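/- As K increases, the functions v_K decrease, and as K → ∞ they converge uniformly on closure(Π) to a continuous function v which is an L_{d+1}-viscosity solution of ∂_t v + H[v] = 0 in Π with boundary condition v = g on ∂'Π. Furthermore, v is the maximal L_{d+1}-viscosity subsolution of class C(closure(Π)) with this boundary condition: v ≥ w for every L_{d+1}-viscosity subsolution w ∈ C(closure(Π)) with w = g on ∂'Π. -/

import Mathlib

open MeasureTheory Filter Metric Set
open scoped Topology ENNReal NNReal InnerProductSpace RealInnerProductSpace

noncomputable section

attribute [local instance] Matrix.normedAddCommGroup Matrix.normedSpace

namespace Krylov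

/-- Euclidean space `ℝ^d`. -/
abbrev E (d : ℕ) := EuclideanSpace ℝ (Fin d)

/-- Type of fully nonlinear operators `H(u', u'', (t,x))`. -/
abbrev Ham (d : ℕ) := E (d + 1) → Matrix (Fin d) (Fin d) ℝ → ℝ × E d → ℝ

def esingle {d : ℕ} (i : Fin d) : E d := EuclideanSpace.single i 1

/-- Assemble `u' = (u'_0, [u'])`. -/
def vcons {d : ℕ} (r : ℝ) (b : E d) : E (d + 1) :=
  (EuclideanSpace.equiv (Fin (d + 1)) ℝ).symm (Fin.cons r (fun i => b i))

/-- The set `𝕊_δ` of symmetric matrices with eigenvalues in `[δ, δ⁻¹]`. -/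
def Sdelta (d : ℕ) (δ : ℝ) : Set (Matrix (Fin d) (Fin d) ℝ) :=
  {a | a.IsSymm ∧ ∀ lam : Fin d → ℝ,
      δ * (∑ i, lam i ^ 2) ≤ ∑ i, ∑ j, a i j * lam i * lam j ∧
      ∑ i, ∑ j, a i j * lam i * lam j ≤ δ⁻¹ * (∑ i, lam i ^ 2)}

/-- Frobenius norm `|u''| = (tr u'' u'')^{1/2}` of a matrix. -/
def frob {d : ℕ} (A : Matrix (Fin d) (Fin d) ℝ) : ℝ :=
  Real.sqrt (∑ i, ∑ j, (A i j) ^ 2)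

/-- Time derivative `∂_t u`. -/
def tderiv {d : ℕ} (u : ℝ × E d → ℝ) (p : ℝ × E d) : ℝ :=
  deriv (fun s => u (s, p.2)) p.1

/-- Spatial gradient `Du`. -/
def sgrad {d : ℕ} (u : ℝ × E d → ℝ) (p : ℝ × E d) : E d :=
  (EuclideanSpace.equiv (Fin d) ℝ).symm (fun i => fderiv ℝ (fun y => u (p.1, y)) p.2 (esingle i))

/-- Spatial Hessian `D²u`. -/
def shess {d : ℕ} (u : ℝ × E d → ℝ) (p : ℝ × E d) : Matrix (Fin d) (Fin d) ℝ :=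
  fun i j => fderiv ℝ (fun y => fderiv ℝ (fun z => u (p.1, z)) y (esingle j)) p.2 (esingle i)

/-- The operator `H[u](t,x) = H(u, Du, D²u, t, x)`. -/
def Hop {d : ℕ} (H : Ham d) (u : ℝ × E d → ℝ) (p : ℝ × E d) : ℝ :=
  H (vcons (u p) (sgrad u p)) (shess u p) p

/-- `C^{1,2}` regularity on a set: pointwise differentiability together with
continuity of `∂_t u`, `Du`, `D²u` on the set. -/
def C12On {d : ℕ} (u : ℝ × E d → ℝ) (Q : Set (ℝ × E d)) : Prop :=
  ContinuousOn u Q ∧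
  (∀ p ∈ Q, DifferentiableAt ℝ (fun s => u (s, p.2)) p.1) ∧
  (∀ p ∈ Q, DifferentiableAt ℝ (fun y => u (p.1, y)) p.2) ∧
  (∀ p ∈ Q, DifferentiableAt ℝ (fun y => fderiv ℝ (fun z => u (p.1, z)) y) p.2) ∧
  ContinuousOn (tderiv u) Q ∧ ContinuousOn (sgrad u) Q ∧ ContinuousOn (shess u) Q

/-- The parabolic cylinder `C_r(t,x) = (t,x) + [0,r²) × B_r`. -/
def cylSet {d : ℕ} (r : ℝ) (p : ℝ × E d) : Set (ℝ × E d) :=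
  Set.Ico p.1 (p.1 + r ^ 2) ×ˢ Metric.ball p.2 r

/-- The domain `Π = [0,T) × Ω`. -/
def PiDom {d : ℕ} (T : ℝ) (Ω : Set (E d)) : Set (ℝ × E d) :=
  Set.Ico 0 T ×ˢ Ω

/-- The parabolic boundary `∂'Π = ({T} × Ω̄) ∪ ([0,T] × ∂Ω)`. -/
def parBdry {d : ℕ} (T : ℝ) (Ω : Set (E d)) : Set (ℝ × E d) :=
  ({T} ×ˢ closure Ω) ∪ (Set.Icc 0 T ×ˢ frontier Ω)

/-- `Ω^ρ = {x : dist(x, Ωᶜ) > ρ}`. -/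
def OmRho {d : ℕ} (ρ : ℝ) (Ω : Set (E d)) : Set (E d) :=
  {x | ρ < Metric.infDist x Ωᶜ}

/-- `Π^ρ = [0, T-ρ²] × Ω^ρ`. -/
def PiRho {d : ℕ} (T ρ : ℝ) (Ω : Set (E d)) : Set (ℝ × E d) :=
  Set.Icc 0 (T - ρ ^ 2) ×ˢ OmRho ρ Ω

/-- The parabolic boundary of the cylinder `C_r(t,x)`. -/
def parCylBdry {d : ℕ} (r : ℝ) (p : ℝ × E d) : Set (ℝ × E d) :=
  ({p.1 + r ^ 2} ×ˢ closure (Metric.ball p.2 r)) ∪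
    (Set.Icc p.1 (p.1 + r ^ 2) ×ˢ Metric.sphere p.2 r)

/-- A bounded domain of class `C^{1,1}`: near every boundary point, `Ω` is the
region above the graph of a differentiable function with Lipschitz gradient. -/
def IsC11Domain {d : ℕ} (Ω : Set (E d)) : Prop :=
  IsOpen Ω ∧ IsConnected Ω ∧ Bornology.IsBounded Ω ∧
  ∀ x ∈ frontier Ω, ∃ r > 0, ∃ ν : E d, ‖ν‖ = 1 ∧ ∃ f : E d → ℝ,
    Differentiable ℝ f ∧ (∃ C : ℝ≥0, LipschitzWith C (fun y => fderiv ℝ f y)) ∧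
    ∀ y ∈ Metric.ball x r, (y ∈ Ω ↔ f (y - x - ⟪y - x, ν⟫_ℝ • ν) < ⟪y - x, ν⟫_ℝ)

/-- Essential supremum (in `EReal`) of `f` over `s`. -/
def pEssSup {d : ℕ} (f : ℝ × E d → ℝ) (s : Set (ℝ × E d)) : EReal :=
  essSup (fun p => (f p : EReal)) (volume.restrict s)

/-- Essential infimum (in `EReal`) of `f` over `s`. -/
def pEssInf {d : ℕ} (f : ℝ × E d → ℝ) (s : Set (ℝ × E d)) : EReal :=
  essInf (fun p => (f p : EReal)) (volume.restrict s)

/-- `C`-viscosity subsolution of `∂_t u + H[u] = 0` in `Q`. -/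
def IsCViscSubsol {d : ℕ} (H : Ham d) (Q : Set (ℝ × E d)) (u : ℝ × E d → ℝ) : Prop :=
  ContinuousOn u Q ∧
  ∀ (p₀ : ℝ × E d) (r : ℝ), 0 < r → closure (cylSet r p₀) ⊆ Q →
    ∀ φ : ℝ × E d → ℝ, C12On φ (cylSet r p₀) →
      IsMaxOn (fun p => u p - φ p) (cylSet r p₀) p₀ →
      (0 : EReal) ≤ Filter.limsup (fun ρ : ℝ =>
        pEssSup (fun p => tderiv φ p + H (vcons (u p) (sgrad φ p)) (shess φ p) p)
          (cylSet ρ p₀)) (𝓝[>] 0)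

/-- `C`-viscosity supersolution of `∂_t u + H[u] = 0` in `Q`. -/
def IsCViscSupersol {d : ℕ} (H : Ham d) (Q : Set (ℝ × E d)) (u : ℝ × E d → ℝ) : Prop :=
  ContinuousOn u Q ∧
  ∀ (p₀ : ℝ × E d) (r : ℝ), 0 < r → closure (cylSet r p₀) ⊆ Q →
    ∀ φ : ℝ × E d → ℝ, C12On φ (cylSet r p₀) →
      IsMinOn (fun p => u p - φ p) (cylSet r p₀) p₀ →
      Filter.liminf (fun ρ : ℝ =>
        pEssInf (fun p => tderiv φ p + H (vcons (u p) (sgrad φ p)) (shess φ p) p)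
          (cylSet ρ p₀)) (𝓝[>] 0) ≤ (0 : EReal)

def IsCViscSol {d : ℕ} (H : Ham d) (Q : Set (ℝ × E d)) (u : ℝ × E d → ℝ) : Prop :=
  IsCViscSubsol H Q u ∧ IsCViscSupersol H Q u

/-- `ut`, `ux`, `uxx` are the generalized (weak) derivatives of `u` on `Q`. -/
def WeakDerivs {d : ℕ} (Q : Set (ℝ × E d)) (u ut : ℝ × E d → ℝ)
    (ux : ℝ × E d → E d) (uxx : ℝ × E d → Matrix (Fin d) (Fin d) ℝ) : Prop :=
  ∀ ψ : ℝ × E d → ℝ, ContDiff ℝ (⊤ : ℕ∞) ψ → HasCompactSupport ψ → tsupport ψ ⊆ interior Q →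
    ((∫ p in Q, u p * fderiv ℝ ψ p ((1 : ℝ), (0 : E d))) = -∫ p in Q, ut p * ψ p) ∧
    (∀ i, (∫ p in Q, u p * fderiv ℝ ψ p ((0 : ℝ), esingle i)) = -∫ p in Q, ux p i * ψ p) ∧
    (∀ i j, (∫ p in Q,
        u p * fderiv ℝ (fun q => fderiv ℝ ψ q ((0 : ℝ), esingle j)) p ((0 : ℝ), esingle i))
      = ∫ p in Q, uxx p i j * ψ p)

def MemLpOn {d : ℕ} (q : ℝ) (Q : Set (ℝ × E d)) (f : ℝ × E d → ℝ) : Prop :=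
  MemLp f (ENNReal.ofReal q) (volume.restrict Q)

/-- `u` together with the derivatives `ut, ux, uxx` is of class `L_q` on `Q`. -/
def LpAll {d : ℕ} (q : ℝ) (Q : Set (ℝ × E d)) (u ut : ℝ × E d → ℝ)
    (ux : ℝ × E d → E d) (uxx : ℝ × E d → Matrix (Fin d) (Fin d) ℝ) : Prop :=
  MemLpOn q Q u ∧ MemLpOn q Q ut ∧ (∀ i, MemLpOn q Q (fun p => ux p i)) ∧
  (∀ i j, MemLpOn q Q (fun p => uxx p i j))

/-- `φ ∈ W^{1,2}_q(Q)` with weak derivatives `φt, φx, φxx`. -/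
def MemW12 {d : ℕ} (q : ℝ) (Q : Set (ℝ × E d)) (φ φt : ℝ × E d → ℝ)
    (φx : ℝ × E d → E d) (φxx : ℝ × E d → Matrix (Fin d) (Fin d) ℝ) : Prop :=
  WeakDerivs Q φ φt φx φxx ∧ LpAll q Q φ φt φx φxx

/-- `L_q`-viscosity subsolution of `∂_t u + H[u] = 0` in `Q`. -/
def IsLqViscSubsol {d : ℕ} (q : ℝ) (H : Ham d) (Q : Set (ℝ × E d)) (u : ℝ × E d → ℝ) : Prop :=
  ContinuousOn u Q ∧
  ∀ (p₀ : ℝ × E d) (r : ℝ), 0 < r → closure (cylSet r p₀) ⊆ Q →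
    ∀ (φ φt : ℝ × E d → ℝ) (φx : ℝ × E d → E d) (φxx : ℝ × E d → Matrix (Fin d) (Fin d) ℝ),
      ContinuousOn φ (cylSet r p₀) → MemW12 q (cylSet r p₀) φ φt φx φxx →
      IsMaxOn (fun p => u p - φ p) (cylSet r p₀) p₀ →
      (0 : EReal) ≤ Filter.limsup (fun ρ : ℝ =>
        pEssSup (fun p => φt p + H (vcons (u p) (φx p)) (φxx p) p) (cylSet ρ p₀)) (𝓝[>] 0)

/-- `L_q`-viscosity supersolution of `∂_t u + H[u] = 0` in `Q`. -/
def IsLqViscSupersol {d : ℕ} (q : ℝ) (H : Ham d) (Q : Set (ℝ × E d)) (u : ℝ × E d → ℝ) : Prop :=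
  ContinuousOn u Q ∧
  ∀ (p₀ : ℝ × E d) (r : ℝ), 0 < r → closure (cylSet r p₀) ⊆ Q →
    ∀ (φ φt : ℝ × E d → ℝ) (φx : ℝ × E d → E d) (φxx : ℝ × E d → Matrix (Fin d) (Fin d) ℝ),
      ContinuousOn φ (cylSet r p₀) → MemW12 q (cylSet r p₀) φ φt φx φxx →
      IsMinOn (fun p => u p - φ p) (cylSet r p₀) p₀ →
      Filter.liminf (fun ρ : ℝ =>
        pEssInf (fun p => φt p + H (vcons (u p) (φx p)) (φxx p) p) (cylSet ρ p₀)) (𝓝[>] 0)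
        ≤ (0 : EReal)

def IsLqViscSol {d : ℕ} (q : ℝ) (H : Ham d) (Q : Set (ℝ × E d)) (u : ℝ × E d → ℝ) : Prop :=
  IsLqViscSubsol q H Q u ∧ IsLqViscSupersol q H Q u

/-- Assumption 2.1: continuity, Lipschitz continuity in `𝐮` with constant `K₀`,
uniform ellipticity (`D_{u''}H ∈ 𝕊_δ`), Hölder regularity in `x` with exponent `γ`,
and boundedness of `H(0,·)` by `Hb`. -/
def AssumptionA {d : ℕ} (δ K₀ γ : ℝ) (H : Ham d) (ω : ℝ → ℝ) (Hb : ℝ) : Prop :=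
  Continuous (fun q : E (d + 1) × Matrix (Fin d) (Fin d) ℝ × (ℝ × E d) => H q.1 q.2.1 q.2.2) ∧
  (∀ u₁ u₂ A₁ A₂ p, |H u₁ A₁ p - H u₂ A₂ p| ≤ K₀ * (‖u₁ - u₂‖ + frob (A₁ - A₂))) ∧
  (∀ (u' : E (d + 1)) (p : ℝ × E d) (A : Matrix (Fin d) (Fin d) ℝ),
    DifferentiableAt ℝ (fun B => H u' B p) A →
    ∃ a ∈ Sdelta d δ, ∀ B, fderiv ℝ (fun B => H u' B p) A B = ∑ i, ∑ j, a i j * B i j) ∧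
  (∀ (u' : E (d + 1)) (A : Matrix (Fin d) (Fin d) ℝ) (t : ℝ) (x y : E d),
    |H u' A (t, x) - H u' A (t, y)| ≤ K₀ * ‖x - y‖ ^ γ * frob A + (‖u'‖ + 1) * ω ‖x - y‖) ∧
  Continuous ω ∧ ω 0 = 0 ∧ (∀ p, |H 0 0 p| ≤ Hb)

/-- `D_{u'_0} H ≤ -1` wherever the derivative exists. -/
def DerU0LeNegOne {d : ℕ} (H : Ham d) : Prop :=
  ∀ (r : ℝ) (b : E d) (A : Matrix (Fin d) (Fin d) ℝ) (p : ℝ × E d),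
    DifferentiableAt ℝ (fun s => H (vcons s b) A p) r →
    deriv (fun s => H (vcons s b) A p) r ≤ -1

/-- Properties of `P`: convex, positively homogeneous of degree one, with
`D_{u''}P ∈ 𝕊_{δ̄}` at points of differentiability. -/
def Pprops (d : ℕ) (δb : ℝ) (P : Matrix (Fin d) (Fin d) ℝ → ℝ) : Prop :=
  ConvexOn ℝ Set.univ P ∧
  (∀ (c : ℝ), 0 ≤ c → ∀ A, P (c • A) = c * P A) ∧
  (∀ A : Matrix (Fin d) (Fin d) ℝ, DifferentiableAt ℝ P A →
    ∃ a ∈ Sdelta d δb, ∀ B, fderiv ℝ P A B = ∑ i, ∑ j, a i j * B i j)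

/-- `u` (with weak derivatives `ut, ux, uxx`) solves
`∂_t u + max(H[u], P[u] - K) = 0` a.e. in `Π` with `u = g` on `∂'Π`, `u ∈ C(Π̄)`. -/
def SolPlus {d : ℕ} (H : Ham d) (P : Matrix (Fin d) (Fin d) ℝ → ℝ) (K T : ℝ) (Ω : Set (E d))
    (g u ut : ℝ × E d → ℝ) (ux : ℝ × E d → E d)
    (uxx : ℝ × E d → Matrix (Fin d) (Fin d) ℝ) : Prop :=
  ContinuousOn u (closure (PiDom T Ω)) ∧
  WeakDerivs (PiDom T Ω) u ut ux uxx ∧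
  (∀ᵐ p ∂(volume.restrict (PiDom T Ω)),
    ut p + max (H (vcons (u p) (ux p)) (uxx p) p) (P (uxx p) - K) = 0) ∧
  Set.EqOn u g (parBdry T Ω)

/-- `u` solves `∂_t u + min(H[u], -P[-u] + K) = 0` a.e. in `Π` with `u = g` on `∂'Π`. -/
def SolMinus {d : ℕ} (H : Ham d) (P : Matrix (Fin d) (Fin d) ℝ → ℝ) (K T : ℝ) (Ω : Set (E d))
    (g u ut : ℝ × E d → ℝ) (ux : ℝ × E d → E d)
    (uxx : ℝ × E d → Matrix (Fin d) (Fin d) ℝ) : Prop :=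
  ContinuousOn u (closure (PiDom T Ω)) ∧
  WeakDerivs (PiDom T Ω) u ut ux uxx ∧
  (∀ᵐ p ∂(volume.restrict (PiDom T Ω)),
    ut p + min (H (vcons (u p) (ux p)) (uxx p) p) (-(P (-(uxx p))) + K) = 0) ∧
  Set.EqOn u g (parBdry T Ω)

/-- Parabolic distance. -/
def parDist {d : ℕ} (p q : ℝ × E d) : ℝ := ‖p.2 - q.2‖ + |p.1 - q.1| ^ ((1 : ℝ) / 2)

/-- `‖u‖_{C^κ(Q)} ≤ C`: bounds on `u`, `Du`, the parabolic Hölder seminorm of order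
`κ-1` of `Du`, and the Hölder seminorm of order `κ/2` of `u` in `t`. -/
def CkappaLE {d : ℕ} (κ : ℝ) (Q : Set (ℝ × E d)) (u : ℝ × E d → ℝ) (C : ℝ) : Prop :=
  (∀ p ∈ Q, |u p| ≤ C) ∧
  (∀ p ∈ Q, DifferentiableAt ℝ (fun y => u (p.1, y)) p.2) ∧
  (∀ p ∈ Q, ‖sgrad u p‖ ≤ C) ∧
  (∀ p ∈ Q, ∀ q ∈ Q, ‖sgrad u p - sgrad u q‖ ≤ C * parDist p q ^ (κ - 1)) ∧
  (∀ p ∈ Q, ∀ q ∈ Q, p.2 = q.2 → |u p - u q| ≤ C * |p.1 - q.1| ^ (κ / 2))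

/-- A nonnegative smooth mollifier, radially symmetric in `x`, supported in
`(-1,0) × B₁`, with unit integral. -/
def StdMollifier {d : ℕ} (ζ : ℝ × E d → ℝ) : Prop :=
  ContDiff ℝ (⊤ : ℕ∞) ζ ∧ HasCompactSupport ζ ∧ (∀ p, 0 ≤ ζ p) ∧
  tsupport ζ ⊆ Set.Ioo (-1 : ℝ) 0 ×ˢ Metric.ball (0 : E d) 1 ∧
  (∀ (t : ℝ) (x y : E d), ‖x‖ = ‖y‖ → ζ (t, x) = ζ (t, y)) ∧
  (∫ p : ℝ × E d, ζ p) = 1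

/-- Parabolic mollification `u^{(ε)} = u * ζ_ε`. -/
def mollify {d : ℕ} (ζ : ℝ × E d → ℝ) (ε : ℝ) (u : ℝ × E d → ℝ) (p : ℝ × E d) : ℝ :=
  ∫ q : ℝ × E d, u (p.1 - ε ^ 2 * q.1, p.2 - ε • q.2) * ζ q

/-- `γ = (7 - 3κ)/(12 - 4κ)`. -/
def gval (κ : ℝ) : ℝ := (7 - 3 * κ) / (12 - 4 * κ)

/-- `ε = ε₀ M^{-1/(κ-1)} K^{-(1-γ)/(2γ)}`. -/
def epsval (κ ε₀ M K : ℝ) : ℝ :=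
  ε₀ * M ^ (-(1 / (κ - 1))) * K ^ (-((1 - gval κ) / (2 * gval κ)))

/-- `η₁⁻¹ = 1 - (2-κ)(1-γ)(2γ)⁻¹`. -/
def eta1 (κ : ℝ) : ℝ := (1 - (2 - κ) * (1 - gval κ) / (2 * gval κ))⁻¹

/-- The function `W(t,x,y)`. -/
def Wfun {d : ℕ} (ζ : ℝ × E d → ℝ) (ν K ε : ℝ) (u v : ℝ × E d → ℝ)
    (q : ℝ × (E d × E d)) : ℝ :=
  u (q.1, q.2.1) - mollify ζ ε u (q.1, q.2.1)
    - (v (q.1, q.2.2) - mollify ζ ε u (q.1, q.2.2)) - ν * K * ‖q.2.1 - q.2.2‖ ^ 2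

/-- The domain of maximization `[0, T-ε²] × (Ω̄^ε)²` for `W`. -/
def Wdom {d : ℕ} (T ε : ℝ) (Ω : Set (E d)) : Set (ℝ × (E d × E d)) :=
  Set.Icc 0 (T - ε ^ 2) ×ˢ (closure (OmRho ε Ω) ×ˢ closure (OmRho ε Ω))

/-- Assumption 4.1 (Assumption B). -/
def AssumptionB {d : ℕ} (δ K₀ : ℝ) (H : Ham d) (Hb : ℝ × E d → ℝ) : Prop :=
  (∀ (r₁ r₂ : ℝ) (b : E d) (A : Matrix (Fin d) (Fin d) ℝ) (p : ℝ × E d),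
    r₁ ≤ r₂ → H (vcons r₂ b) A p ≤ H (vcons r₁ b) A p) ∧
  (∀ ε > (0 : ℝ), ∃ δ' > (0 : ℝ), ∀ (r₁ r₂ : ℝ) (b : E d) (A : Matrix (Fin d) (Fin d) ℝ)
    (p : ℝ × E d), |r₁ - r₂| < δ' → |H (vcons r₁ b) A p - H (vcons r₂ b) A p| < ε) ∧
  (∀ (u' : E (d + 1)) (A : Matrix (Fin d) (Fin d) ℝ), Measurable fun p => H u' A p) ∧
  (∃ L : ℝ, 0 ≤ L ∧ ∀ (r : ℝ) (b₁ b₂ : E d) (A : Matrix (Fin d) (Fin d) ℝ) (p : ℝ × E d),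
    |H (vcons r b₁) A p - H (vcons r b₂) A p| ≤ L * ‖b₁ - b₂‖) ∧
  (∃ L : ℝ, 0 ≤ L ∧ ∀ (u' : E (d + 1)) (A₁ A₂ : Matrix (Fin d) (Fin d) ℝ) (p : ℝ × E d),
    |H u' A₁ p - H u' A₂ p| ≤ L * frob (A₁ - A₂)) ∧
  (∀ (u' : E (d + 1)) (p : ℝ × E d) (A : Matrix (Fin d) (Fin d) ℝ),
    DifferentiableAt ℝ (fun B => H u' B p) A →
    ∃ a ∈ Sdelta d δ, ∀ B, fderiv ℝ (fun B => H u' B p) A B = ∑ i, ∑ j, a i j * B i j) ∧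
  (∀ (u' : E (d + 1)) (p : ℝ × E d), |H u' 0 p| ≤ K₀ * ‖u'‖ + Hb p)

/-- Assumption 4.3 (Assumption C) with parameters `R₀`, `θ`. -/
def AssumptionC {d : ℕ} (δ K₀ R₀ θ : ℝ) (Hb : ℝ × E d → ℝ) (H : Ham d) : Prop :=
  ∃ F : Matrix (Fin d) (Fin d) ℝ → ℝ × E d → ℝ,
    (∀ A, Measurable (F A)) ∧
    (∀ (u' : E (d + 1)) (A : Matrix (Fin d) (Fin d) ℝ) (p : ℝ × E d),
      |H u' A p - F A p| ≤ K₀ * ‖u'‖ + Hb p) ∧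
    (∀ (c : ℝ), 0 ≤ c → ∀ A p, F (c • A) p = c * F A p) ∧
    (∃ L : ℝ, 0 ≤ L ∧ ∀ A₁ A₂ p, |F A₁ p - F A₂ p| ≤ L * frob (A₁ - A₂)) ∧
    (∀ (p : ℝ × E d) (A : Matrix (Fin d) (Fin d) ℝ), DifferentiableAt ℝ (fun B => F B p) A →
      ∃ a ∈ Sdelta d δ, ∀ B, fderiv ℝ (fun B => F B p) A B = ∑ i, ∑ j, a i j * B i j) ∧
    (∀ R : ℝ, 0 < R → R ≤ R₀ → ∀ (p : ℝ × E d) (A : Matrix (Fin d) (Fin d) ℝ),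
      A.IsSymm → frob A = 1 →
      (⨍ q in cylSet R p, |F A q - ⨍ y in Metric.ball p.2 R, F A (q.1, y)|) ≤ θ)

/-- `v` is the maximal `L_q`-viscosity solution of class `C(Π̄)` with boundary datum `g`. -/
def IsMaximalViscSol {d : ℕ} (q : ℝ) (H : Ham d) (T : ℝ) (Ω : Set (E d))
    (g v : ℝ × E d → ℝ) : Prop :=
  ContinuousOn v (closure (PiDom T Ω)) ∧ IsLqViscSol q H (PiDom T Ω) v ∧
  Set.EqOn v g (parBdry T Ω) ∧
  ∀ w : ℝ × E d → ℝ, ContinuousOn w (closure (PiDom T Ω)) →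
    IsLqViscSubsol q H (PiDom T Ω) w → Set.EqOn w g (parBdry T Ω) →
    ∀ p ∈ closure (PiDom T Ω), w p ≤ v p

/-- `v` is the minimal `L_q`-viscosity solution of class `C(Π̄)` with boundary datum `g`. -/
def IsMinimalViscSol {d : ℕ} (q : ℝ) (H : Ham d) (T : ℝ) (Ω : Set (E d))
    (g v : ℝ × E d → ℝ) : Prop :=
  ContinuousOn v (closure (PiDom T Ω)) ∧ IsLqViscSol q H (PiDom T Ω) v ∧
  Set.EqOn v g (parBdry T Ω) ∧
  ∀ w : ℝ × E d → ℝ, ContinuousOn w (closure (PiDom T Ω)) →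
    IsLqViscSupersol q H (PiDom T Ω) w → Set.EqOn w g (parBdry T Ω) →
    ∀ p ∈ closure (PiDom T Ω), v p ≤ w p

/-- The Isaacs operator. -/
def Isaacs {d : ℕ} {A B : Type} (a : A → B → ℝ × E d → Matrix (Fin d) (Fin d) ℝ)
    (b : A → B → E (d + 1) → ℝ × E d → ℝ) : Ham d :=
  fun u' M p => ⨆ α : A, ⨅ β : B, ((∑ i, ∑ j, a α β p i j * M i j) + b α β u' p)

/-- `ℋ₀(ξ, u', t, x) = sup_α inf_β [ξ^{αβ} + b^{αβ}(u',t,x)]`. -/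
def Isaacs0 {d : ℕ} {A B : Type} (b : A → B → E (d + 1) → ℝ × E d → ℝ)
    (ξ : A → B → ℝ) (u' : E (d + 1)) (q : ℝ × E d) : ℝ :=
  ⨆ α : A, ⨅ β : B, (ξ α β + b α β u' q)

/-- `ζ_n(t,x) = n^{d+1} ζ(nt, nx)`. -/
def zetan {d : ℕ} (ζ : ℝ × E d → ℝ) (n : ℕ) (q : ℝ × E d) : ℝ :=
  (n : ℝ) ^ (d + 1) * ζ ((n : ℝ) * q.1, (n : ℝ) • q.2)

/-- `ℋ_n(ξ,u',·) = ℋ₀(ξ,u',·) * ζ_n`. -/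
def IsaacsN {d : ℕ} {A B : Type} (b : A → B → E (d + 1) → ℝ × E d → ℝ)
    (ζ : ℝ × E d → ℝ) (n : ℕ) (ξ : A → B → ℝ) (u' : E (d + 1)) (q : ℝ × E d) : ℝ :=
  ∫ w : ℝ × E d, Isaacs0 b ξ u' (q.1 - w.1, q.2 - w.2) * zetan ζ n w

/-- A Lipschitz function whose directional derivatives are dominated, wherever they exist, by a
function `φ` of the direction has increments dominated by `φ`. -/
lemma LipschitzWith.sub_le_of_fderiv_le {V : Type*} [NormedAddCommGroup V] [NormedSpace ℝ V]
    [FiniteDimensional ℝ V] {f : V → ℝ} {C : ℝ≥0} (hf : LipschitzWith C f) {φ : V → ℝ}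
    (h : ∀ x, DifferentiableAt ℝ f x → ∀ v, fderiv ℝ f x v ≤ φ v) (x y : V) :
    f x - f y ≤ φ (x - y) := by
  borelize V
  set v := x - y
  let μ : Measure V := Measure.addHaar
  have hae : ∀ᵐ p ∂μ, DifferentiableAt ℝ f p := hf.ae_differentiableAt
  have hm : MeasurableSet {q : V × ℝ | DifferentiableAt ℝ f (q.1 + q.2 • v)} := by
    have : Measurable fun q : V × ℝ => q.1 + q.2 • v := by fun_prop
    exact this (measurableSet_of_differentiableAt ℝ f)
  have h1 : ∀ᵐ p ∂μ, ∀ᵐ t ∂(volume : Measure ℝ), DifferentiableAt ℝ f (p + t • v) := by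
    rw [Measure.ae_ae_comm hm]
    refine Eventually.of_forall fun t => ?_
    exact (measurePreserving_add_right μ (t • v)).quasiMeasurePreserving.ae hae
  have h2 : ∀ᵐ p ∂μ, f (p + v) - f p ≤ φ v := by
    filter_upwards [h1] with p hp
    have hg : LipschitzWith (C * ‖v‖₊) fun t : ℝ => f (p + t • v) := by
      refine hf.comp (LipschitzWith.of_dist_le_mul fun s t => ?_)
      rw [dist_add_left, dist_eq_norm, ← sub_smul, norm_smul, dist_eq_norm, mul_comm]
      rfl
    have hac := (hg.lipschitzOnWith (s := uIcc (0 : ℝ) 1)).absolutelyContinuousOnInterval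
    have hi := hac.integral_deriv_eq_sub
    simp only [one_smul, zero_smul, add_zero] at hi
    rw [← hi]
    have hle : ∫ t in (0 : ℝ)..1, deriv (fun t : ℝ => f (p + t • v)) t ≤
        ∫ t in (0 : ℝ)..1, φ v := by
      refine intervalIntegral.integral_mono_ae zero_le_one hac.intervalIntegrable_deriv
        intervalIntegrable_const ?_
      filter_upwards [hp] with t ht
      have hd : HasDerivAt (fun t : ℝ => p + t • v) v t := by
        simpa using ((hasDerivAt_id t).smul_const v).const_add p
      have := (ht.hasFDerivAt.comp_hasDerivAt t hd).deriv
      simp only [Function.comp_def] at this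
      rw [this]
      exact h _ ht v
    simpa using hle
  have hclosed : IsClosed {p : V | f (p + v) - f p ≤ φ v} := by
    have := hf.continuous
    exact isClosed_le (by fun_prop) continuous_const
  have hdense : Dense {p : V | f (p + v) - f p ≤ φ v} := Measure.dense_of_ae h2
  have := hclosed.closure_eq ▸ hdense y
  simpa [v] using this

section Pucci

variable {d : ℕ}

/-- The pairing `∑ a_ij A_ij`. -/
def mdot (a A : Matrix (Fin d) (Fin d) ℝ) : ℝ := ∑ i, ∑ j, a i j * A i j

/-- The maximal Pucci operator of the class `𝕊_δ`. -/
def pucci (δ : ℝ) (A : Matrix (Fin d) (Fin d) ℝ) : ℝ := sSup ((fun a => mdot a A) '' Sdelta d δ)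

lemma mdot_add (a A B : Matrix (Fin d) (Fin d) ℝ) : mdot a (A + B) = mdot a A + mdot a B := by
  simp [mdot, mul_add, Finset.sum_add_distrib]

lemma mdot_smul (a A : Matrix (Fin d) (Fin d) ℝ) (c : ℝ) : mdot a (c • A) = c * mdot a A := by
  simp [mdot, Finset.mul_sum, mul_left_comm]

lemma Sdelta_abs_le {δ : ℝ} (hδ : 0 < δ) {a : Matrix (Fin d) (Fin d) ℝ} (ha : a ∈ Sdelta d δ)
    (i j : Fin d) : |a i j| ≤ 2 * δ⁻¹ := by
  have hq : ∀ k, 0 ≤ a k k ∧ a k k ≤ δ⁻¹ := by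
    intro k
    have := ha.2 (Pi.single k 1)
    simp [Pi.single_apply] at this
    exact ⟨hδ.le.trans this.1, this.2⟩
  have hδ' : 0 < δ⁻¹ := inv_pos.2 hδ
  rcases eq_or_ne i j with rfl | hij
  · rw [abs_of_nonneg (hq i).1]; linarith [(hq i).2]
  have hs : a j i = a i j := ha.1.apply i j
  have key : ∀ s : ℝ, s ^ 2 = 1 → 0 ≤ a i i + a j j + 2 * s * a i j := by
    intro s hs2
    have := (ha.2 (fun k => if k = i then 1 else if k = j then s else 0)).1
    have e : ∑ x, ∑ y, a x y * (if x = i then (1 : ℝ) else if x = j then s else 0) *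
        (if y = i then (1 : ℝ) else if y = j then s else 0) =
        a i i + a j j + 2 * s * a i j := by
      have e1 : ∀ f : Fin d → ℝ, ∑ y, f y * (if y = i then (1 : ℝ) else if y = j then s else 0) =
          f i + s * f j := by
        intro f
        rw [← Finset.sum_subset (Finset.subset_univ {i, j})]
        · rw [Finset.sum_pair hij]; simp [hij.symm, mul_comm]
        · intro x _ hx
          simp only [Finset.mem_insert, Finset.mem_singleton, not_or] at hx
          simp [hx.1, hx.2]
      simp only [e1]
      have e2 : ∀ x, a x i * (if x = i then (1 : ℝ) else if x = j then s else 0) +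
          s * (a x j * (if x = i then (1 : ℝ) else if x = j then s else 0)) =
          (a x i + s * a x j) * (if x = i then (1 : ℝ) else if x = j then s else 0) := by
        intro x; ring
      simp only [e2, e1, hs]
      linear_combination (a j j) * hs2
    rw [e] at this
    refine le_trans (mul_nonneg hδ.le (Finset.sum_nonneg fun _ _ => sq_nonneg _)) this
  have h1 := key 1 (by norm_num)
  have h2 := key (-1) (by norm_num)
  rw [abs_le]
  constructor <;> linarith [(hq i).2, (hq j).2]

lemma abs_mdot_le {δ : ℝ} (hδ : 0 < δ) {a : Matrix (Fin d) (Fin d) ℝ} (ha : a ∈ Sdelta d δ)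
    (A : Matrix (Fin d) (Fin d) ℝ) : |mdot a A| ≤ (d * d * (2 * δ⁻¹)) * ‖A‖ := by
  unfold mdot
  calc |∑ i, ∑ j, a i j * A i j| ≤ ∑ i, ∑ j, |a i j * A i j| :=
        (Finset.abs_sum_le_sum_abs _ _).trans
          (Finset.sum_le_sum fun i _ => Finset.abs_sum_le_sum_abs _ _)
    _ ≤ ∑ _i : Fin d, ∑ _j : Fin d, (2 * δ⁻¹) * ‖A‖ := by
        gcongr with i _ j _
        rw [abs_mul]
        have := Matrix.norm_entry_le_entrywise_sup_norm A (i := i) (j := j)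
        have h0 := Sdelta_abs_le hδ ha i j
        rw [Real.norm_eq_abs] at this
        gcongr
    _ = _ := by simp; ring

lemma one_mem_Sdelta {δ : ℝ} (hδ : 0 < δ) (hδ1 : δ ≤ 1) :
    (1 : Matrix (Fin d) (Fin d) ℝ) ∈ Sdelta d δ := by
  refine ⟨Matrix.isSymm_one, fun l => ?_⟩
  have e : ∑ i, ∑ j, (1 : Matrix (Fin d) (Fin d) ℝ) i j * l i * l j = ∑ i, l i ^ 2 := by
    simp [Matrix.one_apply, sq]
  have h0 : 0 ≤ ∑ i, l i ^ 2 := Finset.sum_nonneg fun _ _ => sq_nonneg _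
  have h1 : 1 ≤ δ⁻¹ := (one_le_inv₀ hδ).2 hδ1
  rw [e]
  constructor <;> nlinarith

lemma bddAbove_pucci {δ : ℝ} (hδ : 0 < δ) (A : Matrix (Fin d) (Fin d) ℝ) :
    BddAbove ((fun a => mdot a A) '' Sdelta d δ) := by
  refine ⟨(d * d * (2 * δ⁻¹)) * ‖A‖, ?_⟩
  rintro _ ⟨a, ha, rfl⟩
  exact (le_abs_self _).trans (abs_mdot_le hδ ha A)

lemma mdot_le_pucci {δ : ℝ} (hδ : 0 < δ) {a : Matrix (Fin d) (Fin d) ℝ} (ha : a ∈ Sdelta d δ)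
    (A : Matrix (Fin d) (Fin d) ℝ) : mdot a A ≤ pucci δ A :=
  le_csSup (bddAbove_pucci hδ A) ⟨a, ha, rfl⟩

lemma pucci_le {δ : ℝ} (hδ : 0 < δ) (hδ1 : δ ≤ 1) {A : Matrix (Fin d) (Fin d) ℝ} {c : ℝ}
    (h : ∀ a ∈ Sdelta d δ, mdot a A ≤ c) : pucci δ A ≤ c := by
  refine csSup_le ⟨_, 1, one_mem_Sdelta hδ hδ1, rfl⟩ ?_
  rintro _ ⟨a, ha, rfl⟩
  exact h a ha

lemma pucci_add_le {δ : ℝ} (hδ : 0 < δ) (hδ1 : δ ≤ 1) (A B : Matrix (Fin d) (Fin d) ℝ) :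
    pucci δ (A + B) ≤ pucci δ A + pucci δ B :=
  pucci_le hδ hδ1 fun a ha => by
    rw [mdot_add]; exact add_le_add (mdot_le_pucci hδ ha A) (mdot_le_pucci hδ ha B)

lemma pucci_smul {δ : ℝ} {c : ℝ} (hc : 0 ≤ c) (A : Matrix (Fin d) (Fin d) ℝ) :
    pucci δ (c • A) = c * pucci δ A := by
  unfold pucci
  simp only [mdot_smul]
  rw [← smul_eq_mul, ← Real.sSup_smul_of_nonneg hc, ← Set.image_smul, Set.image_image]
  rfl

/-- A bound for the norm of the Pucci operator. -/
def puccC (d : ℕ) (δ : ℝ) : ℝ := d * d * (2 * δ⁻¹)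

lemma puccC_nonneg {δ : ℝ} (hδ : 0 < δ) : 0 ≤ puccC d δ := by unfold puccC; positivity

lemma pucci_le_norm {δ : ℝ} (hδ : 0 < δ) (hδ1 : δ ≤ 1) (A : Matrix (Fin d) (Fin d) ℝ) :
    pucci δ A ≤ puccC d δ * ‖A‖ :=
  pucci_le hδ hδ1 fun _ ha => (le_abs_self _).trans (abs_mdot_le hδ ha A)

lemma pucci_sub_le {δ : ℝ} (hδ : 0 < δ) (hδ1 : δ ≤ 1) (A B : Matrix (Fin d) (Fin d) ℝ) :
    pucci δ A - pucci δ B ≤ puccC d δ * ‖A - B‖ := by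
  have h1 := pucci_add_le hδ hδ1 (A - B) B
  have h2 := pucci_le_norm hδ hδ1 (A - B)
  rw [sub_add_cancel] at h1
  linarith

lemma Sdelta_mono {δ δ' : ℝ} (hδ' : 0 < δ') (h : δ' ≤ δ) : Sdelta d δ ⊆ Sdelta d δ' := by
  intro a ha
  refine ⟨ha.1, fun l => ?_⟩
  have h0 : 0 ≤ ∑ i, l i ^ 2 := Finset.sum_nonneg fun _ _ => sq_nonneg _
  have h1 : δ⁻¹ ≤ δ'⁻¹ := inv_anti₀ hδ' h
  exact ⟨(mul_le_mul_of_nonneg_right h h0).trans (ha.2 l).1,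
    (ha.2 l).2.trans (mul_le_mul_of_nonneg_right h1 h0)⟩

lemma pucci_mono {δ δ' : ℝ} (hδ' : 0 < δ') (h : δ' ≤ δ) (hδ1 : δ ≤ 1)
    (A : Matrix (Fin d) (Fin d) ℝ) : pucci δ A ≤ pucci δ' A :=
  pucci_le (hδ'.trans_le h) hδ1 fun _ ha => mdot_le_pucci hδ' (Sdelta_mono hδ' h ha) A

/-- The quadratic form of `A` is nonpositive. -/
def NegSemi (A : Matrix (Fin d) (Fin d) ℝ) : Prop :=
  ∀ ξ : Fin d → ℝ, ∑ i, ∑ j, A i j * ξ i * ξ j ≤ 0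

lemma NegSemi.posSemidef {A : Matrix (Fin d) (Fin d) ℝ} (hs : A.IsSymm) (h : NegSemi A) :
    (-A).PosSemidef := by
  refine Matrix.PosSemidef.of_dotProduct_mulVec_nonneg ?_ fun x => ?_
  · simpa [Matrix.IsHermitian] using hs.eq
  · have e : ∑ i, ∑ j, A i j * x i * x j = x ⬝ᵥ A.mulVec x := by
      simp [dotProduct, Matrix.mulVec, Finset.mul_sum, mul_comm, mul_left_comm]
    have := h x
    rw [e] at this
    simpa [Matrix.neg_mulVec] using this

lemma pucci_le_trace {δ : ℝ} (hδ : 0 < δ) (hδ1 : δ ≤ 1) {A : Matrix (Fin d) (Fin d) ℝ}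
    (hs : A.IsSymm) (h : NegSemi A) : pucci δ A ≤ δ * A.trace := by
  refine pucci_le hδ hδ1 fun a ha => ?_
  obtain ⟨m, B, hB⟩ := Matrix.posSemidef_iff_eq_sum_vecMulVec.1 (h.posSemidef hs)
  have hA : ∀ i j, A i j = -∑ k, B k i * B k j := by
    intro i j
    have := congrFun (congrFun hB i) j
    simp only [Matrix.neg_apply, Matrix.sum_apply, Matrix.vecMulVec_apply, star_trivial] at this
    linarith
  have e1 : mdot a A = -∑ k, ∑ i, ∑ j, a i j * B k i * B k j := by
    unfold mdot
    simp only [hA, mul_neg, Finset.sum_neg_distrib, Finset.mul_sum]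
    rw [neg_inj, Finset.sum_comm (s := Finset.univ (α := Fin m))]
    refine Finset.sum_congr rfl fun i _ => ?_
    rw [Finset.sum_comm]
    simp only [mul_assoc]
  have e2 : A.trace = -∑ k, ∑ i, B k i ^ 2 := by
    simp only [Matrix.trace, Matrix.diag, hA, Finset.sum_neg_distrib, sq]
    rw [Finset.sum_comm]
  rw [e1, e2, mul_neg, neg_le_neg_iff, Finset.mul_sum]
  exact Finset.sum_le_sum fun k _ => (ha.2 (B k)).1

lemma det_neg_le_trace_pow {A : Matrix (Fin d) (Fin d) ℝ} (hs : A.IsSymm) (h : NegSemi A) :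
    0 ≤ (-A).trace ∧ |(-A).det| ≤ (-A).trace ^ d := by
  have hp := h.posSemidef hs
  have hn := hp.eigenvalues_nonneg
  have ht : (-A).trace = ∑ i, hp.1.eigenvalues i := by
    simpa using hp.1.trace_eq_sum_eigenvalues
  have h0 : 0 ≤ (-A).trace := ht ▸ Finset.sum_nonneg fun i _ => hn i
  refine ⟨h0, ?_⟩
  rw [hp.1.det_eq_prod_eigenvalues, ht]
  simp only [RCLike.ofReal_real_eq_id, id]
  rw [abs_of_nonneg (Finset.prod_nonneg fun i _ => hn i)]
  calc ∏ i, hp.1.eigenvalues i ≤ ∏ _i : Fin d, ∑ i, hp.1.eigenvalues i :=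
        Finset.prod_le_prod (fun i _ => hn i) fun i _ =>
          Finset.single_le_sum (f := hp.1.eigenvalues) (fun i _ => hn i) (Finset.mem_univ i)
    _ = _ := by simp

lemma sub_le_pucci {δ : ℝ} (hδ : 0 < δ) {f : Matrix (Fin d) (Fin d) ℝ → ℝ} {C : ℝ≥0}
    (hf : LipschitzWith C f)
    (h : ∀ A, DifferentiableAt ℝ f A →
      ∃ a ∈ Sdelta d δ, ∀ B, fderiv ℝ f A B = ∑ i, ∑ j, a i j * B i j)
    (A B : Matrix (Fin d) (Fin d) ℝ) : f A - f B ≤ pucci δ (A - B) := by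
  refine LipschitzWith.sub_le_of_fderiv_le hf (φ := pucci δ) (fun X hX V => ?_) A B
  obtain ⟨a, ha, hV⟩ := h X hX
  refine (le_of_eq (hV V)).trans ?_
  exact mdot_le_pucci hδ ha V

lemma frob_le {A : Matrix (Fin d) (Fin d) ℝ} : frob A ≤ d * ‖A‖ := by
  unfold frob
  rw [Real.sqrt_le_left (by positivity)]
  calc ∑ i, ∑ j, A i j ^ 2 ≤ ∑ _i : Fin d, ∑ _j : Fin d, ‖A‖ ^ 2 := by
        refine Finset.sum_le_sum fun i _ => Finset.sum_le_sum fun j _ => ?_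
        rw [← sq_abs]
        have := Matrix.norm_entry_le_entrywise_sup_norm A (i := i) (j := j)
        rw [Real.norm_eq_abs] at this
        exact pow_le_pow_left₀ (abs_nonneg _) this 2
    _ = _ := by simp; ring

lemma Pprops.sub_le_pucci {δ : ℝ} (hδ : 0 < δ) {P : Matrix (Fin d) (Fin d) ℝ → ℝ}
    (hP : Pprops d δ P) (A B : Matrix (Fin d) (Fin d) ℝ) : P A - P B ≤ pucci δ (A - B) := by
  obtain ⟨hc, hh, hd⟩ := hP
  have hcont : Continuous P := continuousOn_univ.1 (hc.continuousOn isOpen_univ)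
  have hsub : ∀ A B, P (A + B) ≤ P A + P B := by
    intro A B
    have h1 := hc.2 (mem_univ A) (mem_univ B) (by norm_num : (0 : ℝ) ≤ 1 / 2)
      (by norm_num : (0 : ℝ) ≤ 1 / 2) (by norm_num)
    rw [← smul_add, hh _ (by norm_num)] at h1
    simp only [smul_eq_mul] at h1
    linarith
  obtain ⟨C, hC⟩ := (isCompact_closedBall (0 : Matrix (Fin d) (Fin d) ℝ) 1).bddAbove_image
    hcont.continuousOn
  have hP0 : P 0 = 0 := by simpa using hh 0 le_rfl 0
  have hb : ∀ A, P A ≤ max C 0 * ‖A‖ := by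
    intro A
    rcases eq_or_ne A 0 with rfl | hA
    · simp [hP0]
    have hA' : 0 < ‖A‖ := norm_pos_iff.2 hA
    have h1 : P (‖A‖⁻¹ • A) ≤ C := hC ⟨_, by
      simp [norm_smul, hA'.ne'], rfl⟩
    have h2 : P A = ‖A‖ * P (‖A‖⁻¹ • A) := by
      rw [← hh _ hA'.le, smul_smul, mul_inv_cancel₀ hA'.ne', one_smul]
    rw [h2, mul_comm]
    exact mul_le_mul_of_nonneg_right (h1.trans (le_max_left _ _)) hA'.le
  have hl : ∀ A B, P A - P B ≤ max C 0 * ‖A - B‖ := by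
    intro A B
    have h1 := hsub (A - B) B
    rw [sub_add_cancel] at h1
    linarith [hb (A - B)]
  have hL : LipschitzWith ⟨max C 0, le_max_right _ _⟩ P := by
    refine LipschitzWith.of_dist_le_mul fun A B => ?_
    rw [dist_eq_norm, dist_eq_norm, Real.norm_eq_abs, abs_le]
    change -(max C 0 * _) ≤ _ ∧ _ ≤ max C 0 * _
    have h1 := hl A B
    have h2 := hl B A
    rw [norm_sub_rev] at h2
    constructor <;> linarith
  exact Krylov.sub_le_pucci hδ hL hd A B

end Pucci

section SmoothDerivs

variable {d : ℕ}

lemma inner_esingle_left (i : Fin d) (x : E d) : ⟪(esingle i : E d), x⟫_ℝ = x i := by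
  unfold esingle
  simpa using EuclideanSpace.inner_single_left (𝕜 := ℝ) i 1 x

lemma inner_esingle_right (i : Fin d) (x : E d) : ⟪x, (esingle i : E d)⟫_ℝ = x i := by
  rw [real_inner_comm, inner_esingle_left]

lemma sum_esingle (ξ : E d) : ∑ i, ξ i • (esingle i : E d) = ξ := by
  ext j
  simp [esingle, Pi.single_apply]

/-- Time derivative of a function on space-time. -/
def Dt (u : ℝ × E d → ℝ) (p : ℝ × E d) : ℝ := fderiv ℝ u p ((1 : ℝ), (0 : E d))

/-- Spatial gradient of a function on space-time. -/
def Dx (u : ℝ × E d → ℝ) (p : ℝ × E d) : E d :=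
  WithLp.toLp 2 fun i => fderiv ℝ u p ((0 : ℝ), esingle i)

/-- Spatial Hessian of a function on space-time. -/
def Dxx (u : ℝ × E d → ℝ) (p : ℝ × E d) : Matrix (Fin d) (Fin d) ℝ :=
  fun i j => fderiv ℝ (fun q => fderiv ℝ u q ((0 : ℝ), esingle j)) p ((0 : ℝ), esingle i)

lemma Dx_apply (u : ℝ × E d → ℝ) (p : ℝ × E d) (i : Fin d) :
    Dx u p i = fderiv ℝ u p ((0 : ℝ), esingle i) := rfl

lemma prod_decomp (τ : ℝ) (ξ : E d) :
    ((τ, ξ) : ℝ × E d) = τ • ((1 : ℝ), (0 : E d)) + ∑ i, ξ i • ((0 : ℝ), (esingle i : E d)) := by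
  ext1
  · simp [Prod.fst_sum]
  · simp [Prod.snd_sum, sum_esingle]

lemma fderiv_eq (u : ℝ × E d → ℝ) (p : ℝ × E d) (τ : ℝ) (ξ : E d) :
    fderiv ℝ u p (τ, ξ) = τ * Dt u p + ∑ i, ξ i * Dx u p i := by
  conv_lhs => rw [prod_decomp]
  simp only [map_add, map_sum, map_smul, smul_eq_mul, Dt, Dx_apply]

lemma fderiv_eq_inner (u : ℝ × E d → ℝ) (p : ℝ × E d) (τ : ℝ) (ξ : E d) :
    fderiv ℝ u p (τ, ξ) = τ * Dt u p + ⟪Dx u p, ξ⟫_ℝ := by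
  rw [fderiv_eq, PiLp.inner_apply]
  simp

variable {u v : ℝ × E d → ℝ}

lemma contDiff_fderiv_apply (hu : ContDiff ℝ 2 u) (w : ℝ × E d) :
    ContDiff ℝ 1 fun q => fderiv ℝ u q w :=
  (hu.fderiv_right (m := 1) (by norm_num)).clm_apply contDiff_const

lemma differentiable_fderiv_apply (hu : ContDiff ℝ 2 u) (w : ℝ × E d) :
    Differentiable ℝ fun q => fderiv ℝ u q w :=
  (contDiff_fderiv_apply hu w).differentiable (by norm_num)

lemma contDiff_Dx (hu : ContDiff ℝ 2 u) : ContDiff ℝ 1 (Dx u) :=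
  contDiff_euclidean.2 fun _ => contDiff_fderiv_apply hu _

lemma continuous_Dt (hu : ContDiff ℝ 2 u) : Continuous (Dt u) :=
  (contDiff_fderiv_apply hu _).continuous

lemma continuous_Dx (hu : ContDiff ℝ 2 u) : Continuous (Dx u) := (contDiff_Dx hu).continuous

lemma continuous_Dxx (hu : ContDiff ℝ 2 u) : Continuous (Dxx u) := by
  refine continuous_matrix fun i j => ?_
  exact ((contDiff_fderiv_apply hu _).continuous_fderiv (by norm_num)).clm_apply continuous_const

lemma fderiv_fderiv_eq (hu : ContDiff ℝ 2 u) (p : ℝ × E d) (ξ η : E d) :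
    fderiv ℝ (fun q => fderiv ℝ u q ((0 : ℝ), ξ)) p ((0 : ℝ), η) =
      ∑ i, ∑ j, Dxx u p i j * η i * ξ j := by
  have h1 : (fun q => fderiv ℝ u q ((0 : ℝ), ξ)) =
      fun q => ∑ j, ξ j * fderiv ℝ u q ((0 : ℝ), esingle j) := by
    ext q; rw [fderiv_eq]; simp [Dx_apply]
  rw [h1, fderiv_fun_sum fun j _ => ((differentiable_fderiv_apply hu _) p).const_mul _]
  simp only [_root_.sum_apply]
  rw [Finset.sum_comm]
  refine Finset.sum_congr rfl fun j _ => ?_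
  rw [fderiv_const_mul ((differentiable_fderiv_apply hu _) p), smul_apply,
    fderiv_eq]
  simp only [zero_mul, zero_add, smul_eq_mul, Finset.mul_sum]
  refine Finset.sum_congr rfl fun i _ => ?_
  rw [Dx_apply, Dxx]; ring

lemma Dxx_symm (hu : ContDiff ℝ 2 u) (p : ℝ × E d) : (Dxx u p).IsSymm := by
  ext i j
  have hs : IsSymmSndFDerivAt ℝ u p := hu.contDiffAt.isSymmSndFDerivAt (by simp)
  have hd : DifferentiableAt ℝ (fderiv ℝ u) p :=
    ((hu.fderiv_right (m := 1) (by norm_num)).differentiable (by norm_num)) p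
  have e : ∀ v w : ℝ × E d, fderiv ℝ (fun q => fderiv ℝ u q w) p v =
      fderiv ℝ (fderiv ℝ u) p v w := by
    intro v w
    rw [fderiv_clm_apply hd (differentiableAt_const _)]
    simp
  simp only [Matrix.transpose_apply, Dxx, e]
  exact hs _ _

lemma fderiv_Dx_apply (hu : ContDiff ℝ 2 u) (p : ℝ × E d) (ξ : E d) (j : Fin d) :
    (fderiv ℝ (Dx u) p ((0 : ℝ), ξ)) j = ∑ i, Dxx u p i j * ξ i := by
  have h : HasFDerivAt (Dx u) (fderiv ℝ (Dx u) p) p :=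
    ((contDiff_Dx hu).differentiable (by norm_num) p).hasFDerivAt
  have h2 : HasFDerivAt (fun q => Dx u q j)
      ((EuclideanSpace.proj j : E d →L[ℝ] ℝ).comp (fderiv ℝ (Dx u) p)) p :=
    (EuclideanSpace.proj j : E d →L[ℝ] ℝ).hasFDerivAt.comp p h
  have h3 := h2.fderiv
  have h4 : fderiv ℝ (fun q => Dx u q j) p ((0 : ℝ), ξ) = (fderiv ℝ (Dx u) p ((0 : ℝ), ξ)) j := by
    rw [h3]; rfl
  rw [← h4, fderiv_eq]
  simp only [zero_mul, zero_add]
  refine Finset.sum_congr rfl fun i _ => ?_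
  rw [mul_comm, Dx_apply]; rfl

lemma C2.diff {u : ℝ × E d → ℝ} (hu : ContDiff ℝ 2 u) : Differentiable ℝ u :=
  hu.differentiable (by norm_num)

lemma Dt_add (hu : ContDiff ℝ 2 u) (hv : ContDiff ℝ 2 v) (p : ℝ × E d) :
    Dt (fun q => u q + v q) p = Dt u p + Dt v p := by
  rw [Dt, fderiv_fun_add (C2.diff hu p) (C2.diff hv p)]; rfl

lemma Dx_add (hu : ContDiff ℝ 2 u) (hv : ContDiff ℝ 2 v) (p : ℝ × E d) :
    Dx (fun q => u q + v q) p = Dx u p + Dx v p := by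
  ext i
  rw [Dx_apply, fderiv_fun_add (C2.diff hu p) (C2.diff hv p)]; rfl

lemma Dxx_add (hu : ContDiff ℝ 2 u) (hv : ContDiff ℝ 2 v) (p : ℝ × E d) :
    Dxx (fun q => u q + v q) p = Dxx u p + Dxx v p := by
  ext i j
  have : (fun q => fderiv ℝ (fun q => u q + v q) q ((0 : ℝ), esingle j)) =
      fun q => fderiv ℝ u q ((0 : ℝ), esingle j) + fderiv ℝ v q ((0 : ℝ), esingle j) := by
    ext q; rw [fderiv_fun_add (C2.diff hu q) (C2.diff hv q)]; rfl
  rw [Dxx, this, fderiv_fun_add (differentiable_fderiv_apply hu _ p)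
    (differentiable_fderiv_apply hv _ p)]; rfl

lemma Dt_const_mul (hu : ContDiff ℝ 2 u) (c : ℝ) (p : ℝ × E d) :
    Dt (fun q => c * u q) p = c * Dt u p := by
  rw [Dt, fderiv_const_mul (C2.diff hu p)]; rfl

lemma Dx_const_mul (hu : ContDiff ℝ 2 u) (c : ℝ) (p : ℝ × E d) :
    Dx (fun q => c * u q) p = c • Dx u p := by
  ext i
  rw [Dx_apply, fderiv_const_mul (C2.diff hu p)]; rfl

lemma Dxx_const_mul (hu : ContDiff ℝ 2 u) (c : ℝ) (p : ℝ × E d) :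
    Dxx (fun q => c * u q) p = c • Dxx u p := by
  ext i j
  have : (fun q => fderiv ℝ (fun q => c * u q) q ((0 : ℝ), esingle j)) =
      fun q => c * fderiv ℝ u q ((0 : ℝ), esingle j) := by
    ext q; rw [fderiv_const_mul (C2.diff hu q)]; rfl
  rw [Dxx, this, fderiv_const_mul (differentiable_fderiv_apply hu _ p)]; rfl

lemma Dt_mul (hu : ContDiff ℝ 2 u) (hv : ContDiff ℝ 2 v) (p : ℝ × E d) :
    Dt (fun q => u q * v q) p = u p * Dt v p + v p * Dt u p := by
  rw [Dt, fderiv_fun_mul (C2.diff hu p) (C2.diff hv p)]; rfl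

lemma Dx_mul (hu : ContDiff ℝ 2 u) (hv : ContDiff ℝ 2 v) (p : ℝ × E d) :
    Dx (fun q => u q * v q) p = u p • Dx v p + v p • Dx u p := by
  ext i
  rw [Dx_apply, fderiv_fun_mul (C2.diff hu p) (C2.diff hv p)]; rfl

lemma Dxx_mul (hu : ContDiff ℝ 2 u) (hv : ContDiff ℝ 2 v) (p : ℝ × E d) :
    Dxx (fun q => u q * v q) p = u p • Dxx v p + v p • Dxx u p +
      Matrix.of fun i j => Dx u p i * Dx v p j + Dx v p i * Dx u p j := by
  ext i j
  have : (fun q => fderiv ℝ (fun q => u q * v q) q ((0 : ℝ), esingle j)) =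
      fun q => u q * fderiv ℝ v q ((0 : ℝ), esingle j) +
        v q * fderiv ℝ u q ((0 : ℝ), esingle j) := by
    ext q; rw [fderiv_fun_mul (C2.diff hu q) (C2.diff hv q)]; rfl
  have h1 := differentiable_fderiv_apply hu ((0 : ℝ), esingle j) p
  have h2 := differentiable_fderiv_apply hv ((0 : ℝ), esingle j) p
  rw [Dxx, this, fderiv_fun_add ((C2.diff hu p).fun_mul h2) ((C2.diff hv p).fun_mul h1),
    fderiv_fun_mul (C2.diff hu p) h2, fderiv_fun_mul (C2.diff hv p) h1]
  simp only [_root_.add_apply, smul_apply, smul_eq_mul, Matrix.add_apply,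
    Matrix.smul_apply, Matrix.of_apply, Dx_apply, Dxx]
  ring

lemma Dt_const (c : ℝ) (p : ℝ × E d) : Dt (fun _ => c) p = 0 := by simp [Dt]
lemma Dx_const (c : ℝ) (p : ℝ × E d) : Dx (fun _ => c) p = 0 := by
  ext i; simp [Dx_apply]
lemma Dxx_const (c : ℝ) (p : ℝ × E d) : Dxx (fun _ => c) p = 0 := by
  ext i; simp [Dxx]

/-- Functions of time only. -/
lemma fderiv_time {φ : ℝ → ℝ} (hφ : ContDiff ℝ 2 φ) (p w : ℝ × E d) :
    fderiv ℝ (fun q : ℝ × E d => φ q.1) p w = w.1 * deriv φ p.1 := by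
  have h : HasFDerivAt (fun q : ℝ × E d => φ q.1) _ p :=
    ((hφ.differentiable (by norm_num) p.1).hasFDerivAt).comp p hasFDerivAt_fst
  rw [h.fderiv]
  simp

lemma Dt_time {φ : ℝ → ℝ} (hφ : ContDiff ℝ 2 φ) (p : ℝ × E d) :
    Dt (fun q : ℝ × E d => φ q.1) p = deriv φ p.1 := by
  simp [Dt, fderiv_time hφ]

lemma Dx_time {φ : ℝ → ℝ} (hφ : ContDiff ℝ 2 φ) (p : ℝ × E d) :
    Dx (fun q : ℝ × E d => φ q.1) p = 0 := by
  ext i; simp [Dx_apply, fderiv_time hφ]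

lemma Dxx_time {φ : ℝ → ℝ} (hφ : ContDiff ℝ 2 φ) (p : ℝ × E d) :
    Dxx (fun q : ℝ × E d => φ q.1) p = 0 := by
  ext i; simp [Dxx, fderiv_time hφ]

lemma contDiff_time {φ : ℝ → ℝ} {n : WithTop ℕ∞} (hφ : ContDiff ℝ n φ) :
    ContDiff ℝ n fun q : ℝ × E d => φ q.1 := hφ.comp contDiff_fst

lemma contDiff_normsq (y : E d) {n : WithTop ℕ∞} :
    ContDiff ℝ n fun q : ℝ × E d => ‖q.2 - y‖ ^ 2 :=
  (contDiff_snd.sub contDiff_const).norm_sq ℝ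

lemma fderiv_normsq (y : E d) (p w : ℝ × E d) :
    fderiv ℝ (fun q : ℝ × E d => ‖q.2 - y‖ ^ 2) p w = 2 * ⟪p.2 - y, w.2⟫_ℝ := by
  have h : HasFDerivAt (fun q : ℝ × E d => q.2 - y) (ContinuousLinearMap.snd ℝ ℝ (E d)) p :=
    hasFDerivAt_snd.sub_const y
  rw [h.norm_sq.fderiv]
  simp [inner_sub_left]

lemma Dt_normsq (y : E d) (p : ℝ × E d) : Dt (fun q : ℝ × E d => ‖q.2 - y‖ ^ 2) p = 0 := by
  simp [Dt, fderiv_normsq]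

lemma Dx_normsq (y : E d) (p : ℝ × E d) :
    Dx (fun q : ℝ × E d => ‖q.2 - y‖ ^ 2) p = (2 : ℝ) • (p.2 - y) := by
  ext i
  simp [Dx_apply, fderiv_normsq, inner_esingle_right]

/-- Spatially linear functions. -/
lemma contDiff_inner_snd (y ν : E d) {n : WithTop ℕ∞} :
    ContDiff ℝ n fun q : ℝ × E d => ⟪q.2 - y, ν⟫_ℝ :=
  (contDiff_snd.sub contDiff_const).inner ℝ contDiff_const

lemma fderiv_inner_snd (y ν : E d) (p w : ℝ × E d) :
    fderiv ℝ (fun q : ℝ × E d => ⟪q.2 - y, ν⟫_ℝ) p w = ⟪w.2, ν⟫_ℝ := by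
  have h : HasFDerivAt (fun q : ℝ × E d => q.2 - y) (ContinuousLinearMap.snd ℝ ℝ (E d)) p :=
    hasFDerivAt_snd.sub_const y
  rw [(h.inner ℝ (hasFDerivAt_const ν p)).fderiv]
  simp

lemma Dt_inner_snd (y ν : E d) (p : ℝ × E d) :
    Dt (fun q : ℝ × E d => ⟪q.2 - y, ν⟫_ℝ) p = 0 := by
  simp [Dt, fderiv_inner_snd]

lemma Dx_inner_snd (y ν : E d) (p : ℝ × E d) :
    Dx (fun q : ℝ × E d => ⟪q.2 - y, ν⟫_ℝ) p = ν := by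
  ext i
  simp [Dx_apply, fderiv_inner_snd, inner_esingle_left]

lemma Dxx_inner_snd (y ν : E d) (p : ℝ × E d) :
    Dxx (fun q : ℝ × E d => ⟪q.2 - y, ν⟫_ℝ) p = 0 := by
  ext i j
  simp [Dxx, fderiv_inner_snd]

lemma Dxx_normsq (y : E d) (p : ℝ × E d) :
    Dxx (fun q : ℝ × E d => ‖q.2 - y‖ ^ 2) p = (2 : ℝ) • (1 : Matrix (Fin d) (Fin d) ℝ) := by
  ext i j
  simp only [Dxx, fderiv_normsq]
  have := contDiff_inner_snd (d := d) y (esingle j) (n := 2)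
  rw [fderiv_const_mul (C2.diff this p), smul_apply, fderiv_inner_snd]
  rw [inner_esingle_left]
  simp [esingle, Matrix.one_apply]

/-- Parabolic rescaling. -/
def scaleMap (r : ℝ) (p₀ q : ℝ × E d) : ℝ × E d := (p₀.1 + r ^ 2 * q.1, p₀.2 + r • q.2)

lemma contDiff_scaleMap (r : ℝ) (p₀ : ℝ × E d) {n : WithTop ℕ∞} :
    ContDiff ℝ n (scaleMap r p₀) := by
  unfold scaleMap
  fun_prop

lemma contDiff_scale (hu : ContDiff ℝ 2 u) (r : ℝ) (p₀ : ℝ × E d) :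
    ContDiff ℝ 2 fun q => u (scaleMap r p₀ q) := hu.comp (contDiff_scaleMap r p₀)

lemma fderiv_scale {n : ℝ × E d → ℝ} (hn : Differentiable ℝ n) (r : ℝ) (p₀ p w : ℝ × E d) :
    fderiv ℝ (fun q => n (scaleMap r p₀ q)) p w =
      fderiv ℝ n (scaleMap r p₀ p) (r ^ 2 * w.1, r • w.2) := by
  have h : HasFDerivAt (scaleMap r p₀)
      ((r ^ 2 • ContinuousLinearMap.fst ℝ ℝ (E d)).prod (r • ContinuousLinearMap.snd ℝ ℝ (E d)))
      p := by
    refine HasFDerivAt.prodMk ?_ ?_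
    · exact (hasFDerivAt_fst.const_smul (r ^ 2)).const_add p₀.1
    · exact (hasFDerivAt_snd.const_smul r).const_add p₀.2
  have h2 := (hn (scaleMap r p₀ p)).hasFDerivAt.comp p h
  rw [show (fun q => n (scaleMap r p₀ q)) = n ∘ scaleMap r p₀ from rfl, h2.fderiv]
  rfl

lemma Dt_scale (hu : ContDiff ℝ 2 u) (r : ℝ) (p₀ p : ℝ × E d) :
    Dt (fun q => u (scaleMap r p₀ q)) p = r ^ 2 * Dt u (scaleMap r p₀ p) := by
  rw [Dt, fderiv_scale (C2.diff hu), fderiv_eq]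
  simp

lemma fderiv_scale_esingle (hu : Differentiable ℝ u) (r : ℝ) (p₀ p : ℝ × E d) (i : Fin d) :
    fderiv ℝ (fun q => u (scaleMap r p₀ q)) p ((0 : ℝ), esingle i) =
      r * fderiv ℝ u (scaleMap r p₀ p) ((0 : ℝ), esingle i) := by
  rw [fderiv_scale hu]
  have : ((r ^ 2 * (0 : ℝ), r • esingle i) : ℝ × E d) = r • ((0 : ℝ), esingle i) := by
    ext1 <;> simp
  rw [this, map_smul, smul_eq_mul]

lemma Dx_scale (hu : ContDiff ℝ 2 u) (r : ℝ) (p₀ p : ℝ × E d) :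
    Dx (fun q => u (scaleMap r p₀ q)) p = r • Dx u (scaleMap r p₀ p) := by
  ext i
  rw [Dx_apply, fderiv_scale_esingle (C2.diff hu)]
  rfl

lemma Dxx_scale (hu : ContDiff ℝ 2 u) (r : ℝ) (p₀ p : ℝ × E d) :
    Dxx (fun q => u (scaleMap r p₀ q)) p = r ^ 2 • Dxx u (scaleMap r p₀ p) := by
  ext i j
  simp only [Dxx, fderiv_scale_esingle (C2.diff hu)]
  have h := differentiable_fderiv_apply hu ((0 : ℝ), esingle j)
  have h' : Differentiable ℝ fun q => fderiv ℝ u (scaleMap r p₀ q) ((0 : ℝ), esingle j) :=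
    h.comp ((contDiff_scaleMap r p₀ (n := 1)).differentiable (by norm_num))
  rw [fderiv_const_mul (h' p), smul_apply, fderiv_scale_esingle h]
  simp only [smul_eq_mul, Matrix.smul_apply, Dxx]
  ring

end SmoothDerivs

section ABP

variable {d : ℕ} {u w : ℝ × E d → ℝ}

instance isAddHaarMeasure_volume_prod :
    (volume : Measure (ℝ × E d)).IsAddHaarMeasure := by
  rw [Measure.volume_eq_prod]; infer_instance

lemma hasDerivAt_line (hw : Differentiable ℝ w) (p : ℝ × E d) (ξ : E d) (s : ℝ) :
    HasDerivAt (fun s : ℝ => w (p.1, p.2 + s • ξ))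
      (fderiv ℝ w (p.1, p.2 + s • ξ) ((0 : ℝ), ξ)) s := by
  have h : HasDerivAt (fun s : ℝ => ((p.1, p.2 + s • ξ) : ℝ × E d)) ((0 : ℝ), ξ) s := by
    refine (hasDerivAt_const s p.1).prodMk ?_
    simpa using ((hasDerivAt_id s).smul_const ξ).const_add p.2
  exact (hw _).hasFDerivAt.comp_hasDerivAt s h

/-- First and second order conditions at a spatial local maximum. -/
lemma slice_max (hw : ContDiff ℝ 2 w) {p : ℝ × E d} (h : ∀ᶠ x in 𝓝 p.2, w (p.1, x) ≤ w p) :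
    Dx w p = 0 ∧ NegSemi (Dxx w p) := by
  have hl : ∀ ξ : E d, IsLocalMax (fun s : ℝ => w (p.1, p.2 + s • ξ)) 0 := by
    intro ξ
    have hc : Tendsto (fun s : ℝ => p.2 + s • ξ) (𝓝 0) (𝓝 p.2) := by
      have : Continuous fun s : ℝ => p.2 + s • ξ := by fun_prop
      simpa using this.tendsto 0
    filter_upwards [hc.eventually h] with s hs
    simpa using hs
  have hd1 : ∀ ξ : E d, deriv (fun s : ℝ => w (p.1, p.2 + s • ξ)) =
      fun s => fderiv ℝ w (p.1, p.2 + s • ξ) ((0 : ℝ), ξ) := fun ξ =>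
    funext fun s => (hasDerivAt_line (C2.diff hw) p ξ s).deriv
  have h1 : ∀ ξ : E d, fderiv ℝ w p ((0 : ℝ), ξ) = 0 := by
    intro ξ
    have := (hl ξ).deriv_eq_zero
    rw [hd1] at this
    simpa using this
  refine ⟨?_, fun ξ => ?_⟩
  · ext i; exact h1 _
  · let ξ' : E d := WithLp.toLp 2 ξ
    have hd2 : deriv (deriv (fun s : ℝ => w (p.1, p.2 + s • ξ'))) 0 =
        ∑ i, ∑ j, Dxx w p i j * ξ i * ξ j := by
      rw [hd1, (hasDerivAt_line (differentiable_fderiv_apply hw ((0 : ℝ), ξ')) p ξ' 0).deriv]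
      have := fderiv_fderiv_eq hw p ξ' ξ'
      simpa using this
    rw [← hd2]
    by_contra! hpos
    have hmin := isLocalMin_of_deriv_deriv_pos hpos (hl ξ').deriv_eq_zero
      (hasDerivAt_line (C2.diff hw) p ξ' 0).continuousAt
    have hconst : (fun s : ℝ => w (p.1, p.2 + s • ξ')) =ᶠ[𝓝 0] fun _ => w (p.1, p.2 + (0 : ℝ) • ξ') := by
      filter_upwards [hmin, hl ξ'] with s h1 h2 using le_antisymm h2 h1
    have := hconst.deriv.deriv_eq
    simp at this
    exact hpos.ne' this

lemma time_max (hu : Differentiable ℝ u) {p : ℝ × E d}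
    (h : ∀ᶠ t in 𝓝[>] p.1, u (t, p.2) ≤ u p) : Dt u p ≤ 0 := by
  have hd : HasDerivAt (fun s : ℝ => u (s, p.2)) (Dt u p) p.1 := by
    have h : HasDerivAt (fun s : ℝ => ((s, p.2) : ℝ × E d)) ((1 : ℝ), (0 : E d)) p.1 :=
      (hasDerivAt_id p.1).prodMk (hasDerivAt_const _ _)
    exact (hu _).hasFDerivAt.comp_hasDerivAt p.1 h
  have ht := (hasDerivWithinAt_iff_tendsto_slope' (s := Ioi p.1) (by simp)).1
    (hd.hasDerivWithinAt (s := Ioi p.1))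
  refine le_of_tendsto ht ?_
  filter_upwards [h, self_mem_nhdsWithin] with t ht htp
  rw [slope_def_field]
  exact div_nonpos_of_nonpos_of_nonneg (sub_nonpos.2 ht) (sub_nonneg.2 (le_of_lt htp))

/-- The map of the parabolic Legendre type used in the Aleksandrov estimate. -/
def legMap (u : ℝ × E d → ℝ) (x₀ : E d) (q : ℝ × E d) : ℝ × E d :=
  (u q - ⟪Dx u q, q.2 - x₀⟫_ℝ, Dx u q)

def legDeriv (u : ℝ × E d → ℝ) (x₀ : E d) (q : ℝ × E d) : ℝ × E d →L[ℝ] ℝ × E d :=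
  (fderiv ℝ u q - ((innerSL ℝ (q.2 - x₀)).comp (fderiv ℝ (Dx u) q) +
    (innerSL ℝ (Dx u q)).comp (ContinuousLinearMap.snd ℝ ℝ (E d)))).prod (fderiv ℝ (Dx u) q)

lemma hasFDerivAt_legMap (hu : ContDiff ℝ 2 u) (x₀ : E d) (q : ℝ × E d) :
    HasFDerivAt (legMap u x₀) (legDeriv u x₀ q) q := by
  have hD : HasFDerivAt (Dx u) (fderiv ℝ (Dx u) q) q :=
    ((contDiff_Dx hu).differentiable (by norm_num) q).hasFDerivAt
  refine HasFDerivAt.prodMk ?_ hD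
  refine (C2.diff hu q).hasFDerivAt.sub ?_
  have h := hD.inner ℝ ((hasFDerivAt_snd (p := q)).sub_const x₀)
  refine h.congr_fderiv ?_
  ext z <;> simp [real_inner_comm, add_comm, inner_sub_left]

lemma det_legDeriv (hu : ContDiff ℝ 2 u) (x₀ : E d) (q : ℝ × E d) :
    (legDeriv u x₀ q).det = Dt u q * (Dxx u q).det := by
  let b := (EuclideanSpace.basisFun (Fin d) ℝ).toBasis
  let A : E d →ₗ[ℝ] E d := Matrix.toLin b b (Dxx u q).transpose
  let v : E d := fderiv ℝ (Dx u) q ((1 : ℝ), 0)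
  let f1 : ℝ × E d →ₗ[ℝ] ℝ := -((innerSL ℝ (q.2 - x₀)).toLinearMap ∘ₗ LinearMap.snd ℝ ℝ (E d))
  have hA : ∀ ξ, A ξ = fderiv ℝ (Dx u) q ((0 : ℝ), ξ) := by
    intro ξ
    ext j
    rw [fderiv_Dx_apply hu]
    simp only [A, Matrix.toLin_apply, b, OrthonormalBasis.coe_toBasis,
      EuclideanSpace.basisFun_apply]
    simp [Matrix.mulVec, dotProduct, Pi.single_apply]
  have key : (legDeriv u x₀ q : ℝ × E d →ₗ[ℝ] ℝ × E d) =
      LinearMap.transvection f1 ((1 : ℝ), (0 : E d)) ∘ₗ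
      (LinearMap.prodMap (Dt u q • LinearMap.id) LinearMap.id) ∘ₗ
      LinearMap.transvection (LinearMap.fst ℝ ℝ (E d)) ((0 : ℝ), v) ∘ₗ
      (LinearMap.prodMap LinearMap.id A) := by
    refine LinearMap.ext fun z => ?_
    have hz : fderiv ℝ (Dx u) q z = z.1 • v + A z.2 := by
      rw [hA]
      have : z = z.1 • ((1 : ℝ), (0 : E d)) + ((0 : ℝ), z.2) := by ext1 <;> simp
      conv_lhs => rw [this, map_add, map_smul]
    have hz2 : fderiv ℝ u q z = z.1 * Dt u q + ⟪Dx u q, z.2⟫_ℝ := fderiv_eq_inner u q z.1 z.2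
    ext1
    · simp [legDeriv, LinearMap.transvection.apply, f1, hz, hz2, inner_add_right]
      ring
    · simp [legDeriv, LinearMap.transvection.apply, hz, add_comm]
  rw [ContinuousLinearMap.det, key, LinearMap.det_comp, LinearMap.det_comp, LinearMap.det_comp,
    LinearMap.transvection.det, LinearMap.transvection.det, LinearMap.det_prodMap,
    LinearMap.det_prodMap]
  simp [f1, A]

lemma ennreal_add_pow_le (a b : ℝ≥0∞) (n : ℕ) : (a + b) ^ n ≤ 2 ^ n * (a ^ n + b ^ n) := by
  have h1 : a + b ≤ 2 * max a b := by
    rw [two_mul]; exact add_le_add (le_max_left _ _) (le_max_right _ _)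
  calc (a + b) ^ n ≤ (2 * max a b) ^ n := by gcongr
    _ = 2 ^ n * (max a b) ^ n := mul_pow _ _ _
    _ ≤ _ := by
      gcongr
      rcases max_choice a b with h | h <;> rw [h]
      · exact le_self_add
      · exact le_add_self

/-- The integral of the `(d+1)`-st power of the positive part. -/
def lint (f : ℝ × E d → ℝ) (S : Set (ℝ × E d)) : ℝ≥0∞ :=
  ∫⁻ q in S, ENNReal.ofReal (f q) ^ (d + 1)

lemma lint_mono_set {f : ℝ × E d → ℝ} {S S' : Set (ℝ × E d)} (h : S ⊆ S') :
    lint f S ≤ lint f S' := lintegral_mono_set h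

lemma lint_add_le {f : ℝ × E d → ℝ} {e : ℝ × E d → ℝ} (he : Measurable e) (S : Set (ℝ × E d)) :
    lint (fun q => f q + e q) S ≤ 2 ^ (d + 1) * (lint f S + lint e S) := by
  unfold lint
  rw [← lintegral_add_right _ (by fun_prop), ← lintegral_const_mul' _ _ (by simp)]
  refine lintegral_mono fun q => ?_
  refine le_trans ?_ (ennreal_add_pow_le _ _ _)
  gcongr
  exact ENNReal.ofReal_add_le

lemma lint_const (c : ℝ) (S : Set (ℝ × E d)) :
    lint (fun _ => c) S = ENNReal.ofReal c ^ (d + 1) * volume S := by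
  simp [lint]

/-- The closed box `[t₀, t₀ + T₁] × B̄_R(x₀)`. -/
def box (T₁ R : ℝ) (p₀ : ℝ × E d) : Set (ℝ × E d) :=
  Icc p₀.1 (p₀.1 + T₁) ×ˢ closedBall p₀.2 R

lemma volume_box {T₁ R : ℝ} (hR : 0 ≤ R) (p₀ : ℝ × E d) :
    volume (box T₁ R p₀) =
      ENNReal.ofReal T₁ * (ENNReal.ofReal (R ^ d) * volume (ball (0 : E d) 1)) := by
  rw [box, Measure.volume_eq_prod, Measure.prod_prod, Real.volume_Icc,
    Measure.addHaar_closedBall _ _ hR]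
  simp

lemma omega_pos : 0 < (volume (ball (0 : E d) 1)).toReal :=
  ENNReal.toReal_pos (measure_ball_pos _ _ one_pos).ne' measure_ball_lt_top.ne

/-- The points touched from above by the graph of an affine function cover a cylinder. -/
lemma cylinder_subset_image (hu : ContDiff ℝ 2 u) {Q : Set (ℝ × E d)} (hQ : IsCompact Q)
    {x₀ : E d} {R : ℝ} (hQR : ∀ q ∈ Q, ‖q.2 - x₀‖ ≤ R)
    (hfor : ∀ q ∈ Q, 0 < u q → Q ∈ 𝓝[{p | q.1 ≤ p.1}] q)
    {q₀ : ℝ × E d} (hq₀ : q₀ ∈ Q) {μ : ℝ} (hMμ : R * μ ≤ u q₀ / 4) :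
    Ioo (u q₀ / 4) (u q₀ / 2) ×ˢ ball (0 : E d) μ ⊆
      legMap u x₀ '' {q | q ∈ Q ∧ 0 < u q ∧ ‖Dx u q‖ < μ ∧ Dt u q ≤ 0 ∧ NegSemi (Dxx u q)} := by
  rintro ⟨h, ν⟩ ⟨⟨hh1, hh2⟩, hν⟩
  simp only at hh1 hh2
  replace hν : ‖ν‖ < μ := by simpa using hν
  have hin : ∀ q ∈ Q, |⟪q.2 - x₀, ν⟫_ℝ| ≤ u q₀ / 4 := fun q hq =>
    (abs_real_inner_le_norm _ _).trans <| (mul_le_mul (hQR q hq) hν.le (norm_nonneg _)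
      ((norm_nonneg _).trans (hQR q hq))).trans hMμ
  have hlin : ContDiff ℝ 2 fun q : ℝ × E d => ⟪q.2 - x₀, ν⟫_ℝ := contDiff_inner_snd x₀ ν
  let w : ℝ × E d → ℝ := fun q => u q + (-1) * ⟪q.2 - x₀, ν⟫_ℝ
  have hw : ContDiff ℝ 2 w := hu.add (contDiff_const.mul hlin)
  have hwc : Continuous w := hw.continuous
  let S := Q ∩ {q | h ≤ w q}
  have hS : IsCompact S := hQ.inter_right (isClosed_le continuous_const hwc)
  have hq₀S : q₀ ∈ S := ⟨hq₀, by
    have := (abs_le.1 (hin q₀ hq₀)).2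
    show h ≤ u q₀ + (-1) * _
    linarith⟩
  obtain ⟨q, hqS, hmax⟩ := hS.exists_isMaxOn ⟨_, hq₀S⟩ continuous_fst.continuousOn
  have hposS : ∀ p ∈ S, 0 < u p := by
    rintro p ⟨hp, hp2⟩
    have := (abs_le.1 (hin p hp)).1
    have h3 : h ≤ u p + (-1) * ⟪p.2 - x₀, ν⟫_ℝ := hp2
    linarith
  have hline : ∀ p : ℝ × E d, Tendsto (fun t : ℝ => ((t, p.2) : ℝ × E d)) (𝓝[>] p.1)
      (𝓝[{p' | p.1 ≤ p'.1}] p) := by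
    intro p
    refine tendsto_nhdsWithin_iff.2 ⟨?_, ?_⟩
    · have : Continuous fun t : ℝ => ((t, p.2) : ℝ × E d) := by fun_prop
      exact (this.tendsto p.1).mono_left nhdsWithin_le_nhds
    · filter_upwards [self_mem_nhdsWithin] with t ht using le_of_lt ht
  have hle : ∀ p ∈ Q, 0 < u p → p.1 = q.1 → w p ≤ h := by
    intro p hp hup hpq
    by_contra! hlt
    have h1 := (hline p).eventually (hfor p hp hup)
    have h2 : ∀ᶠ t in 𝓝[>] p.1, h < w (t, p.2) := by
      have := (hline p).eventually ((hwc.continuousAt.eventually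
        (lt_mem_nhds hlt)).filter_mono nhdsWithin_le_nhds)
      exact this
    obtain ⟨t, ⟨ht1, ht2⟩, ht3⟩ := ((h1.and h2).and self_mem_nhdsWithin).exists
    have h4 := hmax (show ((t, p.2) : ℝ × E d) ∈ S from ⟨ht1, ht2.le⟩)
    simp only [mem_ofPred_eq, ← hpq] at h4
    exact absurd h4 (not_le.2 ht3)
  have hqQ := hqS.1
  have huq := hposS q hqS
  have hwq : w q = h := le_antisymm (hle q hqQ huq rfl) hqS.2
  have hslice : ∀ᶠ x in 𝓝 q.2, w (q.1, x) ≤ w q := by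
    have hc : Continuous fun x : E d => ((q.1, x) : ℝ × E d) := by fun_prop
    have ht : Tendsto (fun x : E d => ((q.1, x) : ℝ × E d)) (𝓝 q.2) (𝓝[{p | q.1 ≤ p.1}] q) :=
      tendsto_nhdsWithin_iff.2 ⟨hc.tendsto q.2, Eventually.of_forall fun _ => le_refl q.1⟩
    have hpos : ∀ᶠ x in 𝓝 q.2, 0 < u (q.1, x) :=
      (hc.tendsto q.2).eventually (hu.continuous.continuousAt.eventually (lt_mem_nhds huq))
    filter_upwards [ht.eventually (hfor q hqQ huq), hpos] with x hx hx2
    rw [hwq]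
    exact hle _ hx hx2 rfl
  have htime : ∀ᶠ t in 𝓝[>] q.1, w (t, q.2) ≤ w q := by
    filter_upwards [(hline q).eventually (hfor q hqQ huq), self_mem_nhdsWithin] with t ht1 ht2
    rw [hwq]
    by_contra! hlt
    have h4 : t ≤ q.1 := hmax (show ((t, q.2) : ℝ × E d) ∈ S from ⟨ht1, hlt.le⟩)
    exact absurd h4 (not_le.2 ht2)
  obtain ⟨hDx, hDxx⟩ := slice_max hw hslice
  have hDt := time_max (C2.diff hw) htime
  rw [Dx_add hu (contDiff_const.mul hlin), Dx_const_mul hlin, Dx_inner_snd] at hDx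
  rw [Dxx_add hu (contDiff_const.mul hlin), Dxx_const_mul hlin, Dxx_inner_snd, smul_zero,
    add_zero] at hDxx
  rw [Dt_add hu (contDiff_const.mul hlin), Dt_const_mul hlin, Dt_inner_snd, mul_zero,
    add_zero] at hDt
  have hDx' : Dx u q = ν := by
    rw [neg_one_smul] at hDx
    exact add_neg_eq_zero.1 hDx
  refine ⟨q, ⟨hqQ, huq, by rwa [hDx'], hDt, hDxx⟩, ?_⟩
  unfold legMap
  rw [hDx', ← hwq, real_inner_comm]
  simp only [w]
  congr 1
  ring

lemma measurableSet_contact (hu : ContDiff ℝ 2 u) {Q : Set (ℝ × E d)} (hQ : IsCompact Q) (μ : ℝ) :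
    MeasurableSet
      {q | q ∈ Q ∧ 0 < u q ∧ ‖Dx u q‖ < μ ∧ Dt u q ≤ 0 ∧ NegSemi (Dxx u q)} := by
  have h1 := hu.continuous
  have h2 := continuous_Dx hu
  have h3 := continuous_Dt hu
  have h4 := continuous_Dxx hu
  refine hQ.measurableSet.inter ((isOpen_lt continuous_const h1).measurableSet.inter
    ((isOpen_lt h2.norm continuous_const).measurableSet.inter
    ((isClosed_le h3 continuous_const).measurableSet.inter ?_)))
  have : {q | NegSemi (Dxx u q)} = ⋂ ξ : Fin d → ℝ,
      {q | ∑ i, ∑ j, Dxx u q i j * ξ i * ξ j ≤ 0} := by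
    ext q; simp [NegSemi]
  change MeasurableSet {q | NegSemi (Dxx u q)}
  rw [this]
  refine (isClosed_iInter fun ξ => isClosed_le ?_ continuous_const).measurableSet
  refine continuous_finsetSum _ fun i _ => continuous_finsetSum _ fun j _ => ?_
  exact ((h4.matrix_elem i j).mul continuous_const).mul continuous_const

/-- The constant in the Aleksandrov estimate. -/
def abpN (d : ℕ) (δ B T₁ R : ℝ) : ℝ :=
  4 * R + 4 * (δ⁻¹ ^ d * (2 ^ (d + 1) * (1 + B ^ (d + 1) * (T₁ * (R ^ d *
    (volume (ball (0 : E d) 1)).toReal))))) / (volume (ball (0 : E d) 1)).toReal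

/-- Parabolic Aleksandrov estimate for smooth functions. -/
theorem abp_smooth {δ B T₁ R : ℝ} (hδ : 0 < δ) (hδ1 : δ ≤ 1) (hB : 0 ≤ B) (hT : 0 ≤ T₁)
    (hR : 0 ≤ R) (hu : ContDiff ℝ 2 u) {Q : Set (ℝ × E d)} (hQ : IsCompact Q) {p₀ : ℝ × E d}
    (hQb : Q ⊆ box T₁ R p₀) (hfor : ∀ q ∈ Q, 0 < u q → Q ∈ 𝓝[{p | q.1 ≤ p.1}] q)
    {f : ℝ × E d → ℝ}
    (hf : ∀ q ∈ Q, 0 < u q → 0 ≤ Dt u q + pucci δ (Dxx u q) + B * ‖Dx u q‖ + f q)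
    {μ : ℝ} (hμ : 0 < μ) (hint : lint f (Q ∩ {q | 0 < u q}) ≤ ENNReal.ofReal μ ^ (d + 1)) :
    ∀ q ∈ Q, u q ≤ abpN d δ B T₁ R * μ := by
  intro q hq
  set ω := (volume (ball (0 : E d) 1)).toReal with hω
  have hω0 : 0 < ω := omega_pos
  have hωe : volume (ball (0 : E d) 1) = ENNReal.ofReal ω := by
    rw [hω, ENNReal.ofReal_toReal measure_ball_lt_top.ne]
  set V := T₁ * (R ^ d * ω) with hV
  have hV0 : 0 ≤ V := by positivity
  set C := δ⁻¹ ^ d * (2 ^ (d + 1) * (1 + B ^ (d + 1) * V)) with hC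
  have hC0 : 0 ≤ C := by positivity
  have hN : abpN d δ B T₁ R = 4 * R + 4 * C / ω := rfl
  rw [hN, add_mul]
  have hC1 : 0 ≤ 4 * C / ω * μ := by positivity
  have hR1 : 0 ≤ 4 * R * μ := by positivity
  by_cases hM : u q ≤ 4 * R * μ
  · linarith
  push Not at hM
  have hM0 : 0 < u q := hR1.trans_lt hM
  suffices h : u q / 4 * (μ ^ d * ω) ≤ C * μ ^ (d + 1) by
    have h2 : u q ≤ 4 * C / ω * μ := by
      rw [div_mul_eq_mul_div, le_div_iff₀ hω0]
      have h3 : 0 < μ ^ d := by positivity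
      refine le_of_mul_le_mul_right ?_ h3
      rw [pow_succ] at h
      linarith
    linarith
  set A := {q | q ∈ Q ∧ 0 < u q ∧ ‖Dx u q‖ < μ ∧ Dt u q ≤ 0 ∧ NegSemi (Dxx u q)} with hA
  have hAm : MeasurableSet A := measurableSet_contact hu hQ μ
  have hsub := cylinder_subset_image hu hQ (x₀ := p₀.2)
    (fun p hp => by simpa [dist_eq_norm] using (hQb hp).2) hfor hq (μ := μ) (by linarith)
  have h1 := addHaar_image_le_lintegral_abs_det_fderiv volume hAm
    (fun p _ => (hasFDerivAt_legMap hu p₀.2 p).hasFDerivWithinAt)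
  have h2 : ∫⁻ p in A, ENNReal.ofReal |(legDeriv u p₀.2 p).det| ≤
      ∫⁻ p in A, ENNReal.ofReal (δ⁻¹ ^ d) * ENNReal.ofReal (f p + B * μ) ^ (d + 1) := by
    refine setLIntegral_mono' hAm fun p hp => ?_
    obtain ⟨hpQ, hup, hDx, hDt, hneg⟩ := hp
    have hs := Dxx_symm hu p
    have hpde := hf p hpQ hup
    have htr := pucci_le_trace hδ hδ1 hs hneg
    obtain ⟨ht0, hdet⟩ := det_neg_le_trace_pow hs hneg
    rw [Matrix.trace_neg] at ht0 hdet
    have hF : B * ‖Dx u p‖ ≤ B * μ := mul_le_mul_of_nonneg_left hDx.le hB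
    have habs : |(-Dxx u p).det| = |(Dxx u p).det| := by
      rw [Matrix.det_neg, abs_mul, abs_pow]; simp
    rw [habs] at hdet
    set F := f p + B * μ
    have hδt : 0 ≤ δ * -(Dxx u p).trace := mul_nonneg hδ.le ht0
    have hF0 : 0 ≤ F := by linarith
    rw [det_legDeriv hu, abs_mul, abs_of_nonpos hDt, ← ENNReal.ofReal_pow hF0,
      ← ENNReal.ofReal_mul (by positivity)]
    refine ENNReal.ofReal_le_ofReal ?_
    have h5 : -(Dxx u p).trace ≤ δ⁻¹ * F := by
      rw [inv_mul_eq_div, le_div_iff₀ hδ]; linarith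
    calc -Dt u p * |(Dxx u p).det| ≤ F * (δ⁻¹ * F) ^ d := by
          refine mul_le_mul (by linarith) (hdet.trans (pow_le_pow_left₀ ht0 h5 d))
            (abs_nonneg _) hF0
      _ = δ⁻¹ ^ d * F ^ (d + 1) := by rw [mul_pow, pow_succ]; ring
  have hAQ : A ⊆ Q ∩ {q | 0 < u q} := fun p hp => ⟨hp.1, hp.2.1⟩
  have h3 : ∫⁻ p in A, ENNReal.ofReal (δ⁻¹ ^ d) * ENNReal.ofReal (f p + B * μ) ^ (d + 1) ≤
      ENNReal.ofReal (δ⁻¹ ^ d) * (2 ^ (d + 1) * (ENNReal.ofReal μ ^ (d + 1) +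
        ENNReal.ofReal (B * μ) ^ (d + 1) * ENNReal.ofReal V)) := by
    rw [lintegral_const_mul' _ _ ENNReal.ofReal_ne_top]
    gcongr
    refine (lint_add_le (f := f) (e := fun _ => B * μ) measurable_const A).trans ?_
    gcongr
    · exact (lint_mono_set hAQ).trans hint
    · rw [lint_const]
      gcongr
      refine (measure_mono (hAQ.trans (inter_subset_left.trans hQb))).trans ?_
      rw [volume_box hR, hωe, ← ENNReal.ofReal_mul (by positivity), ← ENNReal.ofReal_mul hT]
  have h4 : volume (Ioo (u q / 4) (u q / 2) ×ˢ ball (0 : E d) μ) =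
      ENNReal.ofReal (u q / 4 * (μ ^ d * ω)) := by
    rw [Measure.volume_eq_prod, Measure.prod_prod, Real.volume_Ioo,
      Measure.addHaar_ball_of_pos _ _ hμ, hωe, ← ENNReal.ofReal_mul (by positivity),
      ← ENNReal.ofReal_mul (by linarith)]
    simp only [finrank_euclideanSpace, Fintype.card_fin]
    congr 2
    ring
  have h5 := ((h4.symm.le.trans (measure_mono hsub)).trans h1).trans (h2.trans h3)
  have h6 : ENNReal.ofReal (δ⁻¹ ^ d) * (2 ^ (d + 1) * (ENNReal.ofReal μ ^ (d + 1) +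
        ENNReal.ofReal (B * μ) ^ (d + 1) * ENNReal.ofReal V)) =
      ENNReal.ofReal (C * μ ^ (d + 1)) := by
    rw [← ENNReal.ofReal_pow hμ.le, ← ENNReal.ofReal_pow (by positivity),
      ← ENNReal.ofReal_mul (by positivity), ← ENNReal.ofReal_add (by positivity) (by positivity),
      show (2 : ℝ≥0∞) = ENNReal.ofReal 2 by simp, ← ENNReal.ofReal_pow (by positivity),
      ← ENNReal.ofReal_mul (by positivity), ← ENNReal.ofReal_mul (by positivity)]
    congr 1
    rw [hC, mul_pow]
    ring
  rw [h6] at h5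
  exact (ENNReal.ofReal_le_ofReal_iff (by positivity)).1 h5

end ABP

section Barrier

variable {d : ℕ} {w g : ℝ × E d → ℝ}

/-- `w` is a supersolution with right-hand side `f` on `S`. -/
def SuperS (δ B : ℝ) (f w : ℝ × E d → ℝ) (S : Set (ℝ × E d)) : Prop :=
  ∀ q ∈ S, 0 ≤ -Dt w q + pucci δ (-Dxx w q) + B * ‖Dx w q‖ + f q

lemma SuperS.mono {δ B : ℝ} {f : ℝ × E d → ℝ} {S S' : Set (ℝ × E d)} (h : SuperS δ B f w S')
    (hS : S ⊆ S') : SuperS δ B f w S := fun q hq => h q (hS hq)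

/-- The Aleksandrov estimate in the form of a comparison principle. -/
theorem abp_compare {δ B T₁ R : ℝ} (hδ : 0 < δ) (hδ1 : δ ≤ 1) (hB : 0 ≤ B) (hT : 0 ≤ T₁)
    (hR : 0 ≤ R) (hg : ContDiff ℝ 2 g) (hw : ContDiff ℝ 2 w) {Q : Set (ℝ × E d)}
    (hQ : IsCompact Q) {p₀ : ℝ × E d} (hQb : Q ⊆ box T₁ R p₀)
    (hfor : ∀ q ∈ Q, w q < g q → Q ∈ 𝓝[{p | q.1 ≤ p.1}] q) {f G : ℝ × E d → ℝ}
    (hf : SuperS δ B f w (Q ∩ {q | w q < g q}))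
    (hG : ∀ q ∈ Q, w q < g q → -G q ≤ Dt g q - pucci δ (-Dxx g q) - B * ‖Dx g q‖)
    {μ : ℝ} (hμ : 0 < μ)
    (hint : lint (fun q => f q + G q) (Q ∩ {q | w q < g q}) ≤ ENNReal.ofReal μ ^ (d + 1)) :
    ∀ q ∈ Q, g q - w q ≤ abpN d δ B T₁ R * μ := by
  have hw' : ContDiff ℝ 2 fun q => (-1) * w q := contDiff_const.mul hw
  have hu : ContDiff ℝ 2 fun q => g q + (-1) * w q := hg.add hw'
  have hpos : ∀ q, 0 < g q + (-1) * w q ↔ w q < g q := fun q => by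
    constructor <;> intro h <;> linarith
  have hset : {q | 0 < g q + (-1) * w q} = {q | w q < g q} := by ext q; exact hpos q
  have := abp_smooth hδ hδ1 hB hT hR hu hQ hQb (fun q hq h => hfor q hq ((hpos q).1 h))
    (f := fun q => f q + G q) (fun q hq h => ?_) hμ (by rwa [hset])
  · intro q hq
    have := this q hq
    linarith
  · have h1 := hf q ⟨hq, (hpos q).1 h⟩
    have h2 := hG q hq ((hpos q).1 h)
    rw [Dt_add hg hw', Dx_add hg hw', Dxx_add hg hw', Dt_const_mul hw, Dx_const_mul hw,
      Dxx_const_mul hw]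
    simp only [neg_one_smul, neg_one_mul]
    have h3 := pucci_add_le hδ hδ1 (Dxx g q + -Dxx w q) (-Dxx g q)
    rw [show Dxx g q + -Dxx w q + -Dxx g q = -Dxx w q by abel] at h3
    have h4 : ‖Dx w q‖ ≤ ‖Dx g q + -Dx w q‖ + ‖Dx g q‖ := by
      have := norm_sub_le (Dx g q + -Dx w q) (Dx g q)
      rwa [show Dx g q + -Dx w q - Dx g q = -Dx w q by abel, norm_neg] at this
    have h5 := mul_le_mul_of_nonneg_left h4 hB
    linarith

lemma pucci_one_le {δ : ℝ} (hδ : 0 < δ) (hδ1 : δ ≤ 1) :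
    pucci δ (1 : Matrix (Fin d) (Fin d) ℝ) ≤ puccC d δ := by
  refine (pucci_le_norm hδ hδ1 _).trans ?_
  refine mul_le_of_le_one_right (puccC_nonneg hδ) ?_
  refine (Matrix.norm_le_iff zero_le_one).2 fun i j => ?_
  rw [Matrix.one_apply]
  split_ifs <;> simp

lemma pucci_neg_outer_le {δ : ℝ} (hδ : 0 < δ) (hδ1 : δ ≤ 1) (z : E d) :
    pucci δ (-(Matrix.of fun i j => z i * z j)) ≤ -(δ * ‖z‖ ^ 2) := by
  refine pucci_le hδ hδ1 fun a ha => ?_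
  have h := (ha.2 z).1
  rw [EuclideanSpace.real_norm_sq_eq]
  simp only [mdot, Matrix.neg_apply, Matrix.of_apply, mul_neg, Finset.sum_neg_distrib,
    neg_le_neg_iff]
  refine h.trans (le_of_eq ?_)
  simp only [mul_assoc]

/-- The paraboloid `ρ² + α (s - t) - |x - y|²`. -/
def bpsi (ρ α : ℝ) (p₀ q : ℝ × E d) : ℝ := ρ ^ 2 + α * (p₀.1 - q.1) + (-1) * ‖q.2 - p₀.2‖ ^ 2

/-- The barrier `e^{-k (s - t)} ψ²`. -/
def bar (ρ α k : ℝ) (p₀ q : ℝ × E d) : ℝ :=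
  Real.exp (-(k * (p₀.1 - q.1))) * (bpsi ρ α p₀ q * bpsi ρ α p₀ q)

/-- The domain `{ψ ≥ 0}` of the barrier. -/
def barDom (ρ α τ : ℝ) (p₀ : ℝ × E d) : Set (ℝ × E d) :=
  {q | p₀.1 - τ ≤ q.1 ∧ q.1 ≤ p₀.1 ∧ 0 ≤ bpsi ρ α p₀ q}

/-- The exponent in the barrier. -/
def bark (d : ℕ) (δ B ρ α τ : ℝ) : ℝ :=
  (2 * α + 4 * puccC d δ + 4 * B * Real.sqrt (ρ ^ 2 + α * τ) + 8 * δ) ^ 2 / (32 * δ * ρ ^ 2)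

lemma contDiff_time_aux (ρ α s : ℝ) : ContDiff ℝ 2 fun t : ℝ => ρ ^ 2 + α * (s - t) := by
  fun_prop

lemma contDiff_exp_aux (k s : ℝ) : ContDiff ℝ 2 fun t : ℝ => Real.exp (-(k * (s - t))) := by
  fun_prop

lemma contDiff_bpsi (ρ α : ℝ) (p₀ : ℝ × E d) : ContDiff ℝ 2 (bpsi ρ α p₀) :=
  (contDiff_time (contDiff_time_aux ρ α p₀.1)).add (contDiff_const.mul (contDiff_normsq p₀.2))

lemma contDiff_bar (ρ α k : ℝ) (p₀ : ℝ × E d) : ContDiff ℝ 2 (bar ρ α k p₀) :=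
  (contDiff_time (contDiff_exp_aux k p₀.1)).mul
    ((contDiff_bpsi ρ α p₀).mul (contDiff_bpsi ρ α p₀))

lemma Dt_bpsi (ρ α : ℝ) (p₀ q : ℝ × E d) : Dt (bpsi ρ α p₀) q = -α := by
  have h1 := contDiff_time (d := d) (contDiff_time_aux ρ α p₀.1)
  have h2 := contDiff_normsq p₀.2 (n := 2)
  unfold bpsi
  rw [Dt_add h1 (contDiff_const.mul h2), Dt_time (contDiff_time_aux ρ α p₀.1),
    Dt_const_mul h2, Dt_normsq]
  have : HasDerivAt (fun t : ℝ => ρ ^ 2 + α * (p₀.1 - t)) (α * (-1)) q.1 :=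
    (((hasDerivAt_id q.1).const_sub p₀.1).const_mul α).const_add _
  rw [this.deriv]
  ring

lemma Dx_bpsi (ρ α : ℝ) (p₀ q : ℝ × E d) :
    Dx (bpsi ρ α p₀) q = (-2 : ℝ) • (q.2 - p₀.2) := by
  have h1 := contDiff_time (d := d) (contDiff_time_aux ρ α p₀.1)
  have h2 := contDiff_normsq p₀.2 (n := 2)
  unfold bpsi
  rw [Dx_add h1 (contDiff_const.mul h2), Dx_time (contDiff_time_aux ρ α p₀.1),
    Dx_const_mul h2, Dx_normsq, zero_add, smul_smul]
  norm_num

lemma Dxx_bpsi (ρ α : ℝ) (p₀ q : ℝ × E d) :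
    Dxx (bpsi ρ α p₀) q = (-2 : ℝ) • (1 : Matrix (Fin d) (Fin d) ℝ) := by
  have h1 := contDiff_time (d := d) (contDiff_time_aux ρ α p₀.1)
  have h2 := contDiff_normsq p₀.2 (n := 2)
  unfold bpsi
  rw [Dxx_add h1 (contDiff_const.mul h2), Dxx_time (contDiff_time_aux ρ α p₀.1),
    Dxx_const_mul h2, Dxx_normsq, zero_add, smul_smul]
  norm_num

lemma Dt_bar (ρ α k : ℝ) (p₀ q : ℝ × E d) :
    Dt (bar ρ α k p₀) q = Real.exp (-(k * (p₀.1 - q.1))) *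
      (k * bpsi ρ α p₀ q ^ 2 - 2 * α * bpsi ρ α p₀ q) := by
  have h1 := contDiff_time (d := d) (contDiff_exp_aux k p₀.1)
  have h2 := contDiff_bpsi ρ α p₀
  unfold bar
  rw [Dt_mul h1 (h2.mul h2), Dt_mul h2 h2, Dt_bpsi, Dt_time (contDiff_exp_aux k p₀.1)]
  have : HasDerivAt (fun t : ℝ => Real.exp (-(k * (p₀.1 - t))))
      (Real.exp (-(k * (p₀.1 - q.1))) * (-(k * (-1)))) q.1 :=
    ((((hasDerivAt_id q.1).const_sub p₀.1).const_mul k).neg).exp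
  rw [this.deriv]
  ring

lemma Dx_bar (ρ α k : ℝ) (p₀ q : ℝ × E d) :
    Dx (bar ρ α k p₀) q = (Real.exp (-(k * (p₀.1 - q.1))) *
      (-4 * bpsi ρ α p₀ q)) • (q.2 - p₀.2) := by
  have h1 := contDiff_time (d := d) (contDiff_exp_aux k p₀.1)
  have h2 := contDiff_bpsi ρ α p₀
  unfold bar
  rw [Dx_mul h1 (h2.mul h2), Dx_mul h2 h2, Dx_bpsi, Dx_time (contDiff_exp_aux k p₀.1)]
  module

lemma Dxx_bar (ρ α k : ℝ) (p₀ q : ℝ × E d) :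
    Dxx (bar ρ α k p₀) q = Real.exp (-(k * (p₀.1 - q.1))) •
      ((-4 * bpsi ρ α p₀ q) • (1 : Matrix (Fin d) (Fin d) ℝ) +
        (8 : ℝ) • Matrix.of fun i j => (q.2 - p₀.2) i * (q.2 - p₀.2) j) := by
  have h1 := contDiff_time (d := d) (contDiff_exp_aux k p₀.1)
  have h2 := contDiff_bpsi ρ α p₀
  unfold bar
  rw [Dxx_mul h1 (h2.mul h2), Dxx_mul h2 h2, Dxx_bpsi, Dx_bpsi, Dxx_time (contDiff_exp_aux k p₀.1),
    Dx_time (contDiff_exp_aux k p₀.1)]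
  ext i j
  simp only [Matrix.add_apply, Matrix.smul_apply, Matrix.of_apply, smul_eq_mul, PiLp.smul_apply,
    PiLp.zero_apply, Matrix.zero_apply]
  ring

lemma norm_sq_le_of_mem_barDom {ρ α τ : ℝ} (hα : 0 ≤ α) {p₀ q : ℝ × E d}
    (hq : q ∈ barDom ρ α τ p₀) : ‖q.2 - p₀.2‖ ^ 2 ≤ ρ ^ 2 + α * τ := by
  obtain ⟨h1, h2, h3⟩ := hq
  unfold bpsi at h3
  nlinarith

lemma bar_subsol {δ B ρ α τ : ℝ} (hδ : 0 < δ) (hδ1 : δ ≤ 1) (hB : 0 ≤ B) (hρ : 0 < ρ)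
    (hα : 0 ≤ α) {p₀ q : ℝ × E d} (hq : q ∈ barDom ρ α τ p₀) :
    0 ≤ Dt (bar ρ α (bark d δ B ρ α τ) p₀) q - pucci δ (-Dxx (bar ρ α (bark d δ B ρ α τ) p₀) q)
      - B * ‖Dx (bar ρ α (bark d δ B ρ α τ) p₀) q‖ := by
  set k := bark d δ B ρ α τ with hk
  set e := Real.exp (-(k * (p₀.1 - q.1)))
  have he : 0 < e := Real.exp_pos _
  set ψ := bpsi ρ α p₀ q with hψ
  have hψ0 : 0 ≤ ψ := hq.2.2
  set z := q.2 - p₀.2 with hz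
  set Rb := Real.sqrt (ρ ^ 2 + α * τ) with hRb
  have hzR : ‖z‖ ≤ Rb := Real.le_sqrt_of_sq_le (norm_sq_le_of_mem_barDom hα hq)
  have hzψ : ‖z‖ ^ 2 = ρ ^ 2 + α * (p₀.1 - q.1) - ψ := by
    simp only [hψ, bpsi, hz]; ring
  have hzψ2 : ρ ^ 2 - ψ ≤ ‖z‖ ^ 2 := by
    have := mul_nonneg hα (sub_nonneg.2 hq.2.1)
    linarith
  rw [Dt_bar, Dx_bar, Dxx_bar]
  have h1 : -(e • ((-4 * ψ) • (1 : Matrix (Fin d) (Fin d) ℝ) +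
      (8 : ℝ) • Matrix.of fun i j => z i * z j)) =
      e • ((4 * ψ) • (1 : Matrix (Fin d) (Fin d) ℝ) +
        (8 : ℝ) • -(Matrix.of fun i j => z i * z j)) := by
    module
  have h2 : pucci δ (e • ((4 * ψ) • (1 : Matrix (Fin d) (Fin d) ℝ) +
        (8 : ℝ) • -(Matrix.of fun i j => z i * z j))) ≤
      e * (4 * ψ * puccC d δ - 8 * (δ * ‖z‖ ^ 2)) := by
    rw [pucci_smul he.le]
    refine mul_le_mul_of_nonneg_left ?_ he.le
    refine (pucci_add_le hδ hδ1 _ _).trans ?_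
    rw [pucci_smul (by positivity), pucci_smul (by norm_num)]
    have h3 := mul_le_mul_of_nonneg_left (pucci_one_le (d := d) hδ hδ1) (by positivity : 0 ≤ 4 * ψ)
    have h4 := pucci_neg_outer_le hδ hδ1 z
    linarith
  have h3 : ‖(e * (-4 * ψ)) • z‖ = e * (4 * ψ * ‖z‖) := by
    rw [norm_smul, Real.norm_eq_abs, abs_mul, abs_of_pos he, abs_mul, abs_of_nonneg hψ0]
    norm_num
    ring
  rw [h1, h3]
  set C := 2 * α + 4 * puccC d δ + 4 * B * Rb with hC
  have hkv : k * (32 * δ * ρ ^ 2) = (C + 8 * δ) ^ 2 := by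
    rw [hk, bark, div_mul_cancel₀ _ (by positivity)]
  have hk0 : 0 ≤ k := by rw [hk, bark]; positivity
  have h5 : 0 ≤ k * ψ ^ 2 - 2 * α * ψ - (4 * ψ * puccC d δ - 8 * (δ * ‖z‖ ^ 2)) -
      B * (4 * ψ * ‖z‖) := by
    have h6 : B * (4 * ψ * ‖z‖) ≤ B * (4 * ψ * Rb) := by gcongr
    have h7 : 8 * δ * (ρ ^ 2 - ψ) ≤ 8 * δ * ‖z‖ ^ 2 := by gcongr
    have h8 : 0 ≤ k * ψ ^ 2 + 8 * δ * ρ ^ 2 - (C + 8 * δ) * ψ := by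
      have h9 : 0 < 32 * δ * ρ ^ 2 := by positivity
      have h10 : 0 ≤ (32 * δ * ρ ^ 2) * (k * ψ ^ 2 + 8 * δ * ρ ^ 2 - (C + 8 * δ) * ψ) := by
        have : (32 * δ * ρ ^ 2) * (k * ψ ^ 2 + 8 * δ * ρ ^ 2 - (C + 8 * δ) * ψ) =
            ((C + 8 * δ) * ψ - 16 * δ * ρ ^ 2) ^ 2 := by
          linear_combination ψ ^ 2 * hkv
        rw [this]
        positivity
      exact nonneg_of_mul_nonneg_right h10 h9
    rw [hC] at h8
    linarith
  have h6 := mul_nonneg he.le h5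
  linarith

/-- Propagation of lower bounds backwards in time through a growing paraboloid. -/
theorem barrier_lower {δ B ρ α τ : ℝ} (hδ : 0 < δ) (hδ1 : δ ≤ 1) (hB : 0 ≤ B) (hρ : 0 < ρ)
    (hα : 0 ≤ α) (hτ : 0 ≤ τ) (hw : ContDiff ℝ 2 w) {p₀ : ℝ × E d}
    (hw0 : ∀ q ∈ barDom ρ α τ p₀, 0 ≤ w q) {f : ℝ × E d → ℝ}
    (hf : SuperS δ B f w (barDom ρ α τ p₀)) {l : ℝ} (hl : 0 ≤ l)
    (hlw : ∀ x, ‖x - p₀.2‖ ≤ ρ → l ≤ w (p₀.1, x)) {μ : ℝ} (hμ : 0 < μ)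
    (hint : lint f (barDom ρ α τ p₀) ≤ ENNReal.ofReal μ ^ (d + 1)) :
    ∀ q ∈ barDom ρ α τ p₀, l / ρ ^ 4 * bar ρ α (bark d δ B ρ α τ) p₀ q -
      abpN d δ B τ (Real.sqrt (ρ ^ 2 + α * τ)) * μ ≤ w q := by
  set k := bark d δ B ρ α τ
  have hψc : Continuous (bpsi ρ α p₀) := (contDiff_bpsi ρ α p₀).continuous
  have hsub : barDom ρ α τ p₀ ⊆ box τ (Real.sqrt (ρ ^ 2 + α * τ)) (p₀.1 - τ, p₀.2) := by
    intro q hq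
    refine ⟨⟨hq.1, by simpa using hq.2.1⟩, ?_⟩
    have h : ‖q.2 - p₀.2‖ ≤ Real.sqrt (ρ ^ 2 + α * τ) :=
      Real.le_sqrt_of_sq_le (norm_sq_le_of_mem_barDom hα hq)
    simpa only [mem_closedBall, dist_eq_norm] using h
  have hclosed : IsClosed (barDom ρ α τ p₀) :=
    (isClosed_le continuous_const continuous_fst).inter
      ((isClosed_le continuous_fst continuous_const).inter (isClosed_le continuous_const hψc))
  have hcomp : IsCompact (barDom ρ α τ p₀) :=
    (isCompact_Icc.prod (isCompact_closedBall _ _)).of_isClosed_subset hclosed hsub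
  have hbar := contDiff_bar ρ α k p₀
  have hg : ContDiff ℝ 2 fun q => l / ρ ^ 4 * bar ρ α k p₀ q := contDiff_const.mul hbar
  have hl' : 0 ≤ l / ρ ^ 4 := by positivity
  intro q hq
  have := abp_compare hδ hδ1 hB hτ (Real.sqrt_nonneg _) hg hw hcomp hsub (f := f) (G := fun _ => 0)
    ?_ (hf.mono inter_subset_left) ?_ hμ ?_ q hq
  · linarith
  · intro q hq hlt
    have hψ : 0 < bpsi ρ α p₀ q := by
      refine lt_of_le_of_ne hq.2.2 fun h0 => ?_
      have : bar ρ α k p₀ q = 0 := by simp [bar, ← h0]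
      rw [this, mul_zero] at hlt
      exact absurd (hw0 q hq) (not_le.2 hlt)
    have ht : q.1 < p₀.1 := by
      refine lt_of_le_of_ne hq.2.1 fun h0 => ?_
      have h1 : bpsi ρ α p₀ q = ρ ^ 2 - ‖q.2 - p₀.2‖ ^ 2 := by
        simp only [bpsi, h0]; ring
      have h2 : bpsi ρ α p₀ q ≤ ρ ^ 2 := by
        rw [h1]; linarith [sq_nonneg ‖q.2 - p₀.2‖]
      have h3 : ‖q.2 - p₀.2‖ ≤ ρ := by
        refine le_of_sq_le_sq ?_ hρ.le
        linarith
      have h4 := hlw q.2 h3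
      rw [← h0] at h4
      have h5 : l / ρ ^ 4 * bar ρ α k p₀ q ≤ l := by
        have : bar ρ α k p₀ q = bpsi ρ α p₀ q ^ 2 := by
          simp only [bar, h0]; simp [sq]
        rw [this, div_mul_eq_mul_div, div_le_iff₀ (by positivity)]
        refine mul_le_mul_of_nonneg_left ?_ hl
        calc bpsi ρ α p₀ q ^ 2 ≤ (ρ ^ 2) ^ 2 := pow_le_pow_left₀ hψ.le h2 2
          _ = ρ ^ 4 := by ring
      exact absurd (h5.trans h4) (not_le.2 hlt)
    have h1 : ∀ᶠ p in 𝓝[{p | q.1 ≤ p.1}] q, 0 < bpsi ρ α p₀ p :=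
      nhdsWithin_le_nhds (hψc.continuousAt.eventually (lt_mem_nhds hψ))
    have h2 : ∀ᶠ p : ℝ × E d in 𝓝[{p | q.1 ≤ p.1}] q, p.1 < p₀.1 :=
      nhdsWithin_le_nhds (continuous_fst.continuousAt.eventually (gt_mem_nhds ht))
    filter_upwards [h1, h2, self_mem_nhdsWithin] with p hp1 hp2 hp3
    exact ⟨hq.1.trans hp3, hp2.le, hp1.le⟩
  · intro q hq _
    rw [Dt_const_mul hbar, Dx_const_mul hbar, Dxx_const_mul hbar, ← smul_neg, pucci_smul hl',
      norm_smul, Real.norm_of_nonneg hl']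
    have := mul_nonneg hl' (bar_subsol hδ hδ1 hB hρ hα hq)
    linarith
  · simp only [add_zero]
    exact (lint_mono_set inter_subset_left).trans hint

end Barrier

section Scaling

variable {d : ℕ} {w f : ℝ × E d → ℝ}

lemma measurableEmbedding_scaleMap {r : ℝ} (hr : r ≠ 0) (p₀ : ℝ × E d) :
    MeasurableEmbedding (scaleMap r p₀) :=
  (((Homeomorph.mulLeft₀ (r ^ 2) (pow_ne_zero 2 hr)).trans (Homeomorph.addLeft p₀.1)).prodCongr
    ((Homeomorph.smulOfNeZero r hr).trans (Homeomorph.addLeft p₀.2))).measurableEmbedding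

lemma map_scaleMap {r : ℝ} (hr : 0 < r) (p₀ : ℝ × E d) :
    Measure.map (scaleMap r p₀) volume = ENNReal.ofReal ((r ^ (d + 2))⁻¹) • volume := by
  have h1 : Measure.map (fun t : ℝ => p₀.1 + r ^ 2 * t) volume =
      ENNReal.ofReal ((r ^ 2)⁻¹) • volume := by
    have : (fun t : ℝ => p₀.1 + r ^ 2 * t) = (fun t => p₀.1 + t) ∘ fun t => r ^ 2 * t := rfl
    rw [this, ← Measure.map_map (by fun_prop) (by fun_prop),
      Real.map_volume_mul_left (by positivity), Measure.map_smul, map_add_left_eq_self,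
      abs_of_pos (by positivity)]
  have h2 : Measure.map (fun x : E d => p₀.2 + r • x) volume =
      ENNReal.ofReal ((r ^ d)⁻¹) • volume := by
    have : (fun x : E d => p₀.2 + r • x) = (fun x => p₀.2 + x) ∘ fun x => r • x := rfl
    rw [this, ← Measure.map_map (by fun_prop) (by fun_prop),
      Measure.map_addHaar_smul _ hr.ne', Measure.map_smul, map_add_left_eq_self,
      abs_of_pos (by positivity), finrank_euclideanSpace_fin]
  have h3 : scaleMap r p₀ = Prod.map (fun t : ℝ => p₀.1 + r ^ 2 * t) fun x => p₀.2 + r • x := rfl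
  rw [h3, Measure.volume_eq_prod, ← Measure.map_prod_map _ _ (by fun_prop) (by fun_prop), h1, h2,
    Measure.prod_smul_left, Measure.prod_smul_right, smul_smul, ← ENNReal.ofReal_mul (by positivity)]
  congr 2
  rw [pow_add]
  field_simp

lemma volume_preimage_scaleMap {r : ℝ} (hr : 0 < r) (p₀ : ℝ × E d) (S : Set (ℝ × E d)) :
    volume (scaleMap r p₀ ⁻¹' S) = ENNReal.ofReal ((r ^ (d + 2))⁻¹) * volume S := by
  rw [← (measurableEmbedding_scaleMap hr.ne' p₀).map_apply, map_scaleMap hr]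
  simp

lemma lint_scale_le {r : ℝ} (hr : 0 < r) (hr1 : r ≤ 1) (p₀ : ℝ × E d) {S S' : Set (ℝ × E d)}
    (h : S ⊆ scaleMap r p₀ ⁻¹' S') :
    lint (fun q => r ^ 2 * f (scaleMap r p₀ q)) S ≤ lint f S' := by
  refine (lint_mono_set h).trans ?_
  have h1 : ∀ q : ℝ × E d, ENNReal.ofReal (r ^ 2 * f (scaleMap r p₀ q)) ^ (d + 1) =
      ENNReal.ofReal ((r ^ 2) ^ (d + 1)) * ENNReal.ofReal (f (scaleMap r p₀ q)) ^ (d + 1) := by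
    intro q
    rw [ENNReal.ofReal_mul (by positivity), mul_pow,
      ENNReal.ofReal_pow (p := r ^ 2) (by positivity)]
  have h2 : ∫⁻ q in scaleMap r p₀ ⁻¹' S', ENNReal.ofReal (f (scaleMap r p₀ q)) ^ (d + 1) =
      ENNReal.ofReal ((r ^ (d + 2))⁻¹) * lint f S' := by
    rw [← (measurableEmbedding_scaleMap hr.ne' p₀).lintegral_map
      (fun q => ENNReal.ofReal (f q) ^ (d + 1)),
      ← (measurableEmbedding_scaleMap hr.ne' p₀).restrict_map, map_scaleMap hr,
      Measure.restrict_smul, lintegral_smul_measure]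
    rfl
  unfold lint at h2 ⊢
  simp only [h1]
  rw [lintegral_const_mul' _ _ ENNReal.ofReal_ne_top, h2, ← mul_assoc,
    ← ENNReal.ofReal_mul (by positivity)]
  refine mul_le_of_le_one_left' ?_
  rw [ENNReal.ofReal_le_one, ← pow_mul, ← div_eq_mul_inv, div_le_one (by positivity)]
  exact pow_le_pow_of_le_one hr.le hr1 (by omega)

lemma SuperS.scale {δ B : ℝ} (hB : 0 ≤ B) (hw : ContDiff ℝ 2 w) {r : ℝ} (hr : 0 < r) (hr1 : r ≤ 1)
    (p₀ : ℝ × E d) {S S' : Set (ℝ × E d)} (h : S ⊆ scaleMap r p₀ ⁻¹' S') (hs : SuperS δ B f w S') :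
    SuperS δ B (fun q => r ^ 2 * f (scaleMap r p₀ q)) (fun q => w (scaleMap r p₀ q)) S := by
  intro q hq
  rw [Dt_scale hw, Dx_scale hw, Dxx_scale hw, ← smul_neg, pucci_smul (by positivity), norm_smul,
    Real.norm_of_nonneg hr.le]
  have h1 := mul_nonneg (sq_nonneg r) (hs _ (h hq))
  have h2 : r ^ 2 * (B * ‖Dx w (scaleMap r p₀ q)‖) ≤ B * (r * ‖Dx w (scaleMap r p₀ q)‖) := by
    have : r ^ 2 ≤ r := by nlinarith
    have h3 : 0 ≤ B * ‖Dx w (scaleMap r p₀ q)‖ := by positivity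
    nlinarith
  linarith

lemma SuperS.const_mul {δ B : ℝ} (hw : ContDiff ℝ 2 w) {c : ℝ} (hc : 0 ≤ c) {S : Set (ℝ × E d)}
    (hs : SuperS δ B f w S) : SuperS δ B (fun q => c * f q) (fun q => c * w q) S := by
  intro q hq
  rw [Dt_const_mul hw, Dx_const_mul hw, Dxx_const_mul hw, ← smul_neg, pucci_smul hc, norm_smul,
    Real.norm_of_nonneg hc]
  have h1 := mul_nonneg hc (hs q hq)
  linarith

lemma lint_const_mul {c : ℝ} (hc : 0 ≤ c) (S : Set (ℝ × E d)) :
    lint (fun q => c * f q) S = ENNReal.ofReal (c ^ (d + 1)) * lint f S := by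
  unfold lint
  rw [← lintegral_const_mul' _ _ ENNReal.ofReal_ne_top]
  refine lintegral_congr fun q => ?_
  rw [ENNReal.ofReal_mul hc, mul_pow, ENNReal.ofReal_pow hc]

end Scaling

section Density

variable {d : ℕ}

lemma abpN_nonneg {δ B T₁ R : ℝ} (hδ : 0 < δ) (hB : 0 ≤ B) (hT : 0 ≤ T₁) (hR : 0 ≤ R) :
    0 ≤ abpN d δ B T₁ R := by
  unfold abpN
  positivity

/-- The open parabolic cylinder centred at `p`. -/
def dcyl (r : ℝ) (p : ℝ × E d) : Set (ℝ × E d) :=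
  Ioo (p.1 - r ^ 2) (p.1 + r ^ 2) ×ˢ ball p.2 r

/-- A nonnegative supersolution which exceeds `1` on most of the unit cylinder is bounded below at
its bottom. -/
lemma density_bottom {δ B : ℝ} (hδ : 0 < δ) (hδ1 : δ ≤ 1) (hB : 0 ≤ B) :
    ∃ μ₀ > (0 : ℝ), ∃ c₀ > (0 : ℝ), ∀ w f : ℝ × E d → ℝ, ContDiff ℝ 2 w →
      (∀ q ∈ box (1 / 2) 1 ((-(1 / 2) : ℝ), (0 : E d)), 0 ≤ w q) →
      SuperS δ B f w (box (1 / 2) 1 ((-(1 / 2) : ℝ), (0 : E d))) →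
      volume ({q | w q ≤ 1} ∩ dcyl 1 (0 : ℝ × E d)) ≤ ENNReal.ofReal μ₀ →
      lint f (box (1 / 2) 1 ((-(1 / 2) : ℝ), (0 : E d))) ≤ ENNReal.ofReal c₀ →
      ∀ x : E d, ‖x‖ ≤ 1 / 2 → 1 / 8 ≤ w (-(1 / 2), x) := by
  set N := abpN d δ B (1 / 2) 1 with hN
  have hN0 : 0 ≤ N := abpN_nonneg hδ hB (by norm_num) zero_le_one
  set G := 1 + 2 * puccC d δ + 2 * B with hG
  have hG0 : 0 < G := by have := puccC_nonneg (d := d) hδ; positivity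
  set μ := 1 / (8 * (N + 1)) with hμ
  have hμ0 : 0 < μ := by positivity
  set c₀ := μ ^ (d + 1) / 2 ^ (d + 2) with hc₀
  refine ⟨c₀ / G ^ (d + 1), by positivity, c₀, by positivity, ?_⟩
  intro w f hw hw0 hf hvol hlint x hx
  set g : ℝ × E d → ℝ := fun q => (-1) * q.1 + (-1) * ‖q.2 - 0‖ ^ 2 with hg
  have ht : ContDiff ℝ 2 fun t : ℝ => (-1) * t := by fun_prop
  have hg1 := contDiff_time (d := d) ht
  have hg2 := contDiff_normsq (0 : E d) (n := 2)
  have hg2' : ContDiff ℝ 2 fun q : ℝ × E d => (-1) * ‖q.2 - 0‖ ^ 2 := contDiff_const.mul hg2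
  have hgC : ContDiff ℝ 2 g := hg1.add hg2'
  set Q : Set (ℝ × E d) := {q | -(1 / 2) ≤ q.1 ∧ 0 ≤ g q} with hQ
  have hgq : ∀ q, g q = -q.1 - ‖q.2‖ ^ 2 := fun q => by simp [hg]; ring
  have hQmem : ∀ q ∈ Q, -(1 / 2) ≤ q.1 ∧ q.1 ≤ 0 ∧ ‖q.2‖ ^ 2 ≤ 1 / 2 ∧ ‖q.2‖ < 1 := by
    intro q hq
    have h1 : -(1 / 2) ≤ q.1 := hq.1
    have h2 : 0 ≤ g q := hq.2
    rw [hgq] at h2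
    have h3 := sq_nonneg ‖q.2‖
    refine ⟨h1, by linarith, by linarith, ?_⟩
    nlinarith [norm_nonneg q.2]
  have hsub : Q ⊆ box (1 / 2) 1 ((-(1 / 2) : ℝ), (0 : E d)) := by
    intro q hq
    obtain ⟨h1, h2, -, h4⟩ := hQmem q hq
    refine ⟨⟨h1, ?_⟩, ?_⟩
    · simpa using h2
    · simpa using h4.le
  have hclosed : IsClosed Q := (isClosed_le continuous_const continuous_fst).inter
    (isClosed_le continuous_const hgC.continuous)
  have hcomp : IsCompact Q := (isCompact_Icc.prod (isCompact_closedBall _ _)).of_isClosed_subset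
    hclosed hsub
  have hxQ : ((-(1 / 2) : ℝ), x) ∈ Q := by
    refine ⟨le_rfl, ?_⟩
    rw [hgq]
    have : ‖x‖ ^ 2 ≤ (1 / 2) ^ 2 := by gcongr
    norm_num at this ⊢
    linarith
  have := abp_compare hδ hδ1 hB (by norm_num) zero_le_one hgC hw hcomp hsub (f := f)
    (G := fun _ => G) ?_ (hf.mono (inter_subset_left.trans hsub)) ?_ hμ0 ?_ _ hxQ
  · rw [hgq] at this
    have h2 : ‖x‖ ^ 2 ≤ (1 / 2) ^ 2 := by gcongr
    have h3 : N * μ ≤ 1 / 8 := by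
      rw [hμ, mul_one_div, div_le_div_iff₀ (by positivity) (by norm_num)]
      linarith
    norm_num at this h2 h3 ⊢
    linarith
  · intro q hq hlt
    have hgpos : 0 < g q := (hw0 q (hsub hq)).trans_lt hlt
    have h1 : ∀ᶠ p in 𝓝[{p | q.1 ≤ p.1}] q, 0 < g p :=
      nhdsWithin_le_nhds (hgC.continuous.continuousAt.eventually (lt_mem_nhds hgpos))
    filter_upwards [h1, self_mem_nhdsWithin] with p hp1 hp2
    have hp2' : q.1 ≤ p.1 := hp2
    exact ⟨(hQmem q hq).1.trans hp2', hp1.le⟩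
  · intro q hq _
    obtain ⟨-, -, -, h4⟩ := hQmem q hq
    rw [hg, Dt_add hg1 hg2', Dx_add hg1 hg2', Dxx_add hg1 hg2', Dt_time ht, Dx_time ht,
      Dxx_time ht, Dt_const_mul hg2, Dx_const_mul hg2, Dxx_const_mul hg2, Dt_normsq, Dx_normsq,
      Dxx_normsq]
    have hd : deriv (fun t : ℝ => (-1) * t) q.1 = -1 := by
      rw [deriv_const_mul _ differentiableAt_id]; simp
    rw [hd]
    have h5 : -(0 + (-1 : ℝ) • (2 : ℝ) • (1 : Matrix (Fin d) (Fin d) ℝ)) =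
        (2 : ℝ) • (1 : Matrix (Fin d) (Fin d) ℝ) := by module
    rw [h5, pucci_smul (by norm_num), zero_add, sub_zero, norm_smul, norm_smul]
    have h6 := pucci_one_le (d := d) hδ hδ1
    have h7 : B * (‖(-1 : ℝ)‖ * (‖(2 : ℝ)‖ * ‖q.2‖)) ≤ 2 * B := by
      norm_num
      nlinarith
    rw [hG]
    linarith
  · have hQ1 : lint f (Q ∩ {q | w q < g q}) ≤ ENNReal.ofReal c₀ :=
      (lint_mono_set (inter_subset_left.trans hsub)).trans hlint
    have hQ2 : lint (fun _ => G) (Q ∩ {q | w q < g q}) ≤ ENNReal.ofReal c₀ := by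
      rw [lint_const]
      have : Q ∩ {q | w q < g q} ⊆ {q | w q ≤ 1} ∩ dcyl 1 (0 : ℝ × E d) := by
        rintro q ⟨hq, hlt⟩
        have hlt' : w q < g q := hlt
        obtain ⟨h1, h2, h3, h4⟩ := hQmem q hq
        refine ⟨?_, ⟨?_, ?_⟩, ?_⟩
        · change w q ≤ 1
          rw [hgq] at hlt'
          have := sq_nonneg ‖q.2‖
          linarith
        · simp; linarith
        · simp; linarith
        · simpa using h4
      calc ENNReal.ofReal G ^ (d + 1) * volume (Q ∩ {q | w q < g q})
          ≤ ENNReal.ofReal G ^ (d + 1) * ENNReal.ofReal (c₀ / G ^ (d + 1)) := by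
            gcongr
            exact (measure_mono this).trans hvol
        _ = ENNReal.ofReal c₀ := by
            rw [← ENNReal.ofReal_pow hG0.le, ← ENNReal.ofReal_mul (by positivity)]
            congr 1
            field_simp
    refine (lint_add_le measurable_const _).trans ?_
    calc 2 ^ (d + 1) * (lint f (Q ∩ {q | w q < g q}) + lint (fun _ => G) (Q ∩ {q | w q < g q}))
        ≤ 2 ^ (d + 1) * (ENNReal.ofReal c₀ + ENNReal.ofReal c₀) := by gcongr
      _ = ENNReal.ofReal μ ^ (d + 1) := by
          rw [← ENNReal.ofReal_add (by positivity) (by positivity), ← ENNReal.ofReal_pow hμ0.le,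
            show (2 : ℝ≥0∞) ^ (d + 1) = ENNReal.ofReal (2 ^ (d + 1)) by
              rw [ENNReal.ofReal_pow (by norm_num)]; simp,
            ← ENNReal.ofReal_mul (by positivity)]
          congr 1
          rw [hc₀]
          field_simp
          ring

/-- The radius of the domain of dependence in the density lemma. -/
def dR (m : ℝ) : ℝ := Real.sqrt ((1 / 2) ^ 2 + 3 * (7 / 2 + 8 * m))

lemma three_le_dR {m : ℝ} (hm : 0 ≤ m) : 3 ≤ dR m := by
  refine Real.le_sqrt_of_sq_le ?_
  norm_num
  linarith

lemma density_unit {δ B : ℝ} (hδ : 0 < δ) (hδ1 : δ ≤ 1) (hB : 0 ≤ B) :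
    ∃ μ₀ > (0 : ℝ), ∀ m : ℝ, 0 ≤ m → ∃ c > (0 : ℝ), c ≤ 1 ∧
      ∀ w f : ℝ × E d → ℝ, ContDiff ℝ 2 w →
      (∀ q ∈ box (5 + 8 * m) (dR m) ((-(4 + 8 * m) : ℝ), (0 : E d)), 0 ≤ w q) →
      SuperS δ B f w (box (5 + 8 * m) (dR m) ((-(4 + 8 * m) : ℝ), (0 : E d))) →
      volume ({q | w q ≤ 1} ∩ dcyl 1 (0 : ℝ × E d)) ≤ ENNReal.ofReal μ₀ →
      lint f (box (5 + 8 * m) (dR m) ((-(4 + 8 * m) : ℝ), (0 : E d))) ≤ ENNReal.ofReal c →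
      ∀ q : ℝ × E d, -(4 + 8 * m) ≤ q.1 → q.1 ≤ -4 → ‖q.2‖ ≤ 2 → c ≤ w q := by
  obtain ⟨μ₀, hμ₀, c₀, hc₀, hbot⟩ := density_bottom (d := d) hδ hδ1 hB
  refine ⟨μ₀, hμ₀, fun m hm => ?_⟩
  set τ := 7 / 2 + 8 * m with hτ
  have hτ0 : 0 ≤ τ := by positivity
  set N := abpN d δ B τ (dR m) with hN
  have hR3 := three_le_dR hm
  have hN0 : 0 ≤ N := abpN_nonneg hδ hB hτ0 (by linarith)
  set k := bark d δ B (1 / 2) 3 τ with hk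
  have hk0 : 0 ≤ k := by rw [hk, bark]; positivity
  set c₁ := Real.exp (-(k * τ)) with hc₁
  have hc₁0 : 0 < c₁ := Real.exp_pos _
  have hc₁1 : c₁ ≤ 1 := Real.exp_le_one_iff.2 (by have := mul_nonneg hk0 hτ0; linarith)
  set μ := c₁ / (N + 1) with hμ
  have hμ0 : 0 < μ := by positivity
  refine ⟨min c₁ (min c₀ (μ ^ (d + 1))), by positivity, (min_le_left _ _).trans hc₁1, ?_⟩
  intro w f hw hw0 hf hvol hlint q hq1 hq2 hq3
  have hsub1 : box (1 / 2) 1 ((-(1 / 2) : ℝ), (0 : E d)) ⊆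
      box (5 + 8 * m) (dR m) ((-(4 + 8 * m) : ℝ), (0 : E d)) := by
    refine prod_mono (Icc_subset_Icc ?_ ?_) (closedBall_subset_closedBall ?_)
    · dsimp only; linarith
    · dsimp only; linarith
    · linarith
  have h1 := hbot w f hw (fun q hq => hw0 q (hsub1 hq)) (hf.mono hsub1) hvol
    ((lint_mono_set hsub1).trans (hlint.trans (ENNReal.ofReal_le_ofReal
      ((min_le_right _ _).trans (min_le_left _ _)))))
  have hsub2 : barDom (1 / 2) 3 τ ((-(1 / 2) : ℝ), (0 : E d)) ⊆
      box (5 + 8 * m) (dR m) ((-(4 + 8 * m) : ℝ), (0 : E d)) := by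
    intro p hp
    have hn := norm_sq_le_of_mem_barDom (by norm_num) hp
    obtain ⟨hp1, hp2, -⟩ := hp
    dsimp only at hp1 hp2 hn
    refine ⟨⟨?_, ?_⟩, ?_⟩
    · dsimp only; linarith
    · dsimp only; linarith
    · have h : ‖p.2 - 0‖ ≤ dR m := Real.le_sqrt_of_sq_le hn
      simpa only [mem_closedBall, dist_eq_norm] using h
  have hψ : 1 ≤ bpsi (1 / 2) 3 ((-(1 / 2) : ℝ), (0 : E d)) q := by
    have : ‖q.2‖ ^ 2 ≤ 2 ^ 2 := by gcongr
    simp only [bpsi, sub_zero]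
    linarith
  have hqd : q ∈ barDom (1 / 2) 3 τ ((-(1 / 2) : ℝ), (0 : E d)) := by
    refine ⟨?_, ?_, by linarith⟩
    · dsimp only; linarith
    · dsimp only; linarith
  have h2 := barrier_lower hδ hδ1 hB (by norm_num) (by norm_num) hτ0 hw
    (fun p hp => hw0 p (hsub2 hp)) (hf.mono hsub2) (l := 1 / 8) (by norm_num)
    (fun x hx => h1 x (by simpa using hx)) hμ0
    ((lint_mono_set hsub2).trans (hlint.trans ((ENNReal.ofReal_le_ofReal
      ((min_le_right _ _).trans (min_le_right _ _))).trans
      (ENNReal.ofReal_pow hμ0.le _).le))) q hqd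
  have h3 : N * μ ≤ c₁ := by
    rw [hμ, mul_div_assoc', div_le_iff₀ (by positivity)]
    nlinarith
  have h4 : c₁ ≤ bar (1 / 2) 3 k ((-(1 / 2) : ℝ), (0 : E d)) q := by
    unfold bar
    have h5 : c₁ ≤ Real.exp (-(k * (-(1 / 2) - q.1))) := by
      refine Real.exp_le_exp.2 (neg_le_neg (mul_le_mul_of_nonneg_left ?_ hk0))
      linarith
    calc c₁ ≤ Real.exp (-(k * (-(1 / 2) - q.1))) := h5
      _ ≤ _ := le_mul_of_one_le_right (Real.exp_pos _).le (one_le_mul_of_one_le_of_one_le hψ hψ)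
  refine (min_le_left _ _).trans ?_
  have h5 : (1 / 8 : ℝ) / (1 / 2) ^ 4 * bar (1 / 2) 3 k ((-(1 / 2) : ℝ), (0 : E d)) q =
      2 * bar (1 / 2) 3 k ((-(1 / 2) : ℝ), (0 : E d)) q := by norm_num
  rw [← hk, h5] at h2
  change _ - N * μ ≤ _ at h2
  linarith

/-- The density lemma at scale `r`. -/
theorem density_lemma {δ B : ℝ} (hδ : 0 < δ) (hδ1 : δ ≤ 1) (hB : 0 ≤ B) :
    ∃ μ₀ > (0 : ℝ), ∀ m : ℝ, 0 ≤ m → ∃ c > (0 : ℝ), c ≤ 1 ∧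
      ∀ w f : ℝ × E d → ℝ, ContDiff ℝ 2 w → ∀ (r : ℝ) (p₀ : ℝ × E d), 0 < r → r ≤ 1 →
      ∀ S : Set (ℝ × E d),
      box ((5 + 8 * m) * r ^ 2) (dR m * r) (p₀.1 - (4 + 8 * m) * r ^ 2, p₀.2) ⊆ S →
      (∀ q ∈ S, 0 ≤ w q) → SuperS δ B f w S →
      volume ({q | w q ≤ 1} ∩ dcyl r p₀) ≤ ENNReal.ofReal (μ₀ * r ^ (d + 2)) →
      lint f S ≤ ENNReal.ofReal c →
      ∀ q : ℝ × E d, p₀.1 - (4 + 8 * m) * r ^ 2 ≤ q.1 → q.1 ≤ p₀.1 - 4 * r ^ 2 →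
        ‖q.2 - p₀.2‖ ≤ 2 * r → c ≤ w q := by
  obtain ⟨μ₀, hμ₀, h⟩ := density_unit (d := d) hδ hδ1 hB
  refine ⟨μ₀, hμ₀, fun m hm => ?_⟩
  obtain ⟨c, hc, hc1, h⟩ := h m hm
  refine ⟨c, hc, hc1, fun w f hw r p₀ hr hr1 S hS hw0 hf hvol hlint q hq1 hq2 hq3 => ?_⟩
  have hr2 : 0 < r ^ 2 := by positivity
  have hsub : box (5 + 8 * m) (dR m) ((-(4 + 8 * m) : ℝ), (0 : E d)) ⊆ scaleMap r p₀ ⁻¹' S := by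
    rintro p ⟨⟨hp1, hp2⟩, hp3⟩
    dsimp only at hp1 hp2
    have hp4 : ‖p.2‖ ≤ dR m := by simpa using hp3
    refine hS ⟨⟨?_, ?_⟩, ?_⟩
    · simp only [scaleMap]; nlinarith
    · simp only [scaleMap]; nlinarith
    · simp only [scaleMap, mem_closedBall, dist_eq_norm, add_sub_cancel_left, norm_smul,
        Real.norm_of_nonneg hr.le]
      nlinarith
  have hpre : {q | w (scaleMap r p₀ q) ≤ 1} ∩ dcyl 1 (0 : ℝ × E d) ⊆
      scaleMap r p₀ ⁻¹' ({q | w q ≤ 1} ∩ dcyl r p₀) := by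
    rintro p ⟨hp, ⟨hp1, hp2⟩, hp3⟩
    simp only [Prod.fst_zero, Prod.snd_zero, one_pow, zero_sub, zero_add, mem_ball_zero_iff]
      at hp1 hp2 hp3
    refine ⟨hp, ⟨?_, ?_⟩, ?_⟩
    · simp only [scaleMap]; nlinarith
    · simp only [scaleMap]; nlinarith
    · simp only [scaleMap, mem_ball, dist_eq_norm, add_sub_cancel_left, norm_smul,
        Real.norm_of_nonneg hr.le]
      nlinarith
  have := h (fun q => w (scaleMap r p₀ q)) (fun q => r ^ 2 * f (scaleMap r p₀ q))
    (contDiff_scale hw r p₀) (fun p hp => hw0 _ (hsub hp)) (hf.scale hB hw hr hr1 p₀ hsub) ?_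
    ((lint_scale_le hr hr1 p₀ hsub).trans hlint) ((q.1 - p₀.1) / r ^ 2, r⁻¹ • (q.2 - p₀.2)) ?_ ?_ ?_
  · have hs : scaleMap r p₀ ((q.1 - p₀.1) / r ^ 2, r⁻¹ • (q.2 - p₀.2)) = q := by
      ext1
      · simp only [scaleMap]; field_simp; ring
      · simp only [scaleMap, smul_smul, mul_inv_cancel₀ hr.ne', one_smul]; abel
    simpa only [hs] using this
  · refine (measure_mono hpre).trans ?_
    rw [volume_preimage_scaleMap hr]
    calc _ ≤ ENNReal.ofReal ((r ^ (d + 2))⁻¹) * ENNReal.ofReal (μ₀ * r ^ (d + 2)) := by gcongr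
      _ = _ := by
        rw [← ENNReal.ofReal_mul (by positivity)]
        congr 1
        field_simp
  · dsimp only
    rw [le_div_iff₀ hr2]
    linarith
  · dsimp only
    rw [div_le_iff₀ hr2]
    linarith
  · dsimp only
    rw [norm_smul, Real.norm_of_nonneg (by positivity), inv_mul_le_iff₀ hr]
    linarith

end Density

section InkSpots

lemma volume_union_Ioo_le {ι : Type*} {m : ℝ} (hm : 0 < m) {s h : ι → ℝ} (hh : ∀ i, 0 < h i)
    {a b : ℝ} (ha : ∀ i, a ≤ s i - m * h i) (hb : ∀ i, s i ≤ b) :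
    volume (⋃ i, Ioo (s i) (s i + h i)) ≤
      ENNReal.ofReal (1 + 1 / m) * volume (⋃ i, Ioo (s i - m * h i) (s i)) := by
  set V := ⋃ i, Ioo (s i - m * h i) (s i) with hV
  have hVo : IsOpen V := isOpen_iUnion fun i => isOpen_Ioo
  have hVb : V ⊆ Icc a b := iUnion_subset fun i =>
    Ioo_subset_Icc_self.trans (Icc_subset_Icc (ha i) (hb i))
  set 𝒞 : Set (Set ℝ) := connectedComponentIn V '' V with h𝒞
  have hsub : ∀ C ∈ 𝒞, C ⊆ V := by
    rintro _ ⟨x, -, rfl⟩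
    exact connectedComponentIn_subset V x
  have hopen : ∀ C ∈ 𝒞, IsOpen C := by
    rintro _ ⟨x, -, rfl⟩
    exact hVo.connectedComponentIn
  have hdisj : 𝒞.PairwiseDisjoint id := by
    rintro _ ⟨x, hx, rfl⟩ _ ⟨y, hy, rfl⟩ hne
    by_contra hcon
    obtain ⟨z, hz1, hz2⟩ := not_disjoint_iff.1 hcon
    exact hne ((connectedComponentIn_eq hz1).trans (connectedComponentIn_eq hz2).symm)
  have hcount : 𝒞.Countable := by
    refine hdisj.countable_of_isOpen hopen ?_
    rintro _ ⟨x, hx, rfl⟩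
    exact ⟨x, mem_connectedComponentIn hx⟩
  have hvolC : ∀ C ∈ 𝒞, ENNReal.ofReal (sSup C - sInf C) ≤ volume C ∧ C ⊆ Icc (sInf C) (sSup C) := by
    intro C hC
    have hbb : BddBelow C := bddBelow_Icc.mono ((hsub C hC).trans hVb)
    have hba : BddAbove C := bddAbove_Icc.mono ((hsub C hC).trans hVb)
    refine ⟨?_, fun x hx => ⟨csInf_le hbb hx, le_csSup hba hx⟩⟩
    have hconn : IsConnected C := by
      obtain ⟨x, hx, rfl⟩ := hC
      exact isConnected_connectedComponentIn_iff.2 hx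
    rw [← Real.volume_Ioo]
    exact measure_mono (hconn.Ioo_csInf_csSup_subset hbb hba)
  have hcover : (⋃ i, Ioo (s i) (s i + h i)) ⊆
      ⋃ C ∈ 𝒞, Icc (sInf C) (sSup C + (sSup C - sInf C) / m) := by
    refine iUnion_subset fun i x hx => ?_
    have hlt : s i - m * h i < s i := by have := mul_pos hm (hh i); linarith
    obtain ⟨y, hy⟩ := nonempty_Ioo.2 hlt
    have hyV : y ∈ V := mem_iUnion.2 ⟨i, hy⟩
    have hCm : connectedComponentIn V y ∈ 𝒞 := mem_image_of_mem _ hyV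
    have hIC : Ioo (s i - m * h i) (s i) ⊆ connectedComponentIn V y :=
      isPreconnected_Ioo.subset_connectedComponentIn hy (subset_iUnion_of_subset i subset_rfl)
    have hII := closure_minimal (hIC.trans (hvolC _ hCm).2) isClosed_Icc
    rw [closure_Ioo hlt.ne] at hII
    have h1 := (hII (left_mem_Icc.2 hlt.le)).1
    have h2 := (hII (right_mem_Icc.2 hlt.le)).2
    refine mem_biUnion hCm ⟨?_, ?_⟩
    · linarith [hx.1]
    · have h3 : h i ≤ (sSup (connectedComponentIn V y) - sInf (connectedComponentIn V y)) / m := by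
        rw [le_div_iff₀ hm]
        linarith
      linarith [hx.2]
  have hUC : V = ⋃ C ∈ 𝒞, id C := by
    refine Subset.antisymm (fun x hx => ?_) (iUnion₂_subset hsub)
    exact mem_biUnion (mem_image_of_mem _ hx) (mem_connectedComponentIn hx)
  calc volume (⋃ i, Ioo (s i) (s i + h i))
      ≤ volume (⋃ C ∈ 𝒞, Icc (sInf C) (sSup C + (sSup C - sInf C) / m)) := measure_mono hcover
    _ ≤ ∑' C : 𝒞, volume (Icc (sInf (C : Set ℝ)) (sSup C.1 + (sSup C.1 - sInf C.1) / m)) :=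
        measure_biUnion_le _ hcount _
    _ ≤ ∑' C : 𝒞, ENNReal.ofReal (1 + 1 / m) * volume (C : Set ℝ) := by
        refine ENNReal.tsum_le_tsum fun C => ?_
        rw [Real.volume_Icc]
        calc ENNReal.ofReal (sSup C.1 + (sSup C.1 - sInf C.1) / m - sInf C.1)
            = ENNReal.ofReal (1 + 1 / m) * ENNReal.ofReal (sSup C.1 - sInf C.1) := by
              rw [← ENNReal.ofReal_mul (by positivity)]
              congr 1
              ring
          _ ≤ _ := by gcongr; exact (hvolC _ C.2).1
    _ = ENNReal.ofReal (1 + 1 / m) * volume V := by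
        rw [ENNReal.tsum_mul_left]
        conv_rhs => rw [hUC]
        rw [measure_biUnion hcount hdisj fun C hC => (hopen C hC).measurableSet]
        rfl

variable {d : ℕ}

lemma volume_union_prod_le {ι : Type*} {m : ℝ} (hm : 0 < m) {s h : ι → ℝ} (hh : ∀ i, 0 < h i)
    {a b : ℝ} (ha : ∀ i, a ≤ s i - m * h i) (hb : ∀ i, s i ≤ b) {U : ι → Set (E d)}
    (hU : ∀ i, IsOpen (U i)) :
    volume (⋃ i, Ioo (s i) (s i + h i) ×ˢ U i) ≤
      ENNReal.ofReal (1 + 1 / m) * volume (⋃ i, Ioo (s i - m * h i) (s i) ×ˢ U i) := by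
  have h1 : MeasurableSet (⋃ i, Ioo (s i) (s i + h i) ×ˢ U i) :=
    (isOpen_iUnion fun i => isOpen_Ioo.prod (hU i)).measurableSet
  have h2 : MeasurableSet (⋃ i, Ioo (s i - m * h i) (s i) ×ˢ U i) :=
    (isOpen_iUnion fun i => isOpen_Ioo.prod (hU i)).measurableSet
  rw [Measure.volume_eq_prod, Measure.prod_apply_symm h1, Measure.prod_apply_symm h2,
    ← lintegral_const_mul' _ _ ENNReal.ofReal_ne_top]
  refine lintegral_mono fun x => ?_
  have key : ∀ I : ι → Set ℝ, (fun t : ℝ => (t, x)) ⁻¹' (⋃ i, I i ×ˢ U i) =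
      ⋃ i : {i // x ∈ U i}, I i := by
    intro I
    ext t
    simp only [mem_preimage, mem_iUnion, mem_prod, Subtype.exists, exists_prop]
    exact exists_congr fun i => and_comm
  rw [key fun i => Ioo (s i) (s i + h i), key fun i => Ioo (s i - m * h i) (s i)]
  exact volume_union_Ioo_le hm (s := fun i : {i // x ∈ U i} => s i) (h := fun i => h i)
    (fun i => hh i) (fun i => ha i) fun i => hb i

lemma isOpen_dcyl (r : ℝ) (p : ℝ × E d) : IsOpen (dcyl r p) := isOpen_Ioo.prod isOpen_ball

lemma mem_dcyl_self {r : ℝ} (hr : 0 < r) (p : ℝ × E d) : p ∈ dcyl r p := by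
  refine ⟨⟨?_, ?_⟩, mem_ball_self hr⟩ <;> · have := pow_pos hr 2; linarith

lemma volume_dcyl {r : ℝ} (hr : 0 < r) (p : ℝ × E d) :
    volume (dcyl r p) = ENNReal.ofReal (r ^ (d + 2)) * volume (dcyl 1 (0 : ℝ × E d)) := by
  have : scaleMap r p ⁻¹' (dcyl r p) = dcyl 1 (0 : ℝ × E d) := by
    ext q
    have hr2 : 0 < r ^ 2 := by positivity
    simp only [dcyl, scaleMap, mem_preimage, mem_prod, mem_Ioo, mem_ball, dist_eq_norm,
      add_sub_cancel_left, norm_smul, Real.norm_of_nonneg hr.le, Prod.fst_zero, Prod.snd_zero,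
      sub_zero, one_pow, zero_sub, zero_add]
    constructor
    · rintro ⟨⟨h1, h2⟩, h3⟩
      refine ⟨⟨?_, ?_⟩, ?_⟩ <;> nlinarith
    · rintro ⟨⟨h1, h2⟩, h3⟩
      refine ⟨⟨?_, ?_⟩, ?_⟩ <;> nlinarith
  have h2 := volume_preimage_scaleMap hr p (dcyl r p)
  rw [this] at h2
  rw [h2, ← mul_assoc, ← ENNReal.ofReal_mul (by positivity), mul_inv_cancel₀ (by positivity),
    ENNReal.ofReal_one, one_mul]

lemma volume_dcyl_one_pos : 0 < volume (dcyl 1 (0 : ℝ × E d)) :=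
  (isOpen_dcyl 1 _).measure_pos _ ⟨0, mem_dcyl_self one_pos _⟩

lemma volume_dcyl_lt_top (r : ℝ) (p : ℝ × E d) : volume (dcyl r p) < ∞ := by
  rw [dcyl, Measure.volume_eq_prod, Measure.prod_prod]
  exact ENNReal.mul_lt_top measure_Ioo_lt_top measure_ball_lt_top

lemma dcyl_subset_five {r s : ℝ} (hr : 0 < r) (hs : 0 < s) {p q : ℝ × E d}
    (hne : (dcyl r p ∩ dcyl s q).Nonempty) (hrs : r ≤ 2 * s) : dcyl r p ⊆ dcyl (5 * s) q := by
  obtain ⟨z, ⟨⟨h1, h2⟩, h3⟩, ⟨h4, h5⟩, h6⟩ := hne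
  rintro y ⟨⟨h7, h8⟩, h9⟩
  have hr2 : r ^ 2 ≤ 4 * s ^ 2 := by nlinarith
  refine ⟨⟨?_, ?_⟩, ?_⟩
  · nlinarith
  · nlinarith
  · rw [mem_ball] at h3 h6 h9 ⊢
    have := dist_triangle4 y.2 p.2 z.2 q.2
    rw [dist_comm p.2] at this
    linarith

/-- A union of cylinders, each of which has a definite part outside `O`, has a definite part
outside `O`. -/
lemma volume_diff_ge {ι : Type*} {r : ι → ℝ} {p : ι → ℝ × E d} (hr : ∀ i, 0 < r i) {R : ℝ}
    (hR : ∀ i, r i ≤ R) {O : Set (ℝ × E d)} (hO : IsOpen O) {μ : ℝ≥0∞}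
    (hμ : ∀ i, μ * volume (dcyl (r i) (p i)) ≤ volume (dcyl (r i) (p i) \ O)) :
    μ * volume (⋃ i, dcyl (r i) (p i)) ≤
      ENNReal.ofReal (5 ^ (d + 2)) * volume ((⋃ i, dcyl (r i) (p i)) \ O) := by
  obtain ⟨u, -, hud, huc⟩ := Vitali.exists_disjoint_subfamily_covering_enlargement
    (fun i => dcyl (r i) (p i)) univ r 2 one_lt_two (fun i _ => (hr i).le) R (fun i _ => hR i)
    (fun i _ => ⟨p i, mem_dcyl_self (hr i) _⟩)
  have hucount : u.Countable := hud.countable_of_isOpen (fun i _ => isOpen_dcyl _ _)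
    fun i _ => ⟨p i, mem_dcyl_self (hr i) _⟩
  have hcov : (⋃ i, dcyl (r i) (p i)) ⊆ ⋃ j ∈ u, dcyl (5 * r j) (p j) := by
    refine iUnion_subset fun i => ?_
    obtain ⟨j, hj, hne, hle⟩ := huc i (mem_univ i)
    exact (dcyl_subset_five (hr i) (hr j) hne hle).trans
      (subset_biUnion_of_mem (u := fun j => dcyl (5 * r j) (p j)) hj)
  calc μ * volume (⋃ i, dcyl (r i) (p i))
      ≤ μ * ∑' j : u, volume (dcyl (5 * r j) (p j)) := by
        gcongr
        exact (measure_mono hcov).trans (measure_biUnion_le _ hucount _)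
    _ = ENNReal.ofReal (5 ^ (d + 2)) * ∑' j : u, μ * volume (dcyl (r j) (p j)) := by
        rw [← ENNReal.tsum_mul_left, ← ENNReal.tsum_mul_left]
        refine tsum_congr fun j => ?_
        rw [volume_dcyl (by have := hr j; positivity), volume_dcyl (hr j), mul_pow,
          ENNReal.ofReal_mul (by positivity)]
        ring
    _ ≤ ENNReal.ofReal (5 ^ (d + 2)) * ∑' j : u, volume (dcyl (r j) (p j) \ O) := by
        gcongr with j
        exact hμ j
    _ = ENNReal.ofReal (5 ^ (d + 2)) * volume (⋃ j ∈ u, dcyl (r j) (p j) \ O) := by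
        rw [measure_biUnion hucount (hud.mono fun j => sdiff_subset)
          fun j _ => (isOpen_dcyl _ _).measurableSet.diff hO.measurableSet]
    _ ≤ _ := by
        gcongr
        exact iUnion₂_subset fun j _ => sdiff_subset_sdiff_left (subset_iUnion_of_subset j subset_rfl)

/-- The growing ink spots lemma. -/
theorem ink_spots {μ : ℝ} (hμ : 0 < μ) :
    ∃ κ > (0 : ℝ), ∃ m > (0 : ℝ), ∀ (A O : Set (ℝ × E d)) (r : ℝ × E d → ℝ), IsOpen O → A ⊆ O →
      Bornology.IsBounded A → (∀ q, 0 < r q) → (∀ q, r q ≤ 1) →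
      (∀ q ∈ A, ENNReal.ofReal μ * volume (dcyl (2 * r q) q) ≤ volume (dcyl (2 * r q) q \ O)) →
      ENNReal.ofReal (1 + κ) * volume A ≤ volume (⋃ q : A,
        Ioo (q.1.1 - 4 * r q ^ 2 - m * (8 * r q ^ 2)) (q.1.1 - 4 * r q ^ 2) ×ˢ
          ball q.1.2 (2 * r q)) := by
  set κ' := μ / 5 ^ (d + 2) with hκ'
  have hκ'0 : 0 < κ' := by positivity
  set m := 2 / κ' + 1 with hm
  have hm0 : 0 < m := by positivity
  refine ⟨κ' / 2, by positivity, m, hm0, fun A O r hO hAO hAb hr hr1 hdens => ?_⟩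
  set F₁ := ⋃ q : A, dcyl (2 * r q) (q : ℝ × E d) with hF₁
  set F₂ := ⋃ q : A, Ioo (q.1.1 - 4 * r q ^ 2 - m * (8 * r q ^ 2)) (q.1.1 - 4 * r q ^ 2) ×ˢ
    ball q.1.2 (2 * r q) with hF₂
  obtain ⟨a, b, hab⟩ : ∃ a b : ℝ, ∀ q ∈ A, a ≤ q.1 ∧ q.1 ≤ b := by
    obtain ⟨R, hR⟩ := hAb.exists_norm_le
    refine ⟨-R, R, fun q hq => abs_le.1 ?_⟩
    exact (norm_fst_le q).trans (hR q hq)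
  have h12 : volume F₁ ≤ ENNReal.ofReal (1 + 1 / m) * volume F₂ := by
    have := volume_union_prod_le hm0 (s := fun q : A => q.1.1 - 4 * r q ^ 2)
      (h := fun q : A => 8 * r q ^ 2) (fun q => by have := hr q; positivity)
      (a := a - 4 - m * 8) (b := b) (fun q => ?_) (fun q => ?_)
      (U := fun q : A => ball q.1.2 (2 * r q)) (fun q => isOpen_ball)
    · refine le_trans (le_of_eq ?_) this
      rw [hF₁]
      congr 1
      refine iUnion_congr fun q => ?_
      simp only [dcyl]
      congr 2 <;> ring
    · have h1 := hr1 q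
      have h2 := hr q
      have h3 : r q ^ 2 ≤ 1 := pow_le_one₀ h2.le h1
      have := (hab q q.2).1
      have h4 := mul_le_mul_of_nonneg_left h3 hm0.le
      nlinarith
    · have := (hab q q.2).2
      have := sq_nonneg (r q)
      linarith
  have hfin : volume F₁ ≠ ∞ := by
    have : Bornology.IsBounded F₁ := by
      obtain ⟨R, hR⟩ := hAb.exists_norm_le
      refine (isBounded_iff_forall_norm_le).2 ⟨R + 4, fun p hp => ?_⟩
      obtain ⟨q, ⟨hq1, hq2⟩, hq3⟩ := mem_iUnion.1 hp
      have h1 := hr1 q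
      have h2 := hr q
      have h3 : r q ^ 2 ≤ 1 := pow_le_one₀ h2.le h1
      have h4 := hR q q.2
      have h5 := abs_le.1 ((norm_fst_le q.1).trans h4)
      have h6 := (norm_snd_le q.1).trans h4
      rw [mul_pow] at hq1 hq2
      refine norm_prod_le_iff.2 ⟨abs_le.2 ⟨?_, ?_⟩, ?_⟩
      · linarith [h5.1]
      · linarith [h5.2]
      · rw [mem_ball, dist_eq_norm] at hq3
        have := norm_le_norm_add_norm_sub' p.2 q.1.2
        linarith
    exact this.measure_lt_top.ne
  have hdiff : ENNReal.ofReal κ' * volume F₁ ≤ volume (F₁ \ O) := by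
    have := volume_diff_ge (r := fun q : A => 2 * r q) (p := fun q : A => (q : ℝ × E d))
      (fun q => by have := hr q; positivity) (R := 2) (fun q => by have := hr1 q; linarith)
      hO (μ := ENNReal.ofReal μ) fun q => hdens q q.2
    rw [hκ', ENNReal.ofReal_div_of_pos (by positivity), ENNReal.div_eq_inv_mul, mul_assoc,
      ENNReal.inv_mul_le_iff (by simp) ENNReal.ofReal_ne_top]
    exact this
  have hA : volume A ≤ volume (F₁ ∩ O) := by
    refine measure_mono fun q hq => ⟨mem_iUnion.2 ⟨⟨q, hq⟩, mem_dcyl_self ?_ _⟩, hAO hq⟩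
    have := hr q
    positivity
  have hAF : volume A ≤ volume F₁ := hA.trans (measure_mono inter_subset_left)
  have h3 : ENNReal.ofReal (1 + κ') * volume A ≤ volume F₁ := by
    calc ENNReal.ofReal (1 + κ') * volume A = volume A + ENNReal.ofReal κ' * volume A := by
          rw [ENNReal.ofReal_add zero_le_one hκ'0.le, add_mul, ENNReal.ofReal_one, one_mul]
      _ ≤ volume (F₁ ∩ O) + volume (F₁ \ O) := by
          gcongr
          exact (mul_le_mul_right hAF _).trans hdiff
      _ = volume F₁ := measure_inter_add_sdiff _ hO.measurableSet
  have h4 : (1 + κ' / 2) * (1 + 1 / m) ≤ 1 + κ' := by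
    have h5 : κ' * m = 2 + κ' := by rw [hm]; field_simp
    have h6 : (1 + κ' / 2) * (1 + 1 / m) = ((1 + κ' / 2) * (m + 1)) / m := by field_simp
    rw [h6, div_le_iff₀ hm0]
    nlinarith
  have h5 : ENNReal.ofReal (1 + 1 / m) * (ENNReal.ofReal (1 + κ' / 2) * volume A) ≤
      ENNReal.ofReal (1 + 1 / m) * volume F₂ := by
    refine le_trans ?_ (h3.trans h12)
    rw [← mul_assoc, ← ENNReal.ofReal_mul (by positivity), mul_comm (1 + 1 / m)]
    gcongr
  exact (ENNReal.mul_le_mul_iff_right (by simp; positivity) ENNReal.ofReal_ne_top).1 h5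

end InkSpots

section Growth

variable {d : ℕ}

lemma abpN_mono {δ B T T' R R' : ℝ} (hδ : 0 < δ) (hB : 0 ≤ B) (hT : 0 ≤ T) (hTT : T ≤ T')
    (hR : 0 ≤ R) (hRR : R ≤ R') : abpN d δ B T R ≤ abpN d δ B T' R' := by
  have h1 : 0 ≤ T' := hT.trans hTT
  unfold abpN
  gcongr

lemma bark_mono {δ B ρ α τ τ' : ℝ} (hδ : 0 < δ) (hB : 0 ≤ B) (hα : 0 ≤ α)
    (hττ : τ ≤ τ') : bark d δ B ρ α τ ≤ bark d δ B ρ α τ' := by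
  have := puccC_nonneg (d := d) hδ
  unfold bark
  gcongr

/-- The domain of the growth lemma. -/
def growD (d : ℕ) : Set (ℝ × E d) := box 3 8 ((0 : ℝ), (0 : E d))

/-- The cylinder where the measure information is given. -/
def growK (d : ℕ) : Set (ℝ × E d) := Ioo 1 2 ×ˢ ball 0 1

lemma isOpen_growK : IsOpen (growK d) := isOpen_Ioo.prod isOpen_ball

lemma volume_growK_lt_top : volume (growK d) < ∞ := by
  rw [growK, Measure.volume_eq_prod, Measure.prod_prod]
  exact ENNReal.mul_lt_top measure_Ioo_lt_top measure_ball_lt_top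

lemma volume_growK_pos : 0 < volume (growK d) :=
  isOpen_growK.measure_pos _ ⟨(3 / 2, 0), ⟨by norm_num, by norm_num⟩, by simp⟩

lemma volume_shell_le {ρ η : ℝ} (hρ : 0 ≤ ρ) (hη : 0 ≤ η) (h : (1 + ρ) ^ (d + 1) ≤ 1 + η) :
    volume ((Ioo (1 - ρ) 2 ×ˢ ball 0 (1 + ρ)) \ growK d) ≤ ENNReal.ofReal η * volume (growK d) := by
  have hsub : growK d ⊆ Ioo (1 - ρ) 2 ×ˢ ball 0 (1 + ρ) :=
    prod_mono (Ioo_subset_Ioo_left (by linarith)) (ball_subset_ball (by linarith))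
  rw [measure_sdiff hsub isOpen_growK.measurableSet.nullMeasurableSet volume_growK_lt_top.ne,
    tsub_le_iff_right, ← add_one_mul, ← ENNReal.ofReal_one, ← ENNReal.ofReal_add hη zero_le_one]
  rw [growK, Measure.volume_eq_prod, Measure.prod_prod, Measure.prod_prod, Real.volume_Ioo,
    Real.volume_Ioo, Measure.addHaar_ball_of_pos _ _ (by linarith : 0 < 1 + ρ),
    finrank_euclideanSpace_fin, ← mul_assoc, ← ENNReal.ofReal_mul (by linarith), ← mul_assoc,
    ← ENNReal.ofReal_mul (by linarith)]
  gcongr ?_ * _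
  refine ENNReal.ofReal_le_ofReal ?_
  rw [show 2 - (1 - ρ) = 1 + ρ by ring, ← pow_succ']
  linarith

lemma exists_stopping_radius {O : Set (ℝ × E d)} (hO : IsOpen O) {r₀ μ : ℝ} (hr₀ : 0 < r₀)
    {q : ℝ × E d} (hq : q ∈ O)
    (h0 : ¬ volume (Oᶜ ∩ dcyl r₀ q) ≤ ENNReal.ofReal (μ * r₀ ^ (d + 2))) :
    ∃ r, 0 < r ∧ r ≤ r₀ ∧ volume (Oᶜ ∩ dcyl r q) ≤ ENNReal.ofReal (μ * r ^ (d + 2)) ∧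
      ¬ volume (Oᶜ ∩ dcyl (2 * r) q) ≤ ENNReal.ofReal (μ * (2 * r) ^ (d + 2)) := by
  classical
  have hex : ∃ k : ℕ, volume (Oᶜ ∩ dcyl (r₀ / 2 ^ k) q) ≤
      ENNReal.ofReal (μ * (r₀ / 2 ^ k) ^ (d + 2)) := by
    obtain ⟨ε, hε, hball⟩ := Metric.isOpen_iff.1 hO q hq
    have h1 : Tendsto (fun k : ℕ => r₀ * (1 / 2 : ℝ) ^ k) atTop (𝓝 (r₀ * 0)) :=
      (tendsto_pow_atTop_nhds_zero_of_lt_one (by norm_num) (by norm_num)).const_mul r₀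
    rw [mul_zero] at h1
    obtain ⟨k, hk⟩ := (h1.eventually (gt_mem_nhds (show (0 : ℝ) < min ε 1 by positivity))).exists
    refine ⟨k, ?_⟩
    have hk' : r₀ / 2 ^ k < min ε 1 := by
      rwa [one_div, inv_pow, ← div_eq_mul_inv] at hk
    have hr : 0 < r₀ / 2 ^ k := by positivity
    have : Oᶜ ∩ dcyl (r₀ / 2 ^ k) q = ∅ := by
      refine eq_empty_of_forall_notMem ?_
      rintro p ⟨hp, ⟨hp1, hp2⟩, hp3⟩
      refine hp (hball ?_)
      have h2 := hk'.trans_le (min_le_left _ _)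
      have h3 := hk'.trans_le (min_le_right _ _)
      rw [mem_ball, Prod.dist_eq, max_lt_iff, Real.dist_eq, abs_lt]
      have h4 : (r₀ / 2 ^ k) ^ 2 ≤ r₀ / 2 ^ k := by nlinarith
      refine ⟨⟨?_, ?_⟩, ?_⟩
      · linarith
      · linarith
      · exact (mem_ball.1 hp3).trans h2
    rw [this]
    simp
  set k := Nat.find hex with hk
  have hk1 := Nat.find_spec hex
  have hk0 : k ≠ 0 := by
    intro hk0
    rw [← hk, hk0] at hk1
    simp only [pow_zero, div_one] at hk1
    exact h0 hk1
  obtain ⟨j, hj⟩ := Nat.exists_eq_succ_of_ne_zero hk0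
  have hjn := Nat.find_min hex (m := j) (by omega)
  refine ⟨r₀ / 2 ^ k, by positivity, div_le_self hr₀.le (one_le_pow₀ one_le_two), hk1, ?_⟩
  have : 2 * (r₀ / 2 ^ k) = r₀ / 2 ^ j := by
    rw [hj, Nat.succ_eq_add_one, pow_succ]
    field_simp
  rwa [this]

set_option maxHeartbeats 1600000 in
/-- Either a lower bound holds at later stages, or the set of large values grows. -/
lemma growth_step {δ B : ℝ} (hδ : 0 < δ) (hδ1 : δ ≤ 1) (hB : 0 ≤ B) :
    ∃ κ > (0 : ℝ), ∃ c > (0 : ℝ), c ≤ 1 ∧ ∀ w f : ℝ × E d → ℝ, ContDiff ℝ 2 w →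
      (∀ q ∈ growD d, 0 ≤ w q) → SuperS δ B f w (growD d) → lint f (growD d) ≤ ENNReal.ofReal c →
      (∀ q : ℝ × E d, 0 ≤ q.1 → q.1 ≤ 1 / 2 → ‖q.2‖ ≤ 1 → c ≤ w q) ∨
      ENNReal.ofReal (1 + κ) * volume ({q | 1 < w q} ∩ growK d) ≤
        volume ({q | c ≤ w q} ∩ growK d) + ENNReal.ofReal (κ / 4) * volume (growK d) := by
  obtain ⟨μ₀, hμ₀, hdens⟩ := density_lemma (d := d) hδ hδ1 hB
  set ω := (volume (dcyl 1 (0 : ℝ × E d))).toReal with hω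
  have hω0 : 0 < ω := ENNReal.toReal_pos volume_dcyl_one_pos.ne' (volume_dcyl_lt_top _ _).ne
  have hωe : volume (dcyl 1 (0 : ℝ × E d)) = ENNReal.ofReal ω :=
    (ENNReal.ofReal_toReal (volume_dcyl_lt_top _ _).ne).symm
  obtain ⟨κ, hκ, m, hm, hink⟩ := ink_spots (d := d) (show 0 < μ₀ / ω by positivity)
  obtain ⟨c, hc, hc1, hdens⟩ := hdens m hm.le
  obtain ⟨ρ, hρ, hρη⟩ : ∃ ρ > (0 : ℝ), (1 + ρ) ^ (d + 1) ≤ 1 + κ / 4 := by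
    have h1 : Tendsto (fun ρ : ℝ => (1 + ρ) ^ (d + 1)) (𝓝[>] 0) (𝓝 ((1 + 0) ^ (d + 1))) :=
      ((by fun_prop : Continuous fun ρ : ℝ => (1 + ρ) ^ (d + 1)).tendsto 0).mono_left
        nhdsWithin_le_nhds
    have h2 : ((1 : ℝ) + 0) ^ (d + 1) < 1 + κ / 4 := by simp; positivity
    obtain ⟨ρ, h3, h4⟩ := ((h1.eventually (gt_mem_nhds h2)).and self_mem_nhdsWithin).exists
    exact ⟨ρ, h4, h3.le⟩
  have hdR := three_le_dR hm.le
  set b := min (1 : ℝ) ρ with hb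
  have hb0 : 0 < b := by positivity
  set r₀ := b / (4 + 8 * m + dR m) with hr₀
  have hr₀0 : 0 < r₀ := by positivity
  have hr₀b : r₀ * (4 + 8 * m + dR m) = b := by rw [hr₀]; field_simp
  have hb1 : b ≤ 1 := min_le_left _ _
  have hbρ : b ≤ ρ := min_le_right _ _
  have hr₀4 : r₀ ≤ 1 / 4 := by nlinarith
  have hr₀m : (4 + 8 * m) * r₀ ^ 2 ≤ b := by
    have : (4 + 8 * m) * r₀ ≤ b := by nlinarith
    nlinarith
  have hr₀R : dR m * r₀ ≤ b := by nlinarith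
  set N := abpN d δ B 2 (Real.sqrt (r₀ ^ 2 + 20 * 2)) with hN
  have hN0 : 0 ≤ N := abpN_nonneg hδ hB (by norm_num) (Real.sqrt_nonneg _)
  set k := bark d δ B r₀ 20 2 with hk
  have hk0 : 0 ≤ k := by rw [hk, bark]; positivity
  set c₁ := c * Real.exp (-(k * 2)) with hc₁
  have hc₁0 : 0 < c₁ := by positivity
  set μ := c₁ / 2 / (N + 1) with hμ
  have hμ0 : 0 < μ := by positivity
  refine ⟨κ, hκ, min c (min (c₁ / 2) (μ ^ (d + 1))), by positivity, (min_le_left _ _).trans hc1, ?_⟩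
  intro w f hw hw0 hf hlint
  set O : Set (ℝ × E d) := {q | 1 < w q} with hO
  have hOo : IsOpen O := isOpen_lt continuous_const hw.continuous
  have hOc : Oᶜ = {q | w q ≤ 1} := by ext q; simp [hO]
  have hlc : lint f (growD d) ≤ ENNReal.ofReal c :=
    hlint.trans (ENNReal.ofReal_le_ofReal (min_le_left _ _))
  have hboxD : ∀ q ∈ growK d, ∀ r, 0 < r → r ≤ r₀ →
      box ((5 + 8 * m) * r ^ 2) (dR m * r) (q.1 - (4 + 8 * m) * r ^ 2, q.2) ⊆ growD d := by
    rintro q ⟨⟨hq1, hq2⟩, hq3⟩ r hr hrr p ⟨⟨hp1, hp2⟩, hp3⟩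
    dsimp only at hp1 hp2 hp3
    have hr2 : r ^ 2 ≤ r₀ ^ 2 := by gcongr
    have h1 : (4 + 8 * m) * r ^ 2 ≤ 1 := by nlinarith
    have h2 : dR m * r ≤ 1 := by nlinarith
    refine ⟨⟨?_, ?_⟩, ?_⟩
    · dsimp only; linarith
    · dsimp only; nlinarith
    · rw [mem_ball_zero_iff] at hq3
      rw [mem_closedBall, dist_eq_norm] at hp3
      rw [mem_closedBall_zero_iff]
      have := norm_le_norm_add_norm_sub' p.2 q.2
      linarith
  have hlow : ∀ q ∈ growK d, ∀ r, 0 < r → r ≤ r₀ →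
      volume (Oᶜ ∩ dcyl r q) ≤ ENNReal.ofReal (μ₀ * r ^ (d + 2)) → ∀ p : ℝ × E d,
        q.1 - (4 + 8 * m) * r ^ 2 ≤ p.1 → p.1 ≤ q.1 - 4 * r ^ 2 → ‖p.2 - q.2‖ ≤ 2 * r → c ≤ w p := by
    intro q hq r hr hrr hv
    rw [hOc] at hv
    exact hdens w f hw r q hr (by linarith) _ (hboxD q hq r hr hrr) hw0 hf hv hlc
  by_cases hcase : ∃ q ∈ growK d, volume (Oᶜ ∩ dcyl r₀ q) ≤ ENNReal.ofReal (μ₀ * r₀ ^ (d + 2))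
  · left
    obtain ⟨q, hq, hqv⟩ := hcase
    have hlq := hlow q hq r₀ hr₀0 le_rfl hqv
    obtain ⟨⟨hq1, hq2⟩, hq3⟩ := hq
    rw [mem_ball_zero_iff] at hq3
    intro p hp1 hp2 hp3
    set s := q.1 - 4 * r₀ ^ 2 with hs
    have hr16 : r₀ ^ 2 ≤ 1 / 16 := by nlinarith
    have hs1 : 3 / 4 ≤ s := by linarith
    have hs2 : s ≤ 2 := by nlinarith
    have hsqrt : Real.sqrt (r₀ ^ 2 + 20 * s) ≤ Real.sqrt (r₀ ^ 2 + 20 * 2) := by gcongr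
    have hsub : barDom r₀ 20 s (s, q.2) ⊆ growD d := by
      intro z hz
      have hn := norm_sq_le_of_mem_barDom (by norm_num) hz
      obtain ⟨hz1, hz2, -⟩ := hz
      dsimp only at hz1 hz2 hn
      refine ⟨⟨?_, ?_⟩, ?_⟩
      · dsimp only; linarith
      · dsimp only; linarith
      · rw [mem_closedBall_zero_iff]
        have h1 : ‖z.2 - q.2‖ ≤ 7 := le_of_sq_le_sq (by linarith) (by norm_num)
        have := norm_le_norm_add_norm_sub' z.2 q.2
        linarith
    have hxx : ‖p.2 - q.2‖ ^ 2 ≤ 2 ^ 2 := by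
      gcongr
      have := norm_sub_le p.2 q.2
      linarith
    have hψ : 1 ≤ bpsi r₀ 20 (s, q.2) p := by
      simp only [bpsi]
      nlinarith [sq_nonneg r₀]
    have hpd : p ∈ barDom r₀ 20 s (s, q.2) := by
      refine ⟨?_, ?_, by linarith⟩
      · dsimp only; linarith
      · dsimp only; linarith
    have h2 := barrier_lower hδ hδ1 hB hr₀0 (by norm_num) (by linarith) hw
      (fun z hz => hw0 z (hsub hz)) (hf.mono hsub) hc.le
      (fun x hx => hlq (s, x) (by dsimp only; nlinarith only [hs, hm.le, sq_nonneg r₀, mul_nonneg hm.le (sq_nonneg r₀)]) le_rfl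
        (hx.trans (by linarith))) hμ0
      ((lint_mono_set hsub).trans (hlint.trans ((ENNReal.ofReal_le_ofReal
        ((min_le_right _ _).trans (min_le_right _ _))).trans
        (ENNReal.ofReal_pow hμ0.le _).le))) p hpd
    have hNs : abpN d δ B s (Real.sqrt (r₀ ^ 2 + 20 * s)) ≤ N :=
      abpN_mono hδ hB (by linarith) hs2 (Real.sqrt_nonneg _) hsqrt
    have hks : bark d δ B r₀ 20 s ≤ k := bark_mono hδ hB (by norm_num) hs2
    set ks := bark d δ B r₀ 20 s
    have h3 : N * μ ≤ c₁ / 2 := by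
      rw [hμ, mul_div_assoc', div_le_iff₀ (by positivity)]
      nlinarith
    have h3' := mul_le_mul_of_nonneg_right hNs hμ0.le
    have h4 : Real.exp (-(k * 2)) ≤ bar r₀ 20 ks (s, q.2) p := by
      unfold bar
      have hks0 : 0 ≤ ks := by simp only [ks, bark]; positivity
      have h5 : Real.exp (-(k * 2)) ≤ Real.exp (-(ks * (s - p.1))) := by
        refine Real.exp_le_exp.2 (neg_le_neg ?_)
        exact mul_le_mul hks (by linarith) (by linarith) hk0
      exact h5.trans (le_mul_of_one_le_right (Real.exp_pos _).le
        (one_le_mul_of_one_le_of_one_le hψ hψ))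
    have h5 : c ≤ c / r₀ ^ 4 := le_div_self hc.le (by positivity)
      (pow_le_one₀ hr₀0.le (by linarith))
    have h6 : c₁ ≤ c / r₀ ^ 4 * bar r₀ 20 ks (s, q.2) p :=
      mul_le_mul h5 h4 (Real.exp_pos _).le (by positivity)
    refine (min_le_right _ _).trans ((min_le_left _ _).trans ?_)
    linarith
  · right
    push Not at hcase
    have hch : ∀ q : ℝ × E d, ∃ r, 0 < r ∧ r ≤ r₀ ∧ (q ∈ O ∩ growK d →
        volume (Oᶜ ∩ dcyl r q) ≤ ENNReal.ofReal (μ₀ * r ^ (d + 2)) ∧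
        ¬ volume (Oᶜ ∩ dcyl (2 * r) q) ≤ ENNReal.ofReal (μ₀ * (2 * r) ^ (d + 2))) := by
      intro q
      by_cases hq : q ∈ O ∩ growK d
      · obtain ⟨r, h1, h2, h3⟩ := exists_stopping_radius hOo hr₀0 hq.1 (hcase q hq.2).not_ge
        exact ⟨r, h1, h2, fun _ => h3⟩
      · exact ⟨r₀, hr₀0, le_rfl, fun h => absurd h hq⟩
    choose r hr0 hrr hr using hch
    have hAb : Bornology.IsBounded (O ∩ growK d) := by
      refine Bornology.IsBounded.subset ?_ (inter_subset_right (s := O))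
      exact (isBounded_Ioo 1 2).prod isBounded_ball
    have h1 := hink (O ∩ growK d) O r hOo inter_subset_left hAb hr0
      (fun q => (hrr q).trans (by linarith)) ?_
    · refine h1.trans ?_
      set F₂ := ⋃ q : ↑(O ∩ growK d),
        Ioo (q.1.1 - 4 * r q ^ 2 - m * (8 * r q ^ 2)) (q.1.1 - 4 * r q ^ 2) ×ˢ
          ball q.1.2 (2 * r q) with hF₂
      have hF₂c : F₂ ⊆ {q | min c (min (c₁ / 2) (μ ^ (d + 1))) ≤ w q} := by
        intro p hp
        obtain ⟨q, ⟨hp1, hp2⟩, hp3⟩ := mem_iUnion.1 hp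
        rw [mem_ball, dist_eq_norm] at hp3
        exact (min_le_left _ _).trans (hlow q q.2.2 (r q) (hr0 q) (hrr q) (hr q q.2).1 p
          (by linarith) hp2.le hp3.le)
      have hF₂s : F₂ ⊆ Ioo (1 - ρ) 2 ×ˢ ball 0 (1 + ρ) := by
        intro p hp
        obtain ⟨q, ⟨hp1, hp2⟩, hp3⟩ := mem_iUnion.1 hp
        obtain ⟨⟨hq1, hq2⟩, hq3⟩ := q.2.2
        have h2 : r q ^ 2 ≤ r₀ ^ 2 := by have := hrr q; have := (hr0 q).le; gcongr
        have h3 : (4 + 8 * m) * r q ^ 2 ≤ (4 + 8 * m) * r₀ ^ 2 := by gcongr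
        have := sq_nonneg (r q)
        refine ⟨⟨?_, ?_⟩, ?_⟩
        · linarith
        · linarith
        · rw [mem_ball, dist_eq_norm] at hp3
          rw [mem_ball_zero_iff] at hq3 ⊢
          have := norm_le_norm_add_norm_sub' p.2 q.1.2
          have := hrr q
          nlinarith
      rw [← measure_inter_add_sdiff F₂ isOpen_growK.measurableSet]
      gcongr
      exact (measure_mono (sdiff_subset_sdiff_left hF₂s)).trans
        (volume_shell_le hρ.le (by positivity) hρη)
    · intro q hq
      have h2 := (not_le.1 (hr q hq).2).le
      have h3 : dcyl (2 * r q) q \ O = Oᶜ ∩ dcyl (2 * r q) q := by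
        rw [Set.sdiff_eq, inter_comm]
      rw [h3]
      refine le_trans (le_of_eq ?_) h2
      have := hr0 q
      rw [volume_dcyl (by positivity), hωe, ← ENNReal.ofReal_mul (by positivity),
        ← ENNReal.ofReal_mul (by positivity)]
      congr 1
      field_simp

/-- The growth lemma: a nonnegative supersolution exceeding `1` on half of a cylinder is bounded
below earlier. -/
theorem growth {δ B : ℝ} (hδ : 0 < δ) (hδ1 : δ ≤ 1) (hB : 0 ≤ B) :
    ∃ c > (0 : ℝ), c ≤ 1 ∧ ∀ w f : ℝ × E d → ℝ, ContDiff ℝ 2 w →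
      (∀ q ∈ growD d, 0 ≤ w q) → SuperS δ B f w (growD d) → lint f (growD d) ≤ ENNReal.ofReal c →
      ENNReal.ofReal (1 / 2) * volume (growK d) ≤ volume ({q | 1 < w q} ∩ growK d) →
      ∀ q : ℝ × E d, 0 ≤ q.1 → q.1 ≤ 1 / 2 → ‖q.2‖ ≤ 1 → c ≤ w q := by
  obtain ⟨κ, hκ, c, hc, hc1, hstep⟩ := growth_step (d := d) hδ hδ1 hB
  have key : ∀ n : ℕ, ∃ c' > (0 : ℝ), c' ≤ 1 ∧ ∀ σ : ℝ, 1 / 2 ≤ σ → 1 + κ / 4 - n * (κ / 4) ≤ σ →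
      ∀ w f : ℝ × E d → ℝ, ContDiff ℝ 2 w →
      (∀ q ∈ growD d, 0 ≤ w q) → SuperS δ B f w (growD d) → lint f (growD d) ≤ ENNReal.ofReal c' →
      ENNReal.ofReal σ * volume (growK d) ≤ volume ({q | 1 < w q} ∩ growK d) →
      ∀ q : ℝ × E d, 0 ≤ q.1 → q.1 ≤ 1 / 2 → ‖q.2‖ ≤ 1 → c' ≤ w q := by
    intro n
    induction n with
    | zero =>
      refine ⟨1, one_pos, le_rfl, fun σ _ hσ w f _ _ _ _ hv => ?_⟩
      exfalso
      have h1 : ENNReal.ofReal σ * volume (growK d) ≤ 1 * volume (growK d) := by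
        rw [one_mul]
        exact hv.trans (measure_mono inter_subset_right)
      rw [ENNReal.mul_le_mul_iff_left volume_growK_pos.ne' volume_growK_lt_top.ne,
        ENNReal.ofReal_le_one] at h1
      simp only [Nat.cast_zero, zero_mul, sub_zero] at hσ
      linarith
    | succ n ih =>
      obtain ⟨c', hc', hc'1, ih⟩ := ih
      have hc2 : 0 < c / 2 := by positivity
      refine ⟨min c (min (c / 2 * c') (c' * (c / 2) ^ (d + 1))), by positivity,
        (min_le_left _ _).trans hc1, fun σ hσ1 hσ w f hw hw0 hf hl hv => ?_⟩
      rcases hstep w f hw hw0 hf (hl.trans (ENNReal.ofReal_le_ofReal (min_le_left _ _))) with h | h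
      · exact fun q h1 h2 h3 => (min_le_left _ _).trans (h q h1 h2 h3)
      have hfin : ENNReal.ofReal (κ / 4) * volume (growK d) ≠ ∞ :=
        ENNReal.mul_ne_top ENNReal.ofReal_ne_top volume_growK_lt_top.ne
      have h1 : ENNReal.ofReal (σ + κ / 4) * volume (growK d) ≤
          volume ({q | c ≤ w q} ∩ growK d) := by
        refine (ENNReal.add_le_add_iff_right hfin).1 (le_trans ?_ h)
        rw [← add_mul, ← ENNReal.ofReal_add (by positivity) (by positivity)]
        calc ENNReal.ofReal (σ + κ / 4 + κ / 4) * volume (growK d)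
            ≤ ENNReal.ofReal ((1 + κ) * σ) * volume (growK d) := by
              gcongr
              nlinarith
          _ = ENNReal.ofReal (1 + κ) * (ENNReal.ofReal σ * volume (growK d)) := by
              rw [ENNReal.ofReal_mul (by positivity), mul_assoc]
          _ ≤ _ := by gcongr
      have h2 : {q | c ≤ w q} ∩ growK d ⊆ {q | 1 < (c / 2)⁻¹ * w q} ∩ growK d := by
        refine inter_subset_inter_left _ fun q hq => ?_
        have hq' : c ≤ w q := hq
        change 1 < (c / 2)⁻¹ * w q
        rw [lt_inv_mul_iff₀ hc2]
        linarith
      have hinv : 0 ≤ (c / 2)⁻¹ := by positivity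
      have h3 := ih (σ + κ / 4) (by linarith) (by push_cast at hσ; linarith)
        (fun q => (c / 2)⁻¹ * w q) (fun q => (c / 2)⁻¹ * f q) (contDiff_const.mul hw)
        (fun q hq => mul_nonneg hinv (hw0 q hq)) (hf.const_mul hw hinv) ?_
        (h1.trans (measure_mono h2))
      · intro q hq1 hq2 hq3
        have := h3 q hq1 hq2 hq3
        rw [le_inv_mul_iff₀ hc2] at this
        exact (min_le_right _ _).trans ((min_le_left _ _).trans this)
      · rw [lint_const_mul hinv]
        calc _ ≤ ENNReal.ofReal ((c / 2)⁻¹ ^ (d + 1)) *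
              ENNReal.ofReal (c' * (c / 2) ^ (d + 1)) := by
              gcongr
              exact hl.trans (ENNReal.ofReal_le_ofReal
                ((min_le_right _ _).trans (min_le_right _ _)))
          _ = ENNReal.ofReal c' := by
              rw [← ENNReal.ofReal_mul (by positivity)]
              congr 1
              rw [mul_left_comm, ← mul_pow, inv_mul_cancel₀ hc2.ne', one_pow, mul_one]
  obtain ⟨n, hn⟩ := exists_nat_gt (3 / κ + 1)
  obtain ⟨c', hc', hc'1, h⟩ := key n
  refine ⟨c', hc', hc'1, h (1 / 2) le_rfl ?_⟩
  have : 3 < (n - 1) * κ := by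
    have h1 : 3 / κ < n - 1 := by linarith
    rwa [div_lt_iff₀ hκ] at h1
  linarith

end Growth

section Oscillation

variable {d : ℕ} {u f : ℝ × E d → ℝ}

lemma SuperS.add_const {δ B : ℝ} (hu : ContDiff ℝ 2 u) {S : Set (ℝ × E d)}
    (hs : SuperS δ B f u S) (c : ℝ) : SuperS δ B f (fun q => u q + c) S := by
  intro q hq
  have h := hs q hq
  rwa [Dt_add hu contDiff_const, Dx_add hu contDiff_const, Dxx_add hu contDiff_const, Dt_const,
    Dx_const, Dxx_const, add_zero, add_zero, add_zero]

lemma scaleMap_inv {r : ℝ} (hr : 0 < r) (p₀ q : ℝ × E d) :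
    scaleMap r p₀ ((q.1 - p₀.1) / r ^ 2, r⁻¹ • (q.2 - p₀.2)) = q := by
  ext1
  · simp only [scaleMap]; field_simp; ring
  · simp only [scaleMap, smul_smul, mul_inv_cancel₀ hr.ne', one_smul]; abel

lemma growD_subset_scaleMap {r : ℝ} (hr : 0 < r) (p₀ : ℝ × E d) :
    growD d ⊆ scaleMap r p₀ ⁻¹' box (3 * r ^ 2) (8 * r) p₀ := by
  rintro q ⟨⟨h1, h2⟩, h3⟩
  dsimp only at h1 h2
  rw [mem_closedBall_zero_iff] at h3
  refine ⟨⟨?_, ?_⟩, ?_⟩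
  · simp only [scaleMap]; nlinarith [sq_nonneg r]
  · simp only [scaleMap]; nlinarith [sq_nonneg r]
  · simp only [scaleMap, mem_closedBall, dist_eq_norm, add_sub_cancel_left, norm_smul,
      Real.norm_of_nonneg hr.le]
    nlinarith

/-- The oscillation decreases at earlier times near the axis. -/
theorem osc_step {δ B : ℝ} (hδ : 0 < δ) (hδ1 : δ ≤ 1) (hB : 0 ≤ B) :
    ∃ θ c₀ : ℝ, 0 < θ ∧ θ < 1 ∧ 0 < c₀ ∧ ∀ u f : ℝ × E d → ℝ, ContDiff ℝ 2 u →
      ∀ (r : ℝ) (p₀ : ℝ × E d), 0 < r → r ≤ 1 →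
      SuperS δ B f u (box (3 * r ^ 2) (8 * r) p₀) →
      SuperS δ B f (fun q => -1 * u q) (box (3 * r ^ 2) (8 * r) p₀) → ∀ m ω : ℝ, 0 < ω →
      (∀ q ∈ box (3 * r ^ 2) (8 * r) p₀, m ≤ u q ∧ u q ≤ m + ω) →
      lint f (box (3 * r ^ 2) (8 * r) p₀) ≤ ENNReal.ofReal (c₀ * ω ^ (d + 1)) →
      ∃ m' : ℝ, ∀ q ∈ box (r ^ 2 / 2) r p₀, m' ≤ u q ∧ u q ≤ m' + θ * ω := by
  obtain ⟨c, hc, hc1, hgrow⟩ := growth (d := d) hδ hδ1 hB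
  refine ⟨1 - c / 4, c / 4 ^ (d + 1), by linarith, by linarith, by positivity, ?_⟩
  intro u f hu r p₀ hr hr1 hs hs' m ω hω hosc hl
  have hsub := growD_subset_scaleMap (d := d) hr p₀
  have h4 : 0 ≤ 4 / ω := by positivity
  have hlint : lint (fun q => 4 / ω * (r ^ 2 * f (scaleMap r p₀ q))) (growD d) ≤
      ENNReal.ofReal c := by
    rw [lint_const_mul h4]
    calc _ ≤ ENNReal.ofReal ((4 / ω) ^ (d + 1)) *
          ENNReal.ofReal (c / 4 ^ (d + 1) * ω ^ (d + 1)) := by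
          gcongr
          exact (lint_scale_le hr hr1 p₀ hsub).trans hl
      _ = ENNReal.ofReal c := by
          rw [← ENNReal.ofReal_mul (by positivity), div_pow]
          congr 1
          field_simp
  have hlow : ∀ (v : ℝ × E d → ℝ) (k : ℝ), ContDiff ℝ 2 v →
      SuperS δ B f v (box (3 * r ^ 2) (8 * r) p₀) →
      (∀ q ∈ box (3 * r ^ 2) (8 * r) p₀, 0 ≤ v q + k) →
      ENNReal.ofReal (1 / 2) * volume (growK d) ≤
        volume ({q | 1 < 4 / ω * (v (scaleMap r p₀ q) + k)} ∩ growK d) →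
      ∀ q ∈ box (r ^ 2 / 2) r p₀, c / 4 * ω ≤ v q + k := by
    intro v k hv hvs hv0 hvol q hq
    have hvk : ContDiff ℝ 2 fun q => v q + k := hv.add contDiff_const
    obtain ⟨⟨hq1, hq2⟩, hq3⟩ := hq
    rw [mem_closedBall, dist_eq_norm] at hq3
    have hr2 : 0 < r ^ 2 := by positivity
    have := hgrow (fun q => 4 / ω * (v (scaleMap r p₀ q) + k)) _
      (contDiff_const.mul (contDiff_scale hvk r p₀))
      (fun z hz => mul_nonneg h4 (hv0 _ (hsub hz)))
      (((hvs.add_const hv k).scale hB hvk hr hr1 p₀ hsub).const_mul (contDiff_scale hvk r p₀) h4)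
      hlint hvol ((q.1 - p₀.1) / r ^ 2, r⁻¹ • (q.2 - p₀.2)) ?_ ?_ ?_
    · rw [scaleMap_inv hr, div_mul_eq_mul_div, le_div_iff₀ hω] at this
      linarith
    · exact div_nonneg (by linarith) hr2.le
    · dsimp only
      rw [div_le_iff₀ hr2]
      linarith
    · dsimp only
      rwa [norm_smul, norm_inv, Real.norm_of_nonneg hr.le, inv_mul_le_iff₀ hr, mul_one]
  have hin : box (r ^ 2 / 2) r p₀ ⊆ box (3 * r ^ 2) (8 * r) p₀ :=
    prod_mono (Icc_subset_Icc_right (by nlinarith [sq_nonneg r]))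
      (closedBall_subset_closedBall (by linarith))
  have hcover : growK d ⊆ ({q | 1 < 4 / ω * (u (scaleMap r p₀ q) + -m)} ∩ growK d) ∪
      ({q | 1 < 4 / ω * (-1 * u (scaleMap r p₀ q) + (m + ω))} ∩ growK d) := by
    intro q hq
    by_cases h : 1 < 4 / ω * (u (scaleMap r p₀ q) + -m)
    · exact Or.inl ⟨h, hq⟩
    · refine Or.inr ⟨?_, hq⟩
      change 1 < 4 / ω * (-1 * u (scaleMap r p₀ q) + (m + ω))
      rw [div_mul_eq_mul_div, lt_div_iff₀ hω] at h ⊢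
      linarith
  have hhalf : ENNReal.ofReal (1 / 2) * volume (growK d) + ENNReal.ofReal (1 / 2) *
      volume (growK d) = volume (growK d) := by
    rw [← add_mul, ← ENNReal.ofReal_add (by norm_num) (by norm_num)]
    norm_num
  have hv := (measure_mono hcover).trans (measure_union_le (μ := volume) _ _)
  rcases le_or_gt (ENNReal.ofReal (1 / 2) * volume (growK d))
    (volume ({q | 1 < 4 / ω * (u (scaleMap r p₀ q) + -m)} ∩ growK d)) with h | h
  · refine ⟨m + c / 4 * ω, fun q hq => ⟨?_, ?_⟩⟩
    · have := hlow u (-m) hu hs (fun q hq => by linarith [(hosc q hq).1]) h q hq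
      linarith
    · linarith [(hosc q (hin hq)).2]
  · have h' : ENNReal.ofReal (1 / 2) * volume (growK d) ≤
        volume ({q | 1 < 4 / ω * (-1 * u (scaleMap r p₀ q) + (m + ω))} ∩ growK d) := by
      by_contra h'
      push Not at h'
      exact absurd (hv.trans_lt (ENNReal.add_lt_add h h')) (by rw [hhalf]; exact lt_irrefl _)
    refine ⟨m, fun q hq => ⟨(hosc q (hin hq)).1, ?_⟩⟩
    have := hlow (fun q => -1 * u q) (m + ω) (contDiff_const.mul hu) hs'
      (fun q hq => by linarith [(hosc q hq).2]) h' q hq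
    linarith

/-- Interior modulus of continuity for functions in the Pucci class. -/
theorem osc_small {δ B : ℝ} (hδ : 0 < δ) (hδ1 : δ ≤ 1) (hB : 0 ≤ B) {η M : ℝ} (hη : 0 < η)
    (hM : 0 < M) : ∃ c₀ > (0 : ℝ), ∀ r : ℝ, 0 < r → r ≤ 1 → ∃ r' > (0 : ℝ),
      ∀ u f : ℝ × E d → ℝ, ContDiff ℝ 2 u → ∀ p₀ : ℝ × E d,
      SuperS δ B f u (box (3 * r ^ 2) (8 * r) p₀) →
      SuperS δ B f (fun q => -1 * u q) (box (3 * r ^ 2) (8 * r) p₀) →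
      (∀ q ∈ box (3 * r ^ 2) (8 * r) p₀, |u q| ≤ M) →
      lint f (box (3 * r ^ 2) (8 * r) p₀) ≤ ENNReal.ofReal c₀ →
      ∀ q ∈ box (3 * r' ^ 2) (8 * r') p₀, |u q - u p₀| ≤ η := by
  obtain ⟨θ, c₀, hθ, hθ1, hc₀, hstep⟩ := osc_step (d := d) hδ hδ1 hB
  refine ⟨c₀ * η ^ (d + 1), by positivity, fun r hr hr1 => ?_⟩
  obtain ⟨k, hk⟩ := exists_pow_lt_of_lt_one (show 0 < η / (2 * M) by positivity) hθ1
  have hsub : ∀ n : ℕ, ∀ p₀ : ℝ × E d, box (3 * (r / 8 ^ n) ^ 2) (8 * (r / 8 ^ n)) p₀ ⊆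
      box (3 * r ^ 2) (8 * r) p₀ := by
    intro n p₀
    have h1 : r / 8 ^ n ≤ r := div_le_self hr.le (one_le_pow₀ (by norm_num))
    have h0 : 0 ≤ r / 8 ^ n := by positivity
    exact prod_mono (Icc_subset_Icc_right (by gcongr)) (closedBall_subset_closedBall (by gcongr))
  refine ⟨r / 8 ^ k, by positivity, fun u f hu p₀ hs hs' hb hl => ?_⟩
  have key : ∀ n : ℕ, ∃ m : ℝ, ∀ q ∈ box (3 * (r / 8 ^ n) ^ 2) (8 * (r / 8 ^ n)) p₀,
      m ≤ u q ∧ u q ≤ m + max η (θ ^ n * (2 * M)) := by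
    intro n
    induction n with
    | zero =>
      refine ⟨-M, fun q hq => ?_⟩
      have := abs_le.1 (hb q (hsub 0 p₀ hq))
      have h2 := le_max_right η (θ ^ 0 * (2 * M))
      rw [pow_zero, one_mul] at h2
      rw [pow_zero, one_mul]
      constructor <;> linarith
    | succ n ih =>
      obtain ⟨m, hm⟩ := ih
      have hω : η ≤ max η (θ ^ n * (2 * M)) := le_max_left _ _
      obtain ⟨m', hm'⟩ := hstep u f hu (r / 8 ^ n) p₀ (by positivity)
        ((div_le_self hr.le (one_le_pow₀ (by norm_num))).trans hr1) (hs.mono (hsub n p₀))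
        (hs'.mono (hsub n p₀)) m _ (hη.trans_le hω) hm
        ((lint_mono_set (hsub n p₀)).trans (hl.trans (ENNReal.ofReal_le_ofReal (by gcongr))))
      have he : r / 8 ^ (n + 1) = r / 8 ^ n / 8 := by rw [pow_succ]; field_simp
      refine ⟨m', fun q hq => ?_⟩
      have hq' : q ∈ box ((r / 8 ^ n) ^ 2 / 2) (r / 8 ^ n) p₀ := by
        rw [he] at hq
        refine prod_mono (Icc_subset_Icc_right ?_) (closedBall_subset_closedBall ?_) hq
        · nlinarith [sq_nonneg (r / 8 ^ n)]
        · linarith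
      refine ⟨(hm' q hq').1, (hm' q hq').2.trans ?_⟩
      gcongr
      rw [mul_max_of_nonneg _ _ hθ.le, pow_succ', mul_assoc]
      exact max_le_max (mul_le_of_le_one_left hη.le hθ1.le) le_rfl
  obtain ⟨m, hm⟩ := key k
  intro q hq
  have hp : p₀ ∈ box (3 * (r / 8 ^ k) ^ 2) (8 * (r / 8 ^ k)) p₀ :=
    ⟨⟨le_rfl, by linarith [show 0 ≤ 3 * (r / 8 ^ k) ^ 2 by positivity]⟩,
      mem_closedBall_self (by positivity)⟩
  have hmax : max η (θ ^ k * (2 * M)) = η := by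
    rw [max_eq_left]
    rw [lt_div_iff₀ (by positivity)] at hk
    exact hk.le
  have h1 := hm q hq
  have h2 := hm p₀ hp
  rw [hmax] at h1 h2
  rw [abs_le]
  constructor <;> linarith

end Oscillation

section Mollification

open scoped Convolution
open ContinuousLinearMap (lsmul)

variable {X : Type*} [NormedAddCommGroup X] [NormedSpace ℝ X] [FiniteDimensional ℝ X]
  [MeasurableSpace X] [BorelSpace X] {μ : Measure X} [μ.IsAddHaarMeasure]

lemma fderiv_convolution {ζ g : X → ℝ} (hζ : ContDiff ℝ 1 ζ) (hc : HasCompactSupport ζ)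
    (hg : LocallyIntegrable g μ) (p v : X) :
    fderiv ℝ (ζ ⋆[lsmul ℝ ℝ, μ] g) p v =
      ((fun t => fderiv ℝ ζ t v) ⋆[lsmul ℝ ℝ, μ] g) p := by
  rw [(hc.hasFDerivAt_convolution_left (lsmul ℝ ℝ) hζ hg p).fderiv]
  unfold convolution
  have h : ConvolutionExistsAt (fderiv ℝ ζ) g p ((lsmul ℝ ℝ).precompL X) μ :=
    (hc.fderiv ℝ).convolutionExists_left _ (hζ.continuous_fderiv one_ne_zero) hg p
  rw [ContinuousLinearMap.integral_apply h.integrable]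
  rfl

/-- Young's inequality for a bump function. -/
lemma eLpNorm_bump_convolution_le (φ : ContDiffBump (0 : X)) {n : ℕ} (hn : n ≠ 0) {g : X → ℝ}
    (hg : AEStronglyMeasurable g μ) :
    eLpNorm (φ.normed μ ⋆[lsmul ℝ ℝ, μ] g) n μ ≤ eLpNorm g n μ := by
  set ν := μ.withDensity fun t => ENNReal.ofReal (φ.normed μ t) with hν
  have hmeas : Measurable fun t => ENNReal.ofReal (φ.normed μ t) :=
    φ.continuous_normed.measurable.ennreal_ofReal
  have hprob : IsProbabilityMeasure ν := by
    constructor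
    rw [hν, withDensity_apply _ MeasurableSet.univ, Measure.restrict_univ,
      ← ofReal_integral_eq_lintegral_ofReal φ.integrable_normed
        (Eventually.of_forall φ.nonneg_normed), φ.integral_normed, ENNReal.ofReal_one]
  have hac : ν ≪ μ := withDensity_absolutelyContinuous _ _
  have hsh : ∀ p : X, AEStronglyMeasurable (fun t => g (p - t)) μ := fun p =>
    hg.comp_quasiMeasurePreserving (quasiMeasurePreserving_sub_left μ p)
  have hpt : ∀ p : X, ‖(φ.normed μ ⋆[lsmul ℝ ℝ, μ] g) p‖ₑ ^ n ≤
      ∫⁻ t, ENNReal.ofReal (φ.normed μ t) * ‖g (p - t)‖ₑ ^ n ∂μ := by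
    intro p
    have h1 : ‖(φ.normed μ ⋆[lsmul ℝ ℝ, μ] g) p‖ₑ ≤ ∫⁻ t, ‖g (p - t)‖ₑ ∂ν := by
      rw [convolution_def]
      refine (enorm_integral_le_lintegral_enorm _).trans (le_of_eq ?_)
      rw [hν, lintegral_withDensity_eq_lintegral_mul₀ hmeas.aemeasurable (hsh p).enorm]
      refine lintegral_congr fun t => ?_
      rw [ContinuousLinearMap.lsmul_apply, smul_eq_mul, enorm_mul, Pi.mul_apply,
        Real.enorm_of_nonneg (φ.nonneg_normed t)]
    have h2 : eLpNorm' (fun t => g (p - t)) 1 ν ≤ eLpNorm' (fun t => g (p - t)) n ν :=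
      eLpNorm'_le_eLpNorm'_of_exponent_le one_pos
        (by exact_mod_cast Nat.one_le_iff_ne_zero.2 hn) ν ((hsh p).mono_ac hac)
    have hn0 : (n : ℝ) ≠ 0 := by exact_mod_cast hn
    simp only [eLpNorm', ENNReal.rpow_one, div_one, ENNReal.rpow_natCast] at h2
    calc _ ≤ ((∫⁻ t, ‖g (p - t)‖ₑ ^ n ∂ν) ^ (1 / (n : ℝ))) ^ n := by
          gcongr
          exact h1.trans h2
      _ = ∫⁻ t, ‖g (p - t)‖ₑ ^ n ∂ν := by
          rw [← ENNReal.rpow_natCast, ← ENNReal.rpow_mul, one_div, inv_mul_cancel₀ hn0,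
            ENNReal.rpow_one]
      _ = _ := by
          rw [hν, lintegral_withDensity_eq_lintegral_mul₀ hmeas.aemeasurable
            ((hsh p).enorm.pow_const n)]
          rfl
  have hn0 : (n : ℝ≥0∞) ≠ 0 := by exact_mod_cast hn
  rw [eLpNorm_eq_lintegral_rpow_enorm_toReal hn0 (ENNReal.natCast_ne_top n),
    eLpNorm_eq_lintegral_rpow_enorm_toReal hn0 (ENNReal.natCast_ne_top n)]
  gcongr ?_ ^ _
  simp only [ENNReal.toReal_natCast, ENNReal.rpow_natCast]
  refine (lintegral_mono hpt).trans ?_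
  have hjoint : AEMeasurable (Function.uncurry fun p t : X =>
      ENNReal.ofReal (φ.normed μ t) * ‖g (p - t)‖ₑ ^ n) (μ.prod μ) := by
    refine AEMeasurable.mul (hmeas.comp measurable_snd).aemeasurable ?_
    refine AEMeasurable.pow_const ?_ n
    exact (hg.comp_quasiMeasurePreserving
      (quasiMeasurePreserving_sub μ μ)).enorm
  rw [lintegral_lintegral_swap hjoint]
  have : ∀ t, ∫⁻ p, ENNReal.ofReal (φ.normed μ t) * ‖g (p - t)‖ₑ ^ n ∂μ =
      ENNReal.ofReal (φ.normed μ t) * ∫⁻ p, ‖g p‖ₑ ^ n ∂μ := by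
    intro t
    rw [lintegral_const_mul' _ _ ENNReal.ofReal_ne_top,
      lintegral_sub_right_eq_self (fun p => ‖g p‖ₑ ^ n)]
  simp_rw [this]
  rw [lintegral_mul_const _ hmeas, ← ofReal_integral_eq_lintegral_ofReal φ.integrable_normed
    (Eventually.of_forall φ.nonneg_normed), φ.integral_normed, ENNReal.ofReal_one, one_mul]

lemma tendsto_bump_convolution {n : ℕ} (hn : n ≠ 0) {g : X → ℝ} (hg : MemLp g n μ) {ε : ℝ≥0∞}
    (hε : ε ≠ 0) : ∃ ρ > (0 : ℝ), ∀ φ : ContDiffBump (0 : X), φ.rOut < ρ →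
      eLpNorm (fun p => (φ.normed μ ⋆[lsmul ℝ ℝ, μ] g) p - g p) n μ ≤ ε := by
  have hn1 : (1 : ℝ≥0∞) ≤ n := by exact_mod_cast Nat.one_le_iff_ne_zero.2 hn
  have hε3 : ε / 3 ≠ 0 := (ENNReal.div_pos hε (by norm_num)).ne'
  obtain ⟨h, hhc, hh, hcont, hhm⟩ :=
    hg.exists_hasCompactSupport_eLpNorm_sub_le (ENNReal.natCast_ne_top n) hε3
  have hKc : IsCompact (cthickening 1 (tsupport h)) := hhc.isCompact.cthickening
  obtain ⟨η, hη, hηε⟩ : ∃ η > (0 : ℝ), ENNReal.ofReal η *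
      μ (cthickening 1 (tsupport h)) ^ (1 / (n : ℝ)) ≤ ε / 3 := by
    set V := μ (cthickening 1 (tsupport h)) ^ (1 / (n : ℝ)) with hV
    have hVt : V ≠ ∞ := ENNReal.rpow_ne_top_of_nonneg (by positivity) hKc.measure_lt_top.ne
    by_cases he : ε / 3 = ∞
    · exact ⟨1, one_pos, by rw [he]; exact le_top⟩
    have hpos : 0 < (ε / 3).toReal := ENNReal.toReal_pos hε3 he
    refine ⟨(ε / 3).toReal / (V.toReal + 1), by positivity, ?_⟩
    rw [← ENNReal.ofReal_toReal hVt, ← ENNReal.ofReal_mul (by positivity)]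
    rw [ENNReal.ofReal_le_iff_le_toReal he, ENNReal.toReal_ofReal ENNReal.toReal_nonneg,
      div_mul_eq_mul_div, div_le_iff₀ (by positivity)]
    nlinarith
  have huc : UniformContinuous h := hhc.uniformContinuous_of_continuous hcont
  obtain ⟨ρ, hρ, hρη⟩ := Metric.uniformContinuous_iff.1 huc η hη
  refine ⟨min ρ 1, by positivity, fun φ hφ => ?_⟩
  have hφρ := hφ.trans_le (min_le_left _ _)
  have hφ1 := hφ.trans_le (min_le_right _ _)
  have hli : LocallyIntegrable g μ := hg.locallyIntegrable hn1
  have hlh : LocallyIntegrable h μ := hcont.locallyIntegrable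
  have hcz : HasCompactSupport (φ.normed μ) := φ.hasCompactSupport_normed
  have hmid : ∀ p, ‖(φ.normed μ ⋆[lsmul ℝ ℝ, μ] h) p - h p‖ ≤
      ‖(cthickening 1 (tsupport h)).indicator (fun _ => η) p‖ := by
    intro p
    by_cases hp : p ∈ cthickening 1 (tsupport h)
    · rw [indicator_of_mem hp, Real.norm_of_nonneg hη.le, ← dist_eq_norm]
      exact φ.dist_normed_convolution_le hcont.aestronglyMeasurable
        fun x hx => (hρη ((mem_ball.1 hx).trans hφρ)).le
    · have hz : ∀ x ∈ ball p φ.rOut, h x = 0 := by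
        intro x hx
        by_contra hne
        refine hp (mem_cthickening_of_dist_le p x 1 _ (subset_tsupport h hne) ?_)
        rw [dist_comm]
        exact ((mem_ball.1 hx).trans hφ1).le
      have hz0 := hz p (mem_ball_self φ.rOut_pos)
      rw [φ.normed_convolution_eq_right (fun x hx => by rw [hz x hx, hz0]), sub_self, norm_zero]
      exact norm_nonneg _
  have hcm : AEStronglyMeasurable (φ.normed μ ⋆[lsmul ℝ ℝ, μ] (g - h)) μ :=
    (hcz.continuous_convolution_left _ φ.continuous_normed
      (hli.sub hlh)).aestronglyMeasurable
  have hcm' : AEStronglyMeasurable (fun p => (φ.normed μ ⋆[lsmul ℝ ℝ, μ] h) p - h p) μ :=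
    ((hcz.continuous_convolution_left _ φ.continuous_normed hlh).sub hcont).aestronglyMeasurable
  have hsplit : (fun p => (φ.normed μ ⋆[lsmul ℝ ℝ, μ] g) p - g p) =
      (φ.normed μ ⋆[lsmul ℝ ℝ, μ] (g - h)) +
        (fun p => (φ.normed μ ⋆[lsmul ℝ ℝ, μ] h) p - h p) + (-(g - h)) := by
    funext p
    have e1 : ConvolutionExistsAt (φ.normed μ) (g - h) p (lsmul ℝ ℝ) μ :=
      hcz.convolutionExists_left _ φ.continuous_normed (hli.sub hlh) p
    have e2 : ConvolutionExistsAt (φ.normed μ) h p (lsmul ℝ ℝ) μ :=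
      hcz.convolutionExists_left _ φ.continuous_normed hlh p
    have e3 := e1.distrib_add e2
    rw [sub_add_cancel] at e3
    simp only [Pi.add_apply, Pi.neg_apply, Pi.sub_apply]
    rw [e3]
    ring
  have h1 : eLpNorm (φ.normed μ ⋆[lsmul ℝ ℝ, μ] (g - h)) n μ ≤ ε / 3 :=
    (eLpNorm_bump_convolution_le φ hn (hg.1.sub hhm.1)).trans hh
  have h2 : eLpNorm (fun p => (φ.normed μ ⋆[lsmul ℝ ℝ, μ] h) p - h p) n μ ≤ ε / 3 := by
    refine (eLpNorm_mono hmid).trans ((eLpNorm_indicator_const_le _ _).trans ?_)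
    rw [Real.enorm_of_nonneg hη.le, ENNReal.toReal_natCast]
    exact hηε
  rw [hsplit]
  calc _ ≤ eLpNorm ((φ.normed μ ⋆[lsmul ℝ ℝ, μ] (g - h)) +
        (fun p => (φ.normed μ ⋆[lsmul ℝ ℝ, μ] h) p - h p)) n μ + eLpNorm (-(g - h)) n μ :=
        eLpNorm_add_le (hcm.add hcm') (hg.1.sub hhm.1).neg hn1
    _ ≤ (ε / 3 + ε / 3) + ε / 3 := by
        gcongr
        · exact (eLpNorm_add_le hcm hcm' hn1).trans (add_le_add h1 h2)
        · rw [eLpNorm_neg]; exact hh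
    _ = ε := ENNReal.add_thirds ε

end Mollification

section Approximation

open scoped Convolution
open ContinuousLinearMap (lsmul)

variable {d : ℕ}

/-- Approximation on `S` by smooth functions, uniformly for `u` and in `L_{d+1}` for the
derivatives. -/
def Approx (S : Set (ℝ × E d)) (u ut : ℝ × E d → ℝ) (ux : ℝ × E d → E d)
    (uxx : ℝ × E d → Matrix (Fin d) (Fin d) ℝ) : Prop :=
  ∀ η > (0 : ℝ), ∃ v e : ℝ × E d → ℝ, ContDiff ℝ 2 v ∧ Measurable e ∧
    (∀ q ∈ S, |v q - u q| ≤ η) ∧ lint e S ≤ ENNReal.ofReal η ∧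
    ∀ᵐ q ∂volume.restrict S, |Dt v q - ut q| ≤ e q ∧ ‖Dx v q - ux q‖ ≤ e q ∧
      ‖Dxx v q - uxx q‖ ≤ e q

lemma norm_le_sum_abs (x : E d) : ‖x‖ ≤ ∑ i, |x i| := by
  conv_lhs => rw [← sum_esingle x]
  refine (norm_sum_le _ _).trans (Finset.sum_le_sum fun i _ => ?_)
  rw [norm_smul, Real.norm_eq_abs]
  simp [esingle]

lemma fderiv_const_sub_apply {X : Type*} [NormedAddCommGroup X] [NormedSpace ℝ X] {ζ : X → ℝ}
    (hζ : Differentiable ℝ ζ) (p q w : X) :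
    fderiv ℝ (fun z => ζ (p - z)) q w = -fderiv ℝ ζ (p - q) w := by
  have h : HasFDerivAt (fun z => ζ (p - z)) _ q :=
    (hζ (p - q)).hasFDerivAt.comp q ((hasFDerivAt_id q).const_sub p)
  rw [h.fderiv]
  simp

lemma setIntegral_mul_eq_convolution {u G : ℝ × E d → ℝ} {V Q : Set (ℝ × E d)} (hVQ : V ⊆ Q)
    (p : ℝ × E d) (hG : ∀ q, q ∉ V → G (p - q) = 0) :
    ∫ q in Q, u q * G (p - q) = (G ⋆[lsmul ℝ ℝ] V.indicator u) p := by
  rw [setIntegral_eq_integral_of_forall_compl_eq_zero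
    (fun q hq => by rw [hG q fun h => hq (hVQ h), mul_zero]), convolution_lsmul,
    ← integral_sub_left_eq_self (fun t => G t • V.indicator u (p - t)) volume p]
  refine integral_congr_ae (Eventually.of_forall fun q => ?_)
  dsimp only
  rw [sub_sub_cancel, smul_eq_mul]
  by_cases hq : q ∈ V
  · rw [indicator_of_mem hq, mul_comm]
  · rw [hG q hq, mul_zero, zero_mul]

lemma contDiff_fderiv_top {X : Type*} [NormedAddCommGroup X] [NormedSpace ℝ X] {ζ : X → ℝ}
    (hζ : ContDiff ℝ (⊤ : ℕ∞) ζ) (w : X) : ContDiff ℝ (⊤ : ℕ∞) fun t => fderiv ℝ ζ t w :=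
  (hζ.fderiv_right (m := ((⊤ : ℕ∞) : WithTop ℕ∞)) (by simp)).clm_apply contDiff_const

/-- Mollification of a function with weak derivatives. -/
lemma approx_of_weakDerivs {Q K : Set (ℝ × E d)} {u ut : ℝ × E d → ℝ} {ux : ℝ × E d → E d}
    {uxx : ℝ × E d → Matrix (Fin d) (Fin d) ℝ} (hw : WeakDerivs Q u ut ux uxx) (hK : IsCompact K)
    {ρ₀ : ℝ} (hρ₀ : 0 < ρ₀) (hKQ : cthickening ρ₀ K ⊆ interior Q)
    (hu : ContinuousOn u (cthickening ρ₀ K))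
    (hut : MemLp ut (d + 1 : ℕ) (volume.restrict (cthickening ρ₀ K)))
    (hux : ∀ i, MemLp (fun q => ux q i) (d + 1 : ℕ) (volume.restrict (cthickening ρ₀ K)))
    (huxx : ∀ i j, MemLp (fun q => uxx q i j) (d + 1 : ℕ) (volume.restrict (cthickening ρ₀ K))) :
    Approx K u ut ux uxx := by
  intro η hη
  set V := cthickening ρ₀ K with hV
  have hVc : IsCompact V := hK.cthickening
  have hVm : MeasurableSet V := hVc.measurableSet
  have hVQ : V ⊆ Q := hKQ.trans interior_subset
  have hn0 : d + 1 ≠ 0 := Nat.succ_ne_zero d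
  set U := V.indicator u with hU
  have hUl : LocallyIntegrable U volume :=
    ((hu.integrableOn_compact hVc).integrable_indicator hVm).locallyIntegrable
  set ι := Unit ⊕ Fin d ⊕ Fin d × Fin d
  set G : ι → ℝ × E d → ℝ := Sum.elim (fun _ => ut) (Sum.elim (fun i q => ux q i)
    (fun ij q => uxx q ij.1 ij.2)) with hGdef
  have hG : ∀ k, MemLp (V.indicator (G k)) (d + 1 : ℕ) volume := by
    intro k
    rw [memLp_indicator_iff_restrict hVm]
    rcases k with k | k | k
    · exact hut
    · exact hux k
    · exact huxx k.1 k.2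
  set N : ℝ := Fintype.card ι + 1 with hN
  have hN0 : 0 < N := by positivity
  set ε : ℝ := min η 1 / N with hε
  have hε0 : 0 < ε := by positivity
  have hch : ∀ k, ∃ ρ > (0 : ℝ), ∀ φ : ContDiffBump (0 : ℝ × E d), φ.rOut < ρ →
      eLpNorm (fun p => (φ.normed volume ⋆[lsmul ℝ ℝ] V.indicator (G k)) p - V.indicator (G k) p)
        (d + 1 : ℕ) volume ≤ ENNReal.ofReal ε := fun k =>
    tendsto_bump_convolution hn0 (hG k) (by simpa using hε0)
  choose ρ hρ hρε using hch
  obtain ⟨ρ₁, hρ₁, hρ₁le⟩ : ∃ ρ₁ > (0 : ℝ), ∀ k, ρ₁ ≤ ρ k := by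
    obtain ⟨k₀, hk₀⟩ := Finite.exists_min ρ
    exact ⟨ρ k₀, hρ k₀, hk₀⟩
  obtain ⟨ρ₂, hρ₂, hρ₂u⟩ := Metric.uniformContinuousOn_iff.1
    (hVc.uniformContinuousOn_of_continuous hu) η hη
  set R := min ρ₀ (min ρ₁ ρ₂) / 2 with hR
  have hR0 : 0 < R := by positivity
  have hRlt : R < min ρ₀ (min ρ₁ ρ₂) := half_lt_self (by positivity)
  have hR₀ : R < ρ₀ := hRlt.trans_le (min_le_left _ _)
  have hR₁ : R < ρ₁ := hRlt.trans_le ((min_le_right _ _).trans (min_le_left _ _))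
  have hR₂ : R < ρ₂ := hRlt.trans_le ((min_le_right _ _).trans (min_le_right _ _))
  let φ : ContDiffBump (0 : ℝ × E d) := ⟨R / 2, R, by positivity, by linarith⟩
  have hφR : φ.rOut = R := rfl
  set ζ := φ.normed volume with hζ
  have hζs : ContDiff ℝ (⊤ : ℕ∞) ζ := φ.contDiff_normed
  have hζ1 : ContDiff ℝ 1 ζ := hζs.of_le (by exact_mod_cast le_top)
  have hζd : Differentiable ℝ ζ := hζ1.differentiable one_ne_zero
  have hζc : HasCompactSupport ζ := φ.hasCompactSupport_normed
  have hζt : tsupport ζ = closedBall 0 R := φ.tsupport_normed_eq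
  have hmemV : ∀ p ∈ K, ∀ q, dist q p ≤ R → q ∈ V := fun p hp q hq =>
    mem_cthickening_of_dist_le q p ρ₀ K hp (hq.trans hR₀.le)
  set v : ℝ × E d → ℝ := ζ ⋆[lsmul ℝ ℝ] U with hv
  have hvs : ContDiff ℝ 2 v :=
    hζc.contDiff_convolution_left (n := 2) (lsmul ℝ ℝ)
      (hζs.of_le (by exact_mod_cast le_top)) hUl
  have hψ : ∀ p ∈ K, ContDiff ℝ (⊤ : ℕ∞) (fun q => ζ (p - q)) ∧
      HasCompactSupport (fun q => ζ (p - q)) ∧ tsupport (fun q => ζ (p - q)) ⊆ interior Q := by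
    intro p hp
    have hs : tsupport (fun q => ζ (p - q)) ⊆ closedBall p R := by
      refine closure_minimal (fun q hq => ?_) isClosed_closedBall
      have : p - q ∈ tsupport ζ := subset_tsupport _ hq
      rw [hζt, mem_closedBall_zero_iff] at this
      rwa [mem_closedBall, dist_comm, dist_eq_norm]
    refine ⟨hζs.comp (contDiff_const.sub contDiff_id),
      (isCompact_closedBall p R).of_isClosed_subset (isClosed_tsupport _) hs,
      hs.trans fun q hq => hKQ (hmemV p hp q hq)⟩
  have hoff : ∀ p ∈ K, ∀ q, q ∉ V → p - q ∉ tsupport ζ := by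
    intro p hp q hq h
    rw [hζt, mem_closedBall_zero_iff] at h
    exact hq (hmemV p hp q (by rwa [dist_comm, dist_eq_norm]))
  have hz0 : ∀ p ∈ K, ∀ q, q ∉ V → ζ (p - q) = 0 := fun p hp q hq =>
    image_eq_zero_of_notMem_tsupport (hoff p hp q hq)
  have hz1 : ∀ w, ∀ p ∈ K, ∀ q, q ∉ V → fderiv ℝ ζ (p - q) w = 0 := fun w p hp q hq => by
    rw [image_eq_zero_of_notMem_tsupport fun h => hoff p hp q hq (tsupport_fderiv_subset ℝ h)]
    rfl
  have hts : ∀ w, tsupport (fun t => fderiv ℝ ζ t w) ⊆ tsupport ζ := fun w =>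
    closure_minimal (fun t ht => tsupport_fderiv_subset ℝ (subset_tsupport _ fun h => ht (by
      dsimp only; rw [h]; rfl))) (isClosed_tsupport _)
  have hz2 : ∀ w w', ∀ p ∈ K, ∀ q, q ∉ V →
      fderiv ℝ (fun t => fderiv ℝ ζ t w) (p - q) w' = 0 := fun w w' p hp q hq => by
    rw [image_eq_zero_of_notMem_tsupport fun h => hoff p hp q hq
      (hts w (tsupport_fderiv_subset ℝ h))]
    rfl
  have hc1 : ∀ w, HasCompactSupport fun t => fderiv ℝ ζ t w := fun w =>
    hζc.isCompact.of_isClosed_subset (isClosed_tsupport _) (hts w)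
  have hfirst : ∀ (w : ℝ × E d) (h : ℝ × E d → ℝ), (∀ ψ : ℝ × E d → ℝ,
      ContDiff ℝ (⊤ : ℕ∞) ψ → HasCompactSupport ψ → tsupport ψ ⊆ interior Q →
      ∫ p in Q, u p * fderiv ℝ ψ p w = -∫ p in Q, h p * ψ p) → ∀ p ∈ K,
      fderiv ℝ v p w = (ζ ⋆[lsmul ℝ ℝ] V.indicator h) p := by
    intro w h hh p hp
    obtain ⟨h1, h2, h3⟩ := hψ p hp
    have h4 := hh _ h1 h2 h3
    rw [setIntegral_mul_eq_convolution hVQ p (hz0 p hp)] at h4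
    simp_rw [fderiv_const_sub_apply hζd, mul_neg] at h4
    rw [integral_neg, neg_inj, setIntegral_mul_eq_convolution (G := fun t => fderiv ℝ ζ t w) hVQ p
      (hz1 w p hp)] at h4
    rw [hv, fderiv_convolution hζ1 hζc hUl]
    exact h4
  have hsecond : ∀ i j, ∀ p ∈ K, Dxx v p i j =
      (ζ ⋆[lsmul ℝ ℝ] V.indicator fun q => uxx q i j) p := by
    intro i j p hp
    obtain ⟨h1, h2, h3⟩ := hψ p hp
    have h4 := (hw _ h1 h2 h3).2.2 i j
    rw [setIntegral_mul_eq_convolution hVQ p (hz0 p hp)] at h4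
    have h5 : ContDiff ℝ 1 fun t => fderiv ℝ ζ t ((0 : ℝ), (esingle j : E d)) :=
      (contDiff_fderiv_top hζs _).of_le (by exact_mod_cast le_top)
    have h6 : Differentiable ℝ fun t => fderiv ℝ ζ t ((0 : ℝ), (esingle j : E d)) :=
      h5.differentiable one_ne_zero
    have h7 : ∀ q, fderiv ℝ (fun q => fderiv ℝ (fun z => ζ (p - z)) q
        ((0 : ℝ), (esingle j : E d))) q ((0 : ℝ), (esingle i : E d)) =
        fderiv ℝ (fun t => fderiv ℝ ζ t ((0 : ℝ), (esingle j : E d))) (p - q)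
          ((0 : ℝ), (esingle i : E d)) := by
      intro q
      simp_rw [fderiv_const_sub_apply hζd]
      rw [fderiv_fun_neg, _root_.neg_apply, fderiv_const_sub_apply h6, neg_neg]
    simp_rw [h7] at h4
    rw [setIntegral_mul_eq_convolution (G := fun t => fderiv ℝ (fun t => fderiv ℝ ζ t
      ((0 : ℝ), (esingle j : E d))) t ((0 : ℝ), (esingle i : E d))) hVQ p (hz2 _ _ p hp)] at h4
    rw [← h4, Dxx]
    have h8 : (fun q => fderiv ℝ v q ((0 : ℝ), (esingle j : E d))) =
        (fun t => fderiv ℝ ζ t ((0 : ℝ), (esingle j : E d))) ⋆[lsmul ℝ ℝ] U := by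
      funext q
      rw [hv, fderiv_convolution hζ1 hζc hUl]
    rw [h8, fderiv_convolution h5 (hc1 _) hUl]
  set r : ι → ℝ × E d → ℝ := fun k p => (ζ ⋆[lsmul ℝ ℝ] V.indicator (G k)) p - V.indicator (G k) p
    with hr
  have hn1 : (1 : ℝ≥0∞) ≤ ((d + 1 : ℕ) : ℝ≥0∞) := Nat.one_le_cast.2 (by omega)
  have hrm : ∀ k, AEStronglyMeasurable (r k) volume := fun k =>
    (hζc.continuous_convolution_left (lsmul ℝ ℝ) hζ1.continuous
      ((hG k).locallyIntegrable hn1)).aestronglyMeasurable.sub (hG k).1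
  set e : ℝ × E d → ℝ := fun p => ∑ k, |(hrm k).mk (r k) p| with he
  have hem : Measurable e :=
    Finset.measurable_fun_sum _ fun k _ => (hrm k).stronglyMeasurable_mk.measurable.abs
  refine ⟨v, e, hvs, hem, ?_, ?_, ?_⟩
  · intro q hq
    have hqV : q ∈ V := self_subset_cthickening K hq
    have hUq : U q = u q := indicator_of_mem hqV u
    rw [← hUq, ← Real.dist_eq]
    refine φ.dist_normed_convolution_le hUl.aestronglyMeasurable fun x hx => ?_
    have hxV : x ∈ V := hmemV q hq x (mem_ball.1 hx).le
    rw [hUq, hU, indicator_of_mem hxV]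
    exact (hρ₂u x hxV q hqV ((mem_ball.1 hx).trans hR₂)).le
  · have h1 : eLpNorm e (d + 1 : ℕ) volume ≤ ENNReal.ofReal (min η 1) := by
      calc eLpNorm e (d + 1 : ℕ) volume
          ≤ ∑ k, eLpNorm (fun p => |(hrm k).mk (r k) p|) (d + 1 : ℕ) volume := by
            have : e = ∑ k, fun p => |(hrm k).mk (r k) p| := by
              funext p; simp [he, Finset.sum_apply]
            rw [this]
            exact eLpNorm_sum_le (fun k _ =>
              (hrm k).stronglyMeasurable_mk.measurable.abs.aestronglyMeasurable) hn1
        _ ≤ ∑ _k : ι, ENNReal.ofReal ε := by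
            refine Finset.sum_le_sum fun k _ => ?_
            refine le_trans (le_of_eq ?_) (hρε k φ (hφR ▸ hR₁.trans_le (hρ₁le k)))
            refine eLpNorm_congr_norm_ae ?_
            filter_upwards [(hrm k).ae_eq_mk] with p hp
            rw [Real.norm_eq_abs, abs_abs, ← hp, Real.norm_eq_abs]
        _ = ENNReal.ofReal (Fintype.card ι * ε) := by
            rw [Finset.sum_const, nsmul_eq_mul, Finset.card_univ,
              ENNReal.ofReal_mul (by positivity), ENNReal.ofReal_natCast]
        _ ≤ ENNReal.ofReal (min η 1) := by
            refine ENNReal.ofReal_le_ofReal ?_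
            rw [hε, mul_div_assoc', div_le_iff₀ hN0, mul_comm]
            gcongr
            linarith
    have h2 : lint e K ≤ eLpNorm e (d + 1 : ℕ) volume ^ (d + 1) := by
      rw [eLpNorm_eq_lintegral_rpow_enorm_toReal (by exact_mod_cast hn0)
        (ENNReal.natCast_ne_top _), ENNReal.toReal_natCast, ← ENNReal.rpow_natCast (_ ^ _),
        ← ENNReal.rpow_mul, one_div, inv_mul_cancel₀ (by positivity), ENNReal.rpow_one]
      simp only [ENNReal.rpow_natCast]
      refine (setLIntegral_le_lintegral _ _).trans (lintegral_mono fun q => ?_)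
      gcongr
      rw [Real.enorm_eq_ofReal_abs]
      exact ENNReal.ofReal_le_ofReal (le_abs_self _)
    refine h2.trans ?_
    calc _ ≤ ENNReal.ofReal (min η 1) ^ (d + 1) := by gcongr
      _ ≤ ENNReal.ofReal (min η 1) ^ 1 := by
          refine pow_le_pow_right_of_le_one' ?_ (by omega)
          rw [ENNReal.ofReal_le_one]
          exact min_le_right _ _
      _ ≤ _ := by
          rw [pow_one]
          exact ENNReal.ofReal_le_ofReal (min_le_left _ _)
  · have hall : ∀ᵐ q ∂(volume : Measure (ℝ × E d)), ∀ k, r k q = (hrm k).mk (r k) q :=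
      eventually_countable_forall.2 fun k => (hrm k).ae_eq_mk
    filter_upwards [ae_restrict_of_ae hall, ae_restrict_mem hK.measurableSet] with q hq hqK
    have hqV : q ∈ V := self_subset_cthickening K hqK
    have he' : e q = ∑ k, |r k q| := by
      rw [he]
      exact Finset.sum_congr rfl fun k _ => by rw [hq k]
    have hle : ∀ s : Finset ι, ∑ k ∈ s, |r k q| ≤ e q := fun s => by
      rw [he']
      exact Finset.sum_le_sum_of_subset_of_nonneg (Finset.subset_univ s) fun _ _ _ => abs_nonneg _
    have hrt : r (Sum.inl ()) q = Dt v q - ut q := by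
      simp only [hr, hGdef, Sum.elim_inl, indicator_of_mem hqV]
      rw [Dt, hfirst _ ut (fun ψ a b c => (hw ψ a b c).1) q hqK]
    have hrx : ∀ i, r (Sum.inr (Sum.inl i)) q = (Dx v q - ux q) i := by
      intro i
      simp only [hr, hGdef, Sum.elim_inl, Sum.elim_inr, indicator_of_mem hqV]
      rw [PiLp.sub_apply, Dx_apply, hfirst _ (fun q => ux q i)
        (fun ψ a b c => (hw ψ a b c).2.1 i) q hqK]
    have hrxx : ∀ i j, r (Sum.inr (Sum.inr (i, j))) q = (Dxx v q - uxx q) i j := by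
      intro i j
      simp only [hr, hGdef, Sum.elim_inr, indicator_of_mem hqV]
      rw [Matrix.sub_apply, hsecond i j q hqK]
    have hsing : ∀ k, |r k q| ≤ e q := fun k => by simpa using hle {k}
    refine ⟨hrt ▸ hsing _, ?_, ?_⟩
    · refine (norm_le_sum_abs _).trans ?_
      have := hle (Finset.univ.map ⟨fun i : Fin d => (Sum.inr (Sum.inl i) : ι), fun a b h =>
        Sum.inl_injective (Sum.inr_injective h)⟩)
      rw [Finset.sum_map] at this
      exact (Finset.sum_congr rfl fun i _ => congrArg abs (hrx i).symm).trans_le this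
    · rw [Matrix.norm_le_iff (le_trans (abs_nonneg _) (hsing (Sum.inl ())))]
      intro i j
      rw [Real.norm_eq_abs, ← hrxx]
      exact hsing _

end Approximation

section WeakABP

variable {d : ℕ} {S S' : Set (ℝ × E d)} {u ut u' ut' : ℝ × E d → ℝ} {ux ux' : ℝ × E d → E d}
  {uxx uxx' : ℝ × E d → Matrix (Fin d) (Fin d) ℝ}

lemma Approx.mono (h : Approx S u ut ux uxx) (hS : S' ⊆ S) : Approx S' u ut ux uxx := by
  intro η hη
  obtain ⟨v, e, hv, he, h1, h2, h3⟩ := h η hη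
  exact ⟨v, e, hv, he, fun q hq => h1 q (hS hq), (lint_mono_set hS).trans h2,
    ae_restrict_of_ae_restrict_of_subset hS h3⟩

lemma approx_smooth (hu : ContDiff ℝ 2 u) : Approx S u (Dt u) (Dx u) (Dxx u) := fun η hη =>
  ⟨u, fun _ => 0, hu, measurable_const, by simp [hη.le], by simp [lint], by simp⟩

lemma Approx.add (h : Approx S u ut ux uxx) (h' : Approx S u' ut' ux' uxx') :
    Approx S (fun q => u q + u' q) (fun q => ut q + ut' q) (fun q => ux q + ux' q)
      (fun q => uxx q + uxx' q) := by
  intro η hη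
  set κ : ℝ := η / (2 ^ (d + 1) * 2) with hκ
  have hκ0 : 0 < κ := by positivity
  have hκη : 2 ^ (d + 1) * (κ + κ) = η := by rw [hκ]; field_simp; ring
  have hκ2 : κ + κ ≤ η := by
    rw [← hκη]
    exact le_mul_of_one_le_left (by positivity) (one_le_pow₀ (by norm_num))
  obtain ⟨v, e, hv, he, h1, h2, h3⟩ := h κ hκ0
  obtain ⟨v', e', hv', he', h1', h2', h3'⟩ := h' κ hκ0
  refine ⟨fun q => v q + v' q, fun q => e q + e' q, hv.add hv', he.add he', fun q hq => ?_, ?_, ?_⟩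
  · have := abs_add_le (v q - u q) (v' q - u' q)
    rw [show v q + v' q - (u q + u' q) = v q - u q + (v' q - u' q) by ring]
    linarith [h1 q hq, h1' q hq]
  · refine (lint_add_le he' S).trans ?_
    calc _ ≤ 2 ^ (d + 1) * (ENNReal.ofReal κ + ENNReal.ofReal κ) := by gcongr
      _ = ENNReal.ofReal η := by
          rw [← ENNReal.ofReal_add hκ0.le hκ0.le, ← hκη, ENNReal.ofReal_mul (by positivity),
            ENNReal.ofReal_pow (by norm_num), ENNReal.ofReal_ofNat]
  · filter_upwards [h3, h3'] with q ha hb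
    rw [Dt_add hv hv', Dx_add hv hv', Dxx_add hv hv', add_sub_add_comm, add_sub_add_comm,
      add_sub_add_comm]
    exact ⟨(abs_add_le _ _).trans (add_le_add ha.1 hb.1),
      (norm_add_le _ _).trans (add_le_add ha.2.1 hb.2.1),
      (norm_add_le _ _).trans (add_le_add ha.2.2 hb.2.2)⟩

lemma Approx.neg (h : Approx S u ut ux uxx) :
    Approx S (fun q => -u q) (fun q => -ut q) (fun q => -ux q) (fun q => -uxx q) := by
  intro η hη
  obtain ⟨v, e, hv, he, h1, h2, h3⟩ := h η hη
  refine ⟨fun q => -1 * v q, e, contDiff_const.mul hv, he, fun q hq => ?_, h2, ?_⟩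
  · dsimp only
    rw [neg_one_mul, neg_sub_neg, abs_sub_comm]
    exact h1 q hq
  · filter_upwards [h3] with q hq
    rw [Dt_const_mul hv, Dx_const_mul hv, Dxx_const_mul hv, neg_one_mul, neg_one_smul, neg_one_smul,
      neg_sub_neg, neg_sub_neg, neg_sub_neg, abs_sub_comm, norm_sub_rev, norm_sub_rev (uxx q)]
    exact hq

lemma le_add_error {δ B : ℝ} (hδ : 0 < δ) (hδ1 : δ ≤ 1) (hB : 0 ≤ B) {a a' e : ℝ} {b b' : E d}
    {A A' : Matrix (Fin d) (Fin d) ℝ} (h1 : |a' - a| ≤ e) (h2 : ‖b' - b‖ ≤ e) (h3 : ‖A' - A‖ ≤ e) :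
    a + pucci δ A + B * ‖b‖ ≤ a' + pucci δ A' + B * ‖b'‖ + (1 + puccC d δ + B) * e := by
  have e1 := pucci_sub_le hδ hδ1 A A'
  rw [norm_sub_rev] at e1
  have e2 : puccC d δ * ‖A' - A‖ ≤ puccC d δ * e :=
    mul_le_mul_of_nonneg_left h3 (puccC_nonneg hδ)
  have e3 := norm_sub_norm_le b b'
  rw [norm_sub_rev] at e3
  have e4 : B * (‖b‖ - ‖b'‖) ≤ B * e := mul_le_mul_of_nonneg_left (by linarith) hB
  have e5 := (abs_le.1 h1).1
  linarith

lemma lint_const_mul_le {f : ℝ × E d → ℝ} {c κ : ℝ} (hc : 0 ≤ c)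
    (h : lint f S ≤ ENNReal.ofReal κ) :
    lint (fun q => c * f q) S ≤ ENNReal.ofReal (c ^ (d + 1) * κ) := by
  rw [lint_const_mul hc, ENNReal.ofReal_mul (by positivity), ENNReal.ofReal_pow hc]
  gcongr

/-- Parabolic Aleksandrov estimate on open sets for functions that can be approximated. -/
theorem abp_weak {δ B T₁ R : ℝ} (hδ : 0 < δ) (hδ1 : δ ≤ 1) (hB : 0 ≤ B) (hT : 0 ≤ T₁) (hR : 0 ≤ R)
    {V : Set (ℝ × E d)} (hV : IsOpen V) {p₀ : ℝ × E d} (hVb : closure V ⊆ box T₁ R p₀)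
    (hVt : ∀ q ∈ V, p₀.1 < q.1) (hu : ContinuousOn u (closure V))
    (hbd : ∀ q ∈ closure V, q ∉ V → p₀.1 < q.1 → u q ≤ 0)
    (hap : ∀ K ⊆ V, IsCompact K → Approx K u ut ux uxx) {f : ℝ × E d → ℝ}
    (hf : ∀ᵐ q ∂volume.restrict V, 0 < u q → 0 ≤ ut q + pucci δ (uxx q) + B * ‖ux q‖ + f q)
    {μ : ℝ} (hμ : 0 < μ) (hint : lint f V ≤ ENNReal.ofReal μ ^ (d + 1)) :
    ∀ q ∈ V, u q ≤ abpN d δ B T₁ R * (4 * μ) := by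
  intro q₀ hq₀
  refine le_of_forall_pos_le_add fun ε₀ hε₀ => ?_
  set ε := ε₀ / 3 with hε
  have hε0 : 0 < ε := by positivity
  set Q : Set (ℝ × E d) := {q | q ∈ closure V ∧ q₀.1 ≤ q.1 ∧ ε ≤ u q} with hQ
  have hVc : IsCompact (closure V) :=
    (isCompact_Icc.prod (isCompact_closedBall _ _)).of_isClosed_subset isClosed_closure hVb
  have hQV : Q ⊆ V := fun q hq => by
    by_contra h
    have := hbd q hq.1 h ((hVt _ hq₀).trans_le hq.2.1)
    linarith [hq.2.2]
  have hQc : IsCompact Q := by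
    refine hVc.of_isClosed_subset ?_ fun q hq => hq.1
    have h1 : IsClosed (closure V ∩ u ⁻¹' Ici ε) := hu.preimage_isClosed_of_isClosed
      isClosed_closure isClosed_Ici
    have h2 : IsClosed {q : ℝ × E d | q₀.1 ≤ q.1} := isClosed_le continuous_const continuous_fst
    convert h1.inter h2 using 1
    ext q
    simp only [hQ, mem_ofPred_eq, mem_inter_iff, mem_preimage, mem_Ici]
    tauto
  set c := 1 + puccC d δ + B with hc
  have hc0 : 0 < c := by have := puccC_nonneg (d := d) hδ; positivity
  set κ := min ε (μ ^ (d + 1) / c ^ (d + 1)) with hκ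
  have hκ0 : 0 < κ := by positivity
  obtain ⟨v, e, hv, he, h1, h2, h3⟩ := hap Q hQV hQc κ hκ0
  have hκε : κ ≤ ε := min_le_left _ _
  set w : ℝ × E d → ℝ := fun q => v q + -(2 * ε) with hw
  have hw2 : ContDiff ℝ 2 w := hv.add contDiff_const
  have hDt : Dt w = Dt v := funext fun q => by
    rw [hw, Dt_add hv contDiff_const, Dt_const, add_zero]
  have hDx : Dx w = Dx v := funext fun q => by
    rw [hw, Dx_add hv contDiff_const, Dx_const, add_zero]
  have hDxx : Dxx w = Dxx v := funext fun q => by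
    rw [hw, Dxx_add hv contDiff_const, Dxx_const, add_zero]
  have hwu : ∀ q ∈ Q, 0 < w q → ε < u q := fun q hq h => by
    have h4 := (abs_le.1 (h1 q hq)).2
    have h5 : 0 < v q + -(2 * ε) := h
    linarith
  have key := abp_smooth (f := fun q => -(Dt w q + pucci δ (Dxx w q) + B * ‖Dx w q‖)) hδ hδ1 hB hT
    hR hw2 hQc (fun q hq => hVb hq.1) (fun q hq hwq => ?_) (fun q hq hwq => by simp)
    (by positivity : 0 < 4 * μ) ?_
  · by_cases h : ε ≤ u q₀
    · have hq : q₀ ∈ Q := ⟨subset_closure hq₀, le_rfl, h⟩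
      have h4 := key q₀ hq
      have h5 := (abs_le.1 (h1 q₀ hq)).1
      have h6 : w q₀ = v q₀ + -(2 * ε) := rfl
      linarith
    · have : 0 ≤ abpN d δ B T₁ R * (4 * μ) := mul_nonneg (abpN_nonneg hδ hB hT hR) (by positivity)
      linarith
  · have hq1 := hwu q hq hwq
    have h4 : ∀ᶠ p in 𝓝 q, p ∈ V ∧ ε < u p :=
      (hV.eventually_mem (hQV hq)).and ((hu.continuousAt (mem_of_superset (hV.mem_nhds (hQV hq))
        subset_closure)).eventually (lt_mem_nhds hq1))
    filter_upwards [h4.filter_mono nhdsWithin_le_nhds, self_mem_nhdsWithin] with p hp hp'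
    have hp'' : q.1 ≤ p.1 := hp'
    exact ⟨subset_closure hp.1, hq.2.1.trans hp'', hp.2.le⟩
  · rw [hDt, hDx, hDxx]
    set W := Q ∩ {q | 0 < w q} with hWdef
    have hWm : MeasurableSet W :=
      hQc.measurableSet.inter (measurableSet_lt measurable_const hw2.continuous.measurable)
    have hWQ : W ⊆ Q := inter_subset_left
    have h5 : lint (fun q => -(Dt v q + pucci δ (Dxx v q) + B * ‖Dx v q‖)) W ≤
        lint (fun q => f q + c * e q) W := by
      refine lintegral_mono_ae ?_
      filter_upwards [ae_restrict_of_ae_restrict_of_subset (hWQ.trans hQV) hf,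
        ae_restrict_of_ae_restrict_of_subset hWQ h3, ae_restrict_mem hWm] with q hfq heq hqW
      gcongr
      have h6 := hfq (hε0.trans (hwu q hqW.1 hqW.2))
      have h7 := le_add_error hδ hδ1 hB heq.1 heq.2.1 heq.2.2
      linarith
    refine h5.trans ((lint_add_le (he.const_mul c) W).trans ?_)
    have h6 : lint f W ≤ ENNReal.ofReal (μ ^ (d + 1)) := by
      rw [ENNReal.ofReal_pow hμ.le]
      exact (lint_mono_set (hWQ.trans hQV)).trans hint
    have h7 : lint (fun q => c * e q) W ≤ ENNReal.ofReal (μ ^ (d + 1)) := by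
      refine (lint_const_mul_le hc0.le ((lint_mono_set hWQ).trans h2)).trans
        (ENNReal.ofReal_le_ofReal ?_)
      calc c ^ (d + 1) * κ ≤ c ^ (d + 1) * (μ ^ (d + 1) / c ^ (d + 1)) := by
            gcongr
            exact min_le_right _ _
        _ = μ ^ (d + 1) := by field_simp
    calc 2 ^ (d + 1) * (lint f W + lint (fun q => c * e q) W)
        ≤ 2 ^ (d + 1) * (ENNReal.ofReal (μ ^ (d + 1)) + ENNReal.ofReal (μ ^ (d + 1))) := by gcongr
      _ = ENNReal.ofReal (2 ^ (d + 1) * (μ ^ (d + 1) + μ ^ (d + 1))) := by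
          rw [← ENNReal.ofReal_add (by positivity) (by positivity),
            ENNReal.ofReal_mul (by positivity), ENNReal.ofReal_pow (by norm_num : (0 : ℝ) ≤ 2),
            ENNReal.ofReal_ofNat]
      _ ≤ ENNReal.ofReal (4 * μ) ^ (d + 1) := by
          rw [← ENNReal.ofReal_pow (by positivity)]
          refine ENNReal.ofReal_le_ofReal ?_
          have h8 : (2 : ℝ) ≤ 2 ^ (d + 1) := by
            simpa using pow_le_pow_right₀ (by norm_num : (1 : ℝ) ≤ 2) (Nat.succ_le_succ d.zero_le)
          calc 2 ^ (d + 1) * (μ ^ (d + 1) + μ ^ (d + 1)) = 2 ^ (d + 1) * (2 * μ ^ (d + 1)) := by ring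
            _ ≤ 2 ^ (d + 1) * (2 ^ (d + 1) * μ ^ (d + 1)) := by gcongr
            _ = (4 * μ) ^ (d + 1) := by
              rw [← mul_pow, ← mul_pow]
              ring_nf

end WeakABP

section Equation

variable {d : ℕ} {T : ℝ} {Ω : Set (E d)} {δ B : ℝ} {F : Ham d} {u ut : ℝ × E d → ℝ}
  {ux : ℝ × E d → E d} {uxx : ℝ × E d → Matrix (Fin d) (Fin d) ℝ}

lemma lint_le_eLpNorm_pow {f : ℝ × E d → ℝ} (S : Set (ℝ × E d)) :
    lint f S ≤ eLpNorm f (d + 1 : ℕ) (volume.restrict S) ^ (d + 1) := by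
  rw [eLpNorm_eq_lintegral_rpow_enorm_toReal (by exact_mod_cast Nat.succ_ne_zero d)
    (ENNReal.natCast_ne_top _), ENNReal.toReal_natCast, ← ENNReal.rpow_natCast (_ ^ _),
    ← ENNReal.rpow_mul, one_div, inv_mul_cancel₀ (by positivity), ENNReal.rpow_one]
  simp only [ENNReal.rpow_natCast]
  refine lintegral_mono fun q => ?_
  gcongr
  rw [Real.enorm_eq_ofReal_abs]
  exact ENNReal.ofReal_le_ofReal (le_abs_self _)

lemma lint_lt_top {f : ℝ × E d → ℝ} {S : Set (ℝ × E d)}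
    (hf : MemLp f (d + 1 : ℕ) (volume.restrict S)) : lint f S < ⊤ :=
  (lint_le_eLpNorm_pow S).trans_lt (ENNReal.pow_lt_top hf.2)

lemma ofReal_add_one : ENNReal.ofReal ((d : ℝ) + 1) = ((d + 1 : ℕ) : ℝ≥0∞) := by
  rw [← ENNReal.ofReal_natCast]
  push_cast
  rfl

lemma memLp_of_le {f : ℝ × E d → ℝ} {p : ℝ} (hp : (d : ℝ) + 1 ≤ p) {S S' : Set (ℝ × E d)}
    (hf : MemLp f (ENNReal.ofReal p) (volume.restrict S)) (hS : S' ⊆ S) (hS' : volume S' < ⊤) :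
    MemLp f (d + 1 : ℕ) (volume.restrict S') := by
  have : IsFiniteMeasure (volume.restrict S') := ⟨by rwa [Measure.restrict_apply_univ]⟩
  refine (hf.mono_measure (Measure.restrict_mono hS le_rfl)).mono_exponent ?_
  rw [← ofReal_add_one]
  exact ENNReal.ofReal_le_ofReal hp

/-- The open cylinder `(0, T) × Ω`. -/
def PiInt (T : ℝ) (Ω : Set (E d)) : Set (ℝ × E d) := Ioo 0 T ×ˢ Ω

lemma isOpen_PiInt (hΩ : IsOpen Ω) : IsOpen (PiInt T Ω) := isOpen_Ioo.prod hΩ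

lemma interior_PiDom (hΩ : IsOpen Ω) : interior (PiDom T Ω) = PiInt T Ω := by
  rw [PiDom, interior_prod_eq, interior_Ico, hΩ.interior_eq, PiInt]

lemma PiInt_subset : PiInt T Ω ⊆ PiDom T Ω := prod_mono_left Ioo_subset_Ico_self

lemma closure_PiDom (hT : 0 < T) : closure (PiDom T Ω) = Icc 0 T ×ˢ closure Ω := by
  rw [PiDom, closure_prod_eq, closure_Ico hT.ne]

lemma closure_PiInt (hT : 0 < T) : closure (PiInt T Ω) = closure (PiDom T Ω) := by
  rw [closure_PiDom hT, PiInt, closure_prod_eq, closure_Ioo hT.ne]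

lemma mem_parBdry (hT : 0 < T) {q : ℝ × E d} (hq : q ∈ closure (PiDom T Ω))
    (hq' : q ∉ PiInt T Ω) (h0 : 0 < q.1) : q ∈ parBdry T Ω := by
  rw [closure_PiDom hT] at hq
  by_cases h : q.1 = T
  · exact Or.inl ⟨h, hq.2⟩
  · refine Or.inr ⟨hq.1, hq.2, fun h2 => hq' ⟨⟨h0, lt_of_le_of_ne hq.1.2 h⟩, ?_⟩⟩
    exact interior_subset h2

lemma parBdry_subset (hT : 0 < T) : parBdry T Ω ⊆ closure (PiDom T Ω) := by
  rw [closure_PiDom hT]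
  rintro q (hq | hq)
  · have h1 : q.1 = T := hq.1
    exact ⟨⟨h1 ▸ hT.le, h1.le⟩, hq.2⟩
  · exact ⟨hq.1, frontier_subset_closure hq.2⟩

lemma isCompact_parBdry (hΩ : Bornology.IsBounded Ω) : IsCompact (parBdry T Ω) :=
  (isCompact_singleton.prod hΩ.isCompact_closure).union
    (isCompact_Icc.prod (hΩ.isCompact_closure.of_isClosed_subset isClosed_frontier
      frontier_subset_closure))

lemma isCompact_closure_PiDom (hT : 0 < T) (hΩ : Bornology.IsBounded Ω) :
    IsCompact (closure (PiDom T Ω)) := by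
  rw [closure_PiDom hT]
  exact isCompact_Icc.prod hΩ.isCompact_closure

lemma volume_PiInt_lt_top (hΩ : Bornology.IsBounded Ω) : volume (PiInt T Ω) < ⊤ :=
  ((isBounded_Ioo 0 T).prod hΩ).measure_lt_top

lemma exists_box (hT : 0 < T) (hΩ : Bornology.IsBounded Ω) :
    ∃ R : ℝ, 0 ≤ R ∧ closure (PiDom T Ω) ⊆ box T R (0, 0) := by
  obtain ⟨R, hR⟩ := hΩ.closure.subset_closedBall 0
  refine ⟨max R 0, le_max_right _ _, ?_⟩
  rw [closure_PiDom hT, box]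
  refine prod_mono (by simp) (hR.trans (closedBall_subset_closedBall (le_max_left _ _)))

/-- Approximation of functions with locally `L_{d+1}` weak derivatives. -/
lemma approx_of_interior {Q : Set (ℝ × E d)} (hw : WeakDerivs Q u ut ux uxx)
    (hu : ContinuousOn u (interior Q))
    (hLp : ∀ K ⊆ interior Q, IsCompact K → MemLp ut (d + 1 : ℕ) (volume.restrict K) ∧
      (∀ i, MemLp (fun q => ux q i) (d + 1 : ℕ) (volume.restrict K)) ∧
      ∀ i j, MemLp (fun q => uxx q i j) (d + 1 : ℕ) (volume.restrict K))
    {K : Set (ℝ × E d)} (hK : K ⊆ interior Q) (hKc : IsCompact K) : Approx K u ut ux uxx := by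
  obtain ⟨ρ, hρ, hρK⟩ := hKc.exists_cthickening_subset_open isOpen_interior hK
  obtain ⟨h1, h2, h3⟩ := hLp _ hρK hKc.cthickening
  exact approx_of_weakDerivs hw hKc hρ hρK (hu.mono hρK) h1 h2 h3

lemma exists_subset_PiRho (hΩ : IsOpen Ω) (hne : (Ωᶜ).Nonempty) {K : Set (ℝ × E d)}
    (hK : K ⊆ PiDom T Ω) (hKc : IsCompact K) : ∃ ρ > (0 : ℝ), K ⊆ PiRho T ρ Ω := by
  rcases K.eq_empty_or_nonempty with rfl | hKn
  · exact ⟨1, one_pos, empty_subset _⟩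
  set m : ℝ × E d → ℝ := fun q => min (T - q.1) (Metric.infDist q.2 Ωᶜ) with hm
  have hmc : Continuous m := by fun_prop
  obtain ⟨q₀, hq₀, hmin⟩ := hKc.exists_isMinOn hKn hmc.continuousOn
  have hpos : 0 < m q₀ := by
    refine lt_min (sub_pos.2 (hK hq₀).1.2) ?_
    refine (hΩ.isClosed_compl.notMem_iff_infDist_pos hne).1 ?_
    simpa using (hK hq₀).2
  set ρ := min (m q₀ / 2) 1 with hρ
  have hρ0 : 0 < ρ := by positivity
  have hρ1 : ρ ≤ 1 := min_le_right _ _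
  have hρm : ρ < m q₀ := (min_le_left _ _).trans_lt (half_lt_self hpos)
  refine ⟨ρ, hρ0, fun q hq => ?_⟩
  have h1 : m q₀ ≤ m q := hmin hq
  have h2 : m q ≤ T - q.1 := min_le_left _ _
  have h3 : m q ≤ Metric.infDist q.2 Ωᶜ := min_le_right _ _
  refine ⟨⟨(hK hq).1.1, ?_⟩, ?_⟩
  · have : ρ ^ 2 ≤ ρ := by nlinarith
    linarith
  · have : ρ < Metric.infDist q.2 Ωᶜ := by linarith
    exact this

/-- Monotone, uniformly elliptic, and Lipschitz in the gradient. -/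
def Struct (δ B : ℝ) (F : Ham d) : Prop :=
  ∀ (r₁ r₂ : ℝ) (b₁ b₂ : E d) (A₁ A₂ : Matrix (Fin d) (Fin d) ℝ) (p : ℝ × E d), r₂ ≤ r₁ →
    F (vcons r₁ b₁) A₁ p - F (vcons r₂ b₂) A₂ p ≤ pucci δ (A₁ - A₂) + B * ‖b₁ - b₂‖

lemma neg_vcons (r : ℝ) (b : E d) : -vcons r b = vcons (-r) (-b) := by
  ext i
  refine Fin.cases ?_ (fun j => ?_) i <;> simp [vcons]

lemma norm_vcons_zero (r : ℝ) : ‖vcons r (0 : E d)‖ = |r| := by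
  rw [EuclideanSpace.norm_eq, Fin.sum_univ_succ]
  simp [vcons, Real.sqrt_sq_eq_abs]

/-- The equation satisfied by `-u`. -/
def negHam (F : Ham d) : Ham d := fun u' A p => -F (-u') (-A) p

lemma Struct.neg (h : Struct δ B F) : Struct δ B (negHam F) := by
  intro r₁ r₂ b₁ b₂ A₁ A₂ p hr
  have := h (-r₂) (-r₁) (-b₂) (-b₁) (-A₂) (-A₁) p (neg_le_neg hr)
  rw [neg_sub_neg, neg_sub_neg] at this
  simp only [negHam, neg_vcons]
  linarith

/-- The operator `max(H, P - K)`. -/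
def maxHam (H : Ham d) (P : Matrix (Fin d) (Fin d) ℝ → ℝ) (K : ℝ) : Ham d :=
  fun u' A p => max (H u' A p) (P A - K)

lemma exists_struct {δ δb K₀ : ℝ} (hδ0 : 0 < δ) (hδ1 : δ ≤ 1) (hδb0 : 0 < δb) (hδbδ : δb < δ)
    {H : Ham d} {Hb : ℝ × E d → ℝ} (hB : AssumptionB δ K₀ H Hb)
    {P : Matrix (Fin d) (Fin d) ℝ → ℝ} (hP : Pprops d δb P) :
    ∃ B, 0 ≤ B ∧ Struct δb B H ∧ ∀ K, Struct δb B (maxHam H P K) := by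
  obtain ⟨hmono, -, -, ⟨L, hL0, hL⟩, ⟨L', hL0', hL'⟩, hder, -⟩ := hB
  have hH : Struct δb L H := by
    intro r₁ r₂ b₁ b₂ A₁ A₂ p hr
    have h1 := (abs_le.1 (hL r₁ b₁ b₂ A₁ p)).2
    have h2 := hmono r₂ r₁ b₂ A₁ p hr
    have h3 : H (vcons r₂ b₂) A₁ p - H (vcons r₂ b₂) A₂ p ≤ pucci δ (A₁ - A₂) := by
      refine sub_le_pucci (C := ⟨L' * d, by positivity⟩) hδ0
        (f := fun A => H (vcons r₂ b₂) A p) ?_ (hder (vcons r₂ b₂) p) A₁ A₂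
      refine LipschitzWith.of_dist_le_mul fun X Y => ?_
      rw [Real.dist_eq, dist_eq_norm]
      calc _ ≤ L' * frob (X - Y) := hL' _ _ _ _
        _ ≤ L' * (d * ‖X - Y‖) := by gcongr; exact frob_le
        _ = _ := by rw [← mul_assoc]; rfl
    have h4 := pucci_mono hδb0 hδbδ.le hδ1 (A₁ - A₂)
    linarith
  refine ⟨L, hL0, hH, fun K r₁ r₂ b₁ b₂ A₁ A₂ p hr => ?_⟩
  have h1 := hH r₁ r₂ b₁ b₂ A₁ A₂ p hr
  have h2 := hP.sub_le_pucci hδb0 A₁ A₂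
  have h3 : 0 ≤ L * ‖b₁ - b₂‖ := by positivity
  simp only [maxHam]
  have h4 := le_max_left (H (vcons r₂ b₂) A₂ p) (P A₂ - K)
  have h5 := le_max_right (H (vcons r₂ b₂) A₂ p) (P A₂ - K)
  rw [sub_le_iff_le_add]
  exact max_le (by linarith) (by linarith)

lemma Pprops.zero {δ : ℝ} {P : Matrix (Fin d) (Fin d) ℝ → ℝ} (hP : Pprops d δ P) : P 0 = 0 := by
  simpa using hP.2.1 0 le_rfl 0

lemma abs_maxHam_le {δ δb K₀ : ℝ} {H : Ham d} {Hb : ℝ × E d → ℝ} (hB : AssumptionB δ K₀ H Hb)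
    {P : Matrix (Fin d) (Fin d) ℝ → ℝ} (hP : Pprops d δb P) {K : ℝ} (hK : 0 < K) (r : ℝ)
    (p : ℝ × E d) : |maxHam H P K (vcons r 0) 0 p| ≤ K₀ * |r| + Hb p := by
  have h := abs_le.1 (hB.2.2.2.2.2.2 (vcons r 0) p)
  rw [norm_vcons_zero] at h
  rw [maxHam, hP.zero, abs_le]
  exact ⟨h.1.trans (le_max_left _ _), max_le h.2 (by linarith [h.1, h.2])⟩

/-- Continuous strong solutions of `∂_t u + F[u] = 0` in `(0, T) × Ω`. -/
structure StrongSol (T : ℝ) (Ω : Set (E d)) (F : Ham d) (u ut : ℝ × E d → ℝ) (ux : ℝ × E d → E d)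
    (uxx : ℝ × E d → Matrix (Fin d) (Fin d) ℝ) : Prop where
  cont : ContinuousOn u (closure (PiDom T Ω))
  ap : ∀ K ⊆ PiInt T Ω, IsCompact K → Approx K u ut ux uxx
  eq : ∀ᵐ p ∂volume.restrict (PiInt T Ω), ut p + F (vcons (u p) (ux p)) (uxx p) p = 0

lemma strongSol_of_solPlus {H : Ham d} {P : Matrix (Fin d) (Fin d) ℝ → ℝ} {K p : ℝ}
    {g : ℝ × E d → ℝ} (hp : (d : ℝ) + 1 ≤ p) (hΩ : IsOpen Ω) (hne : (Ωᶜ).Nonempty)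
    (hs : SolPlus H P K T Ω g u ut ux uxx)
    (hLp : ∀ ρ : ℝ, 0 < ρ → LpAll p (PiRho T ρ Ω) u ut ux uxx) :
    StrongSol T Ω (maxHam H P K) u ut ux uxx := by
  refine ⟨hs.1, fun K hK hKc => ?_, ae_restrict_of_ae_restrict_of_subset PiInt_subset hs.2.2.1⟩
  rw [← interior_PiDom hΩ] at hK
  refine approx_of_interior hs.2.1 (hs.1.mono (interior_subset.trans subset_closure))
    (fun K' hK' hKc' => ?_) hK hKc
  obtain ⟨ρ, hρ, hKρ⟩ := exists_subset_PiRho hΩ hne (hK'.trans interior_subset) hKc'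
  obtain ⟨-, h1, h2, h3⟩ := hLp ρ hρ
  have hv := hKc'.measure_lt_top (μ := volume)
  exact ⟨memLp_of_le hp h1 hKρ hv, fun i => memLp_of_le hp (h2 i) hKρ hv,
    fun i j => memLp_of_le hp (h3 i j) hKρ hv⟩

lemma StrongSol.neg (h : StrongSol T Ω F u ut ux uxx) :
    StrongSol T Ω (negHam F) (fun q => -u q) (fun q => -ut q) (fun q => -ux q)
      (fun q => -uxx q) := by
  refine ⟨h.cont.neg, fun K hK hKc => (h.ap K hK hKc).neg, ?_⟩
  filter_upwards [h.eq] with q hq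
  simp only [negHam, neg_vcons, neg_neg]
  linarith

lemma StrongSol.sub_ineq (h : StrongSol T Ω F u ut ux uxx) (hF : Struct δ B F) :
    ∀ᵐ q ∂volume.restrict (PiInt T Ω), ∀ c ≤ u q,
      0 ≤ ut q + pucci δ (uxx q) + B * ‖ux q‖ + F (vcons c 0) 0 q := by
  filter_upwards [h.eq] with q hq c hc
  have := hF (u q) c (ux q) 0 (uxx q) 0 q hc
  rw [sub_zero, sub_zero] at this
  linarith

lemma approx_sub_const {S : Set (ℝ × E d)} (h : Approx S u ut ux uxx) (c : ℝ) :
    Approx S (fun q => u q - c) ut ux uxx := by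
  have h1 := h.add (approx_smooth (S := S) (contDiff_const (c := -c)))
  simpa only [Dt_const, Dx_const, Dxx_const, add_zero, ← sub_eq_add_neg] using h1

lemma StrongSol.le_of_le {δ B : ℝ} (hδ : 0 < δ) (hδ1 : δ ≤ 1) (hB : 0 ≤ B) (hF : Struct δ B F)
    (hT : 0 < T) (hΩ : IsOpen Ω) {R : ℝ} (hR : 0 ≤ R) (hbox : closure (PiDom T Ω) ⊆ box T R (0, 0))
    (h : StrongSol T Ω F u ut ux uxx) {Hb : ℝ × E d → ℝ} (hF0 : ∀ p, F (vcons 0 0) 0 p ≤ Hb p)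
    {G : ℝ} (hG0 : 0 ≤ G) (hG : ∀ q ∈ parBdry T Ω, u q ≤ G) {μ : ℝ} (hμ : 0 < μ)
    (hint : lint Hb (PiInt T Ω) ≤ ENNReal.ofReal μ ^ (d + 1)) :
    ∀ q ∈ closure (PiDom T Ω), u q ≤ G + abpN d δ B T R * (4 * μ) := by
  rw [← closure_PiInt hT] at hbox ⊢
  have hc := closure_PiInt (Ω := Ω) hT ▸ h.cont
  refine le_on_closure (fun q hq => ?_) hc continuousOn_const
  have := abp_weak hδ hδ1 hB hT.le hR (isOpen_PiInt hΩ) hbox (fun q hq => hq.1.1)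
    (u := fun q => u q - G) (hc.sub continuousOn_const) (fun q hq hq' h0 => sub_nonpos.2
      (hG q (mem_parBdry hT (closure_PiInt (Ω := Ω) hT ▸ hq) hq' h0)))
    (fun K hK hKc => approx_sub_const (h.ap K hK hKc) G) (f := Hb) ?_ hμ hint q hq
  · linarith
  · filter_upwards [h.sub_ineq hF] with q hq hpos
    linarith [hq 0 (by linarith), hF0 q]

lemma StrongSol.compare {δ B : ℝ} (hδ : 0 < δ) (hδ1 : δ ≤ 1) (hB : 0 ≤ B) {F' : Ham d}
    (hF : Struct δ B F) (hT : 0 < T) (hΩ : IsOpen Ω) (hΩb : Bornology.IsBounded Ω)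
    {v vt : ℝ × E d → ℝ} {vx : ℝ × E d → E d} {vxx : ℝ × E d → Matrix (Fin d) (Fin d) ℝ}
    (h : StrongSol T Ω F u ut ux uxx) (h' : StrongSol T Ω F' v vt vx vxx)
    (hFF : ∀ u' A p, F u' A p ≤ F' u' A p) (hbd : ∀ q ∈ parBdry T Ω, u q ≤ v q) :
    ∀ q ∈ closure (PiDom T Ω), u q ≤ v q := by
  obtain ⟨R, hR, hbox⟩ := exists_box hT hΩb
  rw [← closure_PiInt hT] at hbox ⊢
  have hc := closure_PiInt (Ω := Ω) hT ▸ h.cont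
  have hc' := closure_PiInt (Ω := Ω) hT ▸ h'.cont
  refine le_on_closure (fun q hq => ?_) hc hc'
  have hN := abpN_nonneg (d := d) hδ hB hT.le hR
  refine le_of_forall_pos_le_add fun ε hε => ?_
  set μ := ε / (4 * (abpN d δ B T R + 1)) with hμ
  have hμ0 : 0 < μ := by positivity
  have := abp_weak hδ hδ1 hB hT.le hR (isOpen_PiInt hΩ) hbox (fun q hq => hq.1.1)
    (u := fun q => u q + -v q) (hc.add hc'.neg) (fun q hq hq' h0 => by
      linarith [hbd q (mem_parBdry hT (closure_PiInt (Ω := Ω) hT ▸ hq) hq' h0)])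
    (fun K hK hKc => (h.ap K hK hKc).add (h'.ap K hK hKc).neg) (f := fun _ => 0) ?_ hμ0
    (by simp [lint]) q hq
  · have h1 : abpN d δ B T R * (4 * μ) ≤ ε := by
      rw [hμ]
      calc _ = ε * (abpN d δ B T R / (abpN d δ B T R + 1)) := by field_simp
        _ ≤ ε * 1 := by
            gcongr
            exact (div_le_one (by positivity)).2 (by linarith)
        _ = ε := mul_one ε
    linarith
  · filter_upwards [h.eq, h'.eq] with q hq hq' hpos
    have h1 := hF (u q) (v q) (ux q) (vx q) (uxx q) (vxx q) q (by linarith)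
    have h2 := hFF (vcons (v q) (vx q)) (vxx q) q
    rw [← sub_eq_add_neg, ← sub_eq_add_neg, ← sub_eq_add_neg]
    linarith

end Equation

section Boundary

variable {d : ℕ} {T : ℝ} {Ω : Set (E d)} {δ B : ℝ}

lemma exists_ball_lint_le {f : ℝ × E d → ℝ} {S : Set (ℝ × E d)} (hf : lint f S < ⊤)
    (q₀ : ℝ × E d) {ε : ℝ≥0∞} (hε : ε ≠ 0) :
    ∃ σ > (0 : ℝ), lint f (S ∩ ball q₀ σ) ≤ ε := by
  obtain ⟨γ, hγ, h⟩ := exists_pos_setLIntegral_lt_of_measure_lt hf.ne hε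
  obtain ⟨U, hU, hUo, hUγ⟩ := Set.exists_isOpen_lt_of_lt (μ := volume) {q₀} γ (by simpa using hγ)
  obtain ⟨σ, hσ, hσU⟩ := Metric.isOpen_iff.1 hUo q₀ (hU rfl)
  refine ⟨σ, hσ, ?_⟩
  have h1 := h (ball q₀ σ) ((Measure.restrict_apply_le _ _).trans_lt
    ((measure_mono hσU).trans_lt hUγ))
  rw [Measure.restrict_restrict measurableSet_ball, inter_comm] at h1
  exact h1.le

/-- Upper barrier estimate at a point of the parabolic boundary, uniform with respect to the
equation. -/
lemma exists_nhds_le_of_barrier (hδ : 0 < δ) (hδ1 : δ ≤ 1) (hB : 0 ≤ B) (hT : 0 < T)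
    (hΩ : IsOpen Ω) (hΩb : Bornology.IsBounded Ω) {w : ℝ × E d → ℝ} (hw : ContDiff ℝ 2 w)
    {q₀ : ℝ × E d} (hq₀ : q₀ ∈ parBdry T Ω) {ρ : ℝ} (hρ : 0 < ρ)
    (hL : ∀ q ∈ PiInt T Ω ∩ ball q₀ ρ, Dt w q + pucci δ (Dxx w q) + B * ‖Dx w q‖ ≤ 0)
    (h0 : w q₀ = 0) (hpos : ∀ q ∈ closure (PiDom T Ω) ∩ closedBall q₀ ρ, q ≠ q₀ → 0 < w q)
    {g : ℝ × E d → ℝ} (hg : ContinuousOn g (parBdry T Ω)) (M : ℝ) {f : ℝ × E d → ℝ}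
    (hf : MemLp f (d + 1 : ℕ) (volume.restrict (PiInt T Ω))) {η : ℝ} (hη : 0 < η) :
    ∃ W ∈ 𝓝 q₀, ∀ (F : Ham d) (u ut : ℝ × E d → ℝ) (ux : ℝ × E d → E d)
      (uxx : ℝ × E d → Matrix (Fin d) (Fin d) ℝ), Struct δ B F → StrongSol T Ω F u ut ux uxx →
      (∀ q ∈ closure (PiDom T Ω), |u q| ≤ M) → (∀ q, F (vcons (-M) 0) 0 q ≤ f q) →
      EqOn u g (parBdry T Ω) → ∀ q ∈ W ∩ closure (PiDom T Ω), u q ≤ g q₀ + 3 * η := by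
  obtain ⟨R, hR, hbox⟩ := exists_box hT hΩb
  have hN := abpN_nonneg (d := d) hδ hB hT.le hR
  set N := abpN d δ B T R with hNdef
  set μ := η / (4 * (N + 1)) with hμ
  have hμ0 : 0 < μ := by positivity
  have hNμ : N * (4 * μ) ≤ η := by
    rw [hμ]
    calc _ = η * (N / (N + 1)) := by field_simp
      _ ≤ η * 1 := by
          gcongr
          exact (div_le_one (by positivity)).2 (by linarith)
      _ = η := mul_one η
  obtain ⟨σ₁, hσ₁, hint⟩ := exists_ball_lint_le (lint_lt_top hf) q₀
    (ε := ENNReal.ofReal μ ^ (d + 1)) (by simp [hμ0])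
  obtain ⟨σ₂, hσ₂, hgσ⟩ := Metric.continuousWithinAt_iff.1 (hg q₀ hq₀) η hη
  set σ := min (min σ₁ (σ₂ / 2)) ρ with hσ
  have hσ0 : 0 < σ := by positivity
  have hσρ : σ ≤ ρ := min_le_right _ _
  have hσ1 : σ ≤ σ₁ := (min_le_left _ _).trans (min_le_left _ _)
  have hσ2 : σ < σ₂ := by
    have : σ ≤ σ₂ / 2 := (min_le_left _ _).trans (min_le_right _ _)
    linarith
  have hw0 : ∀ q ∈ closure (PiDom T Ω) ∩ closedBall q₀ σ, 0 ≤ w q := fun q hq => by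
    rcases eq_or_ne q q₀ with rfl | hne
    · exact h0.ge
    · exact (hpos q ⟨hq.1, closedBall_subset_closedBall hσρ hq.2⟩ hne).le
  obtain ⟨A, hA, hAw⟩ : ∃ A : ℝ, 0 ≤ A ∧ ∀ q ∈ closure (PiDom T Ω) ∩ sphere q₀ σ,
      2 * M ≤ A * w q := by
    have hSc : IsCompact (closure (PiDom T Ω) ∩ sphere q₀ σ) :=
      (isCompact_closure_PiDom hT hΩb).inter_right isClosed_sphere
    rcases (closure (PiDom T Ω) ∩ sphere q₀ σ).eq_empty_or_nonempty with he | hne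
    · exact ⟨0, le_rfl, by simp [he]⟩
    obtain ⟨q₁, hq₁, hmin⟩ := hSc.exists_isMinOn hne hw.continuous.continuousOn
    have hm : 0 < w q₁ := by
      refine hpos q₁ ⟨hq₁.1, closedBall_subset_closedBall hσρ (sphere_subset_closedBall hq₁.2)⟩ ?_
      rintro rfl
      have := mem_sphere.1 hq₁.2
      rw [dist_self] at this
      exact hσ0.ne this
    refine ⟨2 * |M| / w q₁, by positivity, fun q hq => ?_⟩
    have h1 : w q₁ ≤ w q := hmin hq
    calc 2 * M ≤ 2 * |M| := by linarith [le_abs_self M]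
      _ = 2 * |M| / w q₁ * w q₁ := by field_simp
      _ ≤ _ := by gcongr
  set V := PiInt T Ω ∩ ball q₀ σ with hV
  have hVc : closure V ⊆ closure (PiDom T Ω) ∩ closedBall q₀ σ := by
    refine subset_inter (closure_mono (inter_subset_left.trans PiInt_subset)) ?_
    exact (closure_mono inter_subset_right).trans closure_ball_subset_closedBall
  refine ⟨ball q₀ σ ∩ {q | A * w q < η}, inter_mem (ball_mem_nhds _ hσ0) ?_, ?_⟩
  · refine (isOpen_lt (continuous_const.mul hw.continuous) continuous_const).mem_nhds ?_
    simpa [h0] using hη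
  intro F u ut ux uxx hF h hM hFf hug
  have hq₀c := parBdry_subset hT hq₀
  have hM0 := (abs_le.1 (hM q₀ hq₀c)).1
  rw [hug hq₀] at hM0
  have hlin : ContDiff ℝ 2 fun q => (-A) * w q + (-(g q₀ + η)) :=
    (contDiff_const.mul hw).add contDiff_const
  have hcont : ContinuousOn u (closure V) := h.cont.mono (hVc.trans inter_subset_left)
  have key := abp_weak hδ hδ1 hB hT.le hR ((isOpen_PiInt hΩ).inter isOpen_ball)
    ((hVc.trans inter_subset_left).trans hbox) (fun q hq => hq.1.1.1)
    (u := fun q => u q + ((-A) * w q + (-(g q₀ + η))))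
    (hcont.add hlin.continuous.continuousOn) ?_
    (fun K hK hKc => (h.ap K (hK.trans inter_subset_left) hKc).add (approx_smooth hlin))
    (f := f) ?_ hμ0 ((lint_mono_set (inter_subset_inter_right _ (ball_subset_ball hσ1))).trans hint)
  · have key2 : ∀ q ∈ closure V, u q ≤ g q₀ + 2 * η + A * w q := by
      refine le_on_closure (fun q hq => ?_) hcont
        (continuousOn_const.add (continuous_const.mul hw.continuous).continuousOn)
      linarith [key q hq]
    rintro q ⟨⟨hqσ, hqA⟩, hqc⟩
    have hqV : q ∈ closure V := by
      rw [hV, inter_comm]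
      rw [← closure_PiInt hT] at hqc
      exact isOpen_ball.inter_closure ⟨hqσ, hqc⟩
    have hqA' : A * w q < η := hqA
    linarith [key2 q hqV]
  · intro q hq hqV hq0
    have hqc := hVc hq
    have hwq := hw0 q hqc
    by_cases hqP : q ∈ PiInt T Ω
    · have hqs : q ∈ sphere q₀ σ := by
        refine mem_sphere.2 (le_antisymm hqc.2 (not_lt.1 fun hlt => hqV ⟨hqP, hlt⟩))
      have h1 := hAw q ⟨hqc.1, hqs⟩
      have h2 := (abs_le.1 (hM q hqc.1)).2
      linarith
    · have hqb := mem_parBdry hT hqc.1 hqP hq0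
      have h1 := hgσ hqb ((mem_closedBall.1 hqc.2).trans_lt hσ2)
      rw [Real.dist_eq] at h1
      have h2 := (abs_lt.1 h1).2
      have h3 := mul_nonneg hA hwq
      rw [hug hqb]
      linarith
  · have h1 := ae_restrict_of_ae_restrict_of_subset (inter_subset_left : V ⊆ _) (h.sub_ineq hF)
    filter_upwards [h1, self_mem_ae_restrict ((isOpen_PiInt hΩ).inter isOpen_ball).measurableSet]
      with q hq hqV _
    have hqc := hVc (subset_closure hqV)
    have h2 := hq (-M) (abs_le.1 (hM q hqc.1)).1
    have h3 := hL q ⟨hqV.1, ball_subset_ball hσρ hqV.2⟩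
    have hAw2 : ContDiff ℝ 2 fun q => (-A) * w q := contDiff_const.mul hw
    rw [Dt_add hAw2 contDiff_const, Dx_add hAw2 contDiff_const, Dxx_add hAw2 contDiff_const,
      Dt_const_mul hw, Dx_const_mul hw, Dxx_const_mul hw, Dt_const, Dx_const, Dxx_const, add_zero,
      add_zero, add_zero, neg_smul, neg_smul]
    have h4 := pucci_add_le hδ hδ1 (uxx q + -(A • Dxx w q)) (A • Dxx w q)
    rw [pucci_smul hA, neg_add_cancel_right] at h4
    have h5 : ‖ux q‖ ≤ ‖ux q + -(A • Dx w q)‖ + A * ‖Dx w q‖ := by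
      have := norm_add_le (ux q + -(A • Dx w q)) (A • Dx w q)
      rwa [neg_add_cancel_right, norm_smul, Real.norm_of_nonneg hA] at this
    have h6 := mul_le_mul_of_nonneg_left h3 hA
    have h7 := mul_le_mul_of_nonneg_left h5 hB
    have h8 := hFf q
    linarith

/-- Barrier at the top of the cylinder. -/
lemma exists_top_barrier (hδ : 0 < δ) (hδ1 : δ ≤ 1) (hB : 0 ≤ B) (hT : 0 < T) (x₀ : E d) :
    ∃ w : ℝ × E d → ℝ, ContDiff ℝ 2 w ∧
      (∀ q ∈ PiInt T Ω ∩ ball (T, x₀) 1, Dt w q + pucci δ (Dxx w q) + B * ‖Dx w q‖ ≤ 0) ∧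
      w (T, x₀) = 0 ∧
      ∀ q ∈ closure (PiDom T Ω) ∩ closedBall (T, x₀) 1, q ≠ (T, x₀) → 0 < w q := by
  set C := 2 * puccC d δ + 2 * B + 1 with hC
  have hC0 : 0 < C := by have := puccC_nonneg (d := d) hδ; positivity
  have ht : ContDiff ℝ 2 fun t : ℝ => C * (T - t) := by fun_prop
  refine ⟨fun q => C * (T - q.1) + ‖q.2 - x₀‖ ^ 2, (contDiff_time ht).add (contDiff_normsq x₀),
    fun q hq => ?_, by simp, fun q hq hne => ?_⟩
  · rw [Dt_add (contDiff_time ht) (contDiff_normsq x₀), Dx_add (contDiff_time ht)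
      (contDiff_normsq x₀), Dxx_add (contDiff_time ht) (contDiff_normsq x₀), Dt_time ht,
      Dx_time ht, Dxx_time ht, Dt_normsq, Dx_normsq, Dxx_normsq, zero_add, zero_add, add_zero,
      pucci_smul zero_le_two, norm_smul, Real.norm_of_nonneg zero_le_two]
    have h1 : deriv (fun t : ℝ => C * (T - t)) q.1 = -C := by
      have : HasDerivAt (fun t : ℝ => C * (T - t)) (C * (0 - 1)) q.1 :=
        ((hasDerivAt_const _ T).sub (hasDerivAt_id _)).const_mul C
      rw [this.deriv]; ring
    have h2 : ‖q.2 - x₀‖ ≤ 1 := by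
      have := (Prod.dist_eq (x := q) (y := (T, x₀))) ▸ (mem_ball.1 hq.2)
      rw [← dist_eq_norm]
      exact (le_max_right _ _).trans this.le
    have h3 := pucci_one_le (d := d) hδ hδ1
    rw [h1]
    nlinarith [mul_le_mul_of_nonneg_left h2 hB]
  · rw [closure_PiDom hT] at hq
    have h1 : q.1 ≤ T := hq.1.1.2
    rcases h1.lt_or_eq with h2 | h2
    · have : 0 < C * (T - q.1) := mul_pos hC0 (sub_pos.2 h2)
      positivity
    · have h3 : q.2 ≠ x₀ := fun h3 => hne (Prod.ext h2 h3)
      have h4 : 0 < ‖q.2 - x₀‖ := norm_pos_iff.2 (sub_ne_zero.2 h3)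
      have : 0 ≤ C * (T - q.1) := mul_nonneg hC0.le (sub_nonneg.2 h1)
      positivity

end Boundary

section Lateral

variable {d : ℕ} {T : ℝ} {Ω : Set (E d)} {δ B : ℝ}

/-- The paraboloid touching a `C^{1,1}` domain from outside. -/
lemma exists_touching_paraboloid (hΩ : IsC11Domain Ω) {x₀ : E d} (hx₀ : x₀ ∈ frontier Ω) :
    ∃ (a : E d) (c r : ℝ), 1 ≤ ‖a‖ ∧ 0 ≤ c ∧ 0 < r ∧
      ∀ x ∈ closure Ω ∩ ball x₀ r, ‖x - x₀‖ ^ 2 ≤ ⟪x - x₀, a⟫_ℝ + c * ‖x - x₀‖ ^ 2 := by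
  obtain ⟨r, hr, ν, hν, f, hfd, ⟨C, hC⟩, hf⟩ := hΩ.2.2.2 x₀ hx₀
  set φ := fderiv ℝ f 0 with hφ
  set ℓ : E d →L[ℝ] ℝ := innerSL ℝ ν - φ.comp
    (ContinuousLinearMap.id ℝ (E d) - (innerSL ℝ ν).smulRight ν) with hℓ
  have hℓz : ∀ z, ℓ z = ⟪z, ν⟫_ℝ - φ (z - ⟪z, ν⟫_ℝ • ν) := fun z => by
    simp [hℓ, real_inner_comm z ν]
  set a := (InnerProductSpace.toDual ℝ (E d)).symm ℓ with ha
  have haz : ∀ z, ⟪z, a⟫_ℝ = ℓ z := fun z => by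
    rw [real_inner_comm, ha, InnerProductSpace.toDual_symm_apply]
  refine ⟨a, 4 * C + 1, r, ?_, by positivity, hr, ?_⟩
  · have h1 : ⟪ν, a⟫_ℝ = 1 := by
      rw [haz, hℓz, real_inner_self_eq_norm_sq, hν]
      simp
    have h2 := real_inner_le_norm ν a
    rw [h1, hν, one_mul] at h2
    exact h2
  · have hx₀Ω : x₀ ∉ Ω := fun h => hx₀.2 (by rwa [hΩ.1.interior_eq])
    have hf0 : 0 ≤ f 0 := by
      have := (hf x₀ (mem_ball_self hr)).not.1 hx₀Ω
      simpa using this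
    rintro x ⟨hx, hxr⟩
    have hxc : x ∈ closure (ball x₀ r ∩ Ω) := isOpen_ball.inter_closure ⟨hxr, hx⟩
    refine le_on_closure (f := fun x => ‖x - x₀‖ ^ 2)
      (g := fun x => ⟪x - x₀, a⟫_ℝ + (4 * C + 1) * ‖x - x₀‖ ^ 2) (fun y hy => ?_)
      (Continuous.continuousOn (by fun_prop)) (Continuous.continuousOn (by fun_prop)) hxc
    have h1 := (hf y hy.1).1 hy.2
    rw [haz, hℓz]
    set z := y - x₀
    set z' := z - ⟪z, ν⟫_ℝ • ν
    have hz' : ‖z'‖ ≤ 2 * ‖z‖ := by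
      have h2 := norm_sub_le z (⟪z, ν⟫_ℝ • ν)
      have h3 := abs_real_inner_le_norm z ν
      rw [norm_smul, hν, mul_one, Real.norm_eq_abs] at h2
      rw [hν, mul_one] at h3
      linarith
    have h2 : ‖f z' - f 0 - φ (z' - 0)‖ ≤ C * ‖z'‖ * ‖z' - 0‖ := by
      refine (convex_closedBall (0 : E d) ‖z'‖).norm_image_sub_le_of_norm_fderiv_le'
        (𝕜 := ℝ) (fun y _ => hfd y) (fun y hy => ?_) (by simp) (by simp)
      have h3 := hC.dist_le_mul y 0
      rw [dist_eq_norm] at h3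
      exact h3.trans (by gcongr; exact hy)
    rw [sub_zero, Real.norm_eq_abs] at h2
    have h3 := (abs_le.1 h2).1
    have h4 : (C : ℝ) * ‖z'‖ * ‖z'‖ ≤ C * (2 * ‖z‖) * (2 * ‖z‖) := by gcongr
    nlinarith

set_option maxHeartbeats 800000 in
/-- Barrier at the lateral boundary. -/
lemma exists_lateral_barrier (hδ : 0 < δ) (hδ1 : δ ≤ 1) (hB : 0 ≤ B) (hT : 0 < T)
    (hΩ : IsC11Domain Ω) (t₀ : ℝ) {x₀ : E d} (hx₀ : x₀ ∈ frontier Ω) :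
    ∃ ρ > (0 : ℝ), ∃ w : ℝ × E d → ℝ, ContDiff ℝ 2 w ∧
      (∀ q ∈ PiInt T Ω ∩ ball (t₀, x₀) ρ, Dt w q + pucci δ (Dxx w q) + B * ‖Dx w q‖ ≤ 0) ∧
      w (t₀, x₀) = 0 ∧
      ∀ q ∈ closure (PiDom T Ω) ∩ closedBall (t₀, x₀) ρ, q ≠ (t₀, x₀) → 0 < w q := by
  obtain ⟨a, c, r, ha, hc, hr, hs⟩ := exists_touching_paraboloid hΩ hx₀
  have hP0 := puccC_nonneg (d := d) hδ
  set A := 2 * (2 + 2 * c * puccC d δ + B * (‖a‖ + 1)) / δ with hA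
  have hA0 : 0 ≤ A := by positivity
  have hAδ : A * δ = 2 * (2 + 2 * c * puccC d δ + B * (‖a‖ + 1)) := by rw [hA]; field_simp
  set D := 4 * c + 2 * A * (‖a‖ + c) + 1 with hD
  have hD0 : 0 < D := by positivity
  set ρ := min (min 1 (r / 2)) D⁻¹ with hρ
  have hρ0 : 0 < ρ := by positivity
  have hρ1 : ρ ≤ 1 := (min_le_left _ _).trans (min_le_left _ _)
  have hρr : ρ < r := by
    have : ρ ≤ r / 2 := (min_le_left _ _).trans (min_le_right _ _)
    linarith
  have hρD : ρ * D ≤ 1 := by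
    have : ρ ≤ D⁻¹ := min_le_right _ _
    calc ρ * D ≤ D⁻¹ * D := by gcongr
      _ = 1 := inv_mul_cancel₀ hD0.ne'
  have hρc : 2 * c * ρ ≤ 1 / 2 := by
    have : 0 ≤ ρ * (2 * A * (‖a‖ + c)) := by positivity
    nlinarith
  have hρA : A * ((‖a‖ + c) * ρ) ≤ 1 / 2 := by
    have : 0 ≤ ρ * (4 * c) := by positivity
    nlinarith
  set s : ℝ × E d → ℝ := fun q => ⟪q.2 - x₀, a⟫_ℝ + c * ‖q.2 - x₀‖ ^ 2 with hsdef
  have hi := contDiff_inner_snd (n := 2) x₀ a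
  have hn := contDiff_normsq (n := 2) x₀
  have hcn : ContDiff ℝ 2 fun q : ℝ × E d => c * ‖q.2 - x₀‖ ^ 2 := contDiff_const.mul hn
  have hsC : ContDiff ℝ 2 s := hi.add hcn
  have hss : ContDiff ℝ 2 fun q => s q * s q := hsC.mul hsC
  have hAss : ContDiff ℝ 2 fun q => -A * (s q * s q) := contDiff_const.mul hss
  have hsA : ContDiff ℝ 2 fun q => s q + -A * (s q * s q) := hsC.add hAss
  have ht : ContDiff ℝ 2 fun t : ℝ => (t - t₀) ^ 2 := by fun_prop
  have hmem : ∀ q ∈ closure (PiDom T Ω) ∩ closedBall (t₀, x₀) ρ, ‖q.2 - x₀‖ ≤ ρ ∧ |q.1 - t₀| ≤ ρ ∧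
      ‖q.2 - x₀‖ ^ 2 ≤ s q ∧ A * s q ≤ 1 / 2 := fun q hq => by
    have h1 := mem_closedBall.1 hq.2
    rw [Prod.dist_eq] at h1
    have h2 : ‖q.2 - x₀‖ ≤ ρ := dist_eq_norm q.2 x₀ ▸ (le_max_right _ _).trans h1
    have hqc := hq.1
    rw [closure_PiDom hT] at hqc
    refine ⟨h2, (le_max_left _ _).trans h1,
      hs q.2 ⟨hqc.2, mem_ball.2 (((le_max_right _ _).trans h1).trans_lt hρr)⟩, ?_⟩
    refine le_trans ?_ hρA
    gcongr
    have h3 := real_inner_le_norm (q.2 - x₀) a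
    have h4 : ‖q.2 - x₀‖ * ‖a‖ ≤ ρ * ‖a‖ := by gcongr
    have h5 : c * ‖q.2 - x₀‖ ^ 2 ≤ c * (ρ * 1) := by
      rw [sq]; gcongr; exact h2.trans hρ1
    simp only [hsdef]
    linarith
  refine ⟨ρ, hρ0, fun q => s q + -A * (s q * s q) + (q.1 - t₀) ^ 2, hsA.add (contDiff_time ht),
    fun q hq => ?_, by simp [hsdef], fun q hq hne => ?_⟩
  · obtain ⟨h1, h2, h3, h4⟩ := hmem q ⟨(PiInt_subset.trans subset_closure) hq.1,
      ball_subset_closedBall hq.2⟩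
    have hs0 : 0 ≤ s q := (sq_nonneg _).trans h3
    have hDts : Dt s q = 0 := by
      rw [hsdef, Dt_add hi hcn, Dt_inner_snd, Dt_const_mul hn, Dt_normsq]; simp
    have hDxs : Dx s q = a + c • (2 : ℝ) • (q.2 - x₀) := by
      rw [hsdef, Dx_add hi hcn, Dx_inner_snd, Dx_const_mul hn, Dx_normsq]
    have hDxxs : Dxx s q = (2 * c) • (1 : Matrix (Fin d) (Fin d) ℝ) := by
      rw [hsdef, Dxx_add hi hcn, Dxx_inner_snd, Dxx_const_mul hn, Dxx_normsq, zero_add, smul_smul,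
        mul_comm]
    have hdt : deriv (fun t : ℝ => (t - t₀) ^ 2) q.1 = 2 * (q.1 - t₀) := by simp
    rw [Dt_add hsA (contDiff_time ht), Dx_add hsA (contDiff_time ht),
      Dxx_add hsA (contDiff_time ht), Dt_time ht, Dx_time ht, Dxx_time ht, Dt_add hsC hAss,
      Dx_add hsC hAss, Dxx_add hsC hAss, Dt_const_mul hss, Dx_const_mul hss, Dxx_const_mul hss,
      Dt_mul hsC hsC, Dx_mul hsC hsC, Dxx_mul hsC hsC, hDts, hdt]
    set k := 1 - 2 * A * s q with hk
    have hk0 : 0 ≤ k := by rw [hk]; linarith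
    have hk1 : k ≤ 1 := by rw [hk]; nlinarith [mul_nonneg hA0 hs0]
    have e1 : Dx s q + -A • (s q • Dx s q + s q • Dx s q) + 0 = k • Dx s q := by
      rw [hk]; module
    have e2 : Dxx s q + -A • (s q • Dxx s q + s q • Dxx s q +
        Matrix.of fun i j => Dx s q i * Dx s q j + Dx s q i * Dx s q j) + 0 =
        (k * (2 * c)) • (1 : Matrix (Fin d) (Fin d) ℝ) +
          (2 * A) • (-(Matrix.of fun i j => Dx s q i * Dx s q j)) := by
      rw [hDxxs]
      ext i j
      simp [hk]
      ring
    rw [e1, e2, norm_smul, Real.norm_of_nonneg hk0]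
    have g1 := pucci_add_le hδ hδ1 ((k * (2 * c)) • (1 : Matrix (Fin d) (Fin d) ℝ))
      ((2 * A) • (-(Matrix.of fun i j => Dx s q i * Dx s q j)))
    rw [pucci_smul (by positivity), pucci_smul (by positivity)] at g1
    have g2 := pucci_one_le (d := d) hδ hδ1
    have g3 := pucci_neg_outer_le hδ hδ1 (Dx s q)
    have hy : ‖c • (2 : ℝ) • (q.2 - x₀)‖ ≤ 1 / 2 := by
      rw [norm_smul, norm_smul, Real.norm_of_nonneg hc, Real.norm_of_nonneg zero_le_two]
      refine le_trans ?_ hρc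
      nlinarith [mul_le_mul_of_nonneg_left h1 hc]
    have hlow : 1 / 2 ≤ ‖Dx s q‖ := by
      have := norm_sub_le (Dx s q) (c • (2 : ℝ) • (q.2 - x₀))
      rw [hDxs, add_sub_cancel_right, ← hDxs] at this
      linarith
    have hup : ‖Dx s q‖ ≤ ‖a‖ + 1 := by
      rw [hDxs]
      linarith [norm_add_le a (c • (2 : ℝ) • (q.2 - x₀))]
    have g4 : k * (2 * c) * pucci δ (1 : Matrix (Fin d) (Fin d) ℝ) ≤ 1 * (2 * c) * puccC d δ := by
      calc _ ≤ k * (2 * c) * puccC d δ := by gcongr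
        _ ≤ _ := by gcongr
    have g5 : 2 * A * pucci δ (-(Matrix.of fun i j => Dx s q i * Dx s q j)) ≤
        2 * A * (-(δ * (1 / 2) ^ 2)) := by
      gcongr
      refine g3.trans (neg_le_neg ?_)
      gcongr
    have g6 : B * (k * ‖Dx s q‖) ≤ B * (1 * (‖a‖ + 1)) := by gcongr
    have g7 := (le_abs_self (q.1 - t₀)).trans (h2.trans hρ1)
    have g8 : 2 * A * (-(δ * (1 / 2) ^ 2)) = -(A * δ) / 2 := by ring
    rw [g8, hAδ] at g5
    rw [mul_zero, add_zero, mul_zero, zero_add, zero_add]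
    linarith
  · obtain ⟨h1, h2, h3, h4⟩ := hmem q hq
    have hs0 : 0 ≤ s q := (sq_nonneg _).trans h3
    have h5 : 1 / 2 * s q ≤ s q + -A * (s q * s q) := by nlinarith
    have h6 : 0 ≤ (q.1 - t₀) ^ 2 := sq_nonneg _
    by_cases hx : q.2 = x₀
    · have h7 : q.1 - t₀ ≠ 0 := fun h => hne (Prod.ext (sub_eq_zero.1 h) hx)
      have : 0 < (q.1 - t₀) ^ 2 := by positivity
      linarith
    · have : 0 < ‖q.2 - x₀‖ ^ 2 := by
        have := norm_pos_iff.2 (sub_ne_zero.2 hx)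
        positivity
      linarith

/-- Solutions are equicontinuous at the parabolic boundary. -/
lemma exists_nhds_abs_sub_le (hδ : 0 < δ) (hδ1 : δ ≤ 1) (hB : 0 ≤ B) (hT : 0 < T)
    (hΩ : IsC11Domain Ω) {q₀ : ℝ × E d} (hq₀ : q₀ ∈ parBdry T Ω)
    {g : ℝ × E d → ℝ} (hg : ContinuousOn g (parBdry T Ω)) (M : ℝ) {f : ℝ × E d → ℝ}
    (hf : MemLp f (d + 1 : ℕ) (volume.restrict (PiInt T Ω))) {η : ℝ} (hη : 0 < η) :
    ∃ W ∈ 𝓝 q₀, ∀ (F : Ham d) (u ut : ℝ × E d → ℝ) (ux : ℝ × E d → E d)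
      (uxx : ℝ × E d → Matrix (Fin d) (Fin d) ℝ), Struct δ B F → StrongSol T Ω F u ut ux uxx →
      (∀ q ∈ closure (PiDom T Ω), |u q| ≤ M) → (∀ r q, |r| ≤ M → |F (vcons r 0) 0 q| ≤ f q) →
      EqOn u g (parBdry T Ω) → ∀ q ∈ W ∩ closure (PiDom T Ω), |u q - g q₀| ≤ 3 * η := by
  obtain ⟨ρ, hρ, w, hw, hL, h0, hpos⟩ : ∃ ρ > (0 : ℝ), ∃ w : ℝ × E d → ℝ, ContDiff ℝ 2 w ∧
      (∀ q ∈ PiInt T Ω ∩ ball q₀ ρ, Dt w q + pucci δ (Dxx w q) + B * ‖Dx w q‖ ≤ 0) ∧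
      w q₀ = 0 ∧ ∀ q ∈ closure (PiDom T Ω) ∩ closedBall q₀ ρ, q ≠ q₀ → 0 < w q := by
    obtain ⟨t₀, x₀⟩ := q₀
    rcases hq₀ with hq | hq
    · obtain rfl : t₀ = T := hq.1
      exact ⟨1, one_pos, exists_top_barrier hδ hδ1 hB hT x₀⟩
    · exact exists_lateral_barrier hδ hδ1 hB hT hΩ t₀ hq.2
  obtain ⟨W, hW, h1⟩ := exists_nhds_le_of_barrier hδ hδ1 hB hT hΩ.1 hΩ.2.2.1 hw hq₀ hρ hL h0 hpos hg
    M hf hη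
  obtain ⟨W', hW', h2⟩ := exists_nhds_le_of_barrier hδ hδ1 hB hT hΩ.1 hΩ.2.2.1 hw hq₀ hρ hL h0 hpos
    hg.neg M hf hη
  refine ⟨W ∩ W', inter_mem hW hW', fun F u ut ux uxx hF h hM hFf hug q hq => ?_⟩
  have hM0 : |M| ≤ M := (abs_of_nonneg ((abs_nonneg _).trans (hM _ (parBdry_subset hT hq₀)))).le
  have g1 := h1 F u ut ux uxx hF h hM (fun q => (le_abs_self _).trans (hFf _ q (by rwa [abs_neg])))
    hug q ⟨hq.1.1, hq.2⟩
  have g2 := h2 _ _ _ _ _ hF.neg h.neg (fun q hq => by simpa using hM q hq) (fun q => ?_)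
    (fun q hq => by simp [hug hq]) q ⟨hq.1.2, hq.2⟩
  · dsimp only [Pi.neg_apply] at g2
    rw [abs_le]
    constructor <;> linarith
  · rw [negHam, neg_vcons, neg_neg, neg_zero, neg_zero]
    exact (neg_le_abs _).trans (hFf _ q hM0)

end Lateral

section Interior

variable {d : ℕ} {T : ℝ} {Ω : Set (E d)} {δ B : ℝ}

/-- Small oscillation at small scales for functions in the weak parabolic Pucci class. -/
lemma osc_small_approx (hδ : 0 < δ) (hδ1 : δ ≤ 1) (hB : 0 ≤ B) {η M : ℝ} (hη : 0 < η)
    (hM : 0 < M) : ∃ c₀ > (0 : ℝ), ∀ r : ℝ, 0 < r → r ≤ 1 → ∃ r' > (0 : ℝ), r' ≤ r ∧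
      ∀ (u ut f : ℝ × E d → ℝ) (ux : ℝ × E d → E d)
      (uxx : ℝ × E d → Matrix (Fin d) (Fin d) ℝ) (p₀ : ℝ × E d),
      Approx (box (3 * r ^ 2) (8 * r) p₀) u ut ux uxx →
      (∀ᵐ q ∂volume.restrict (box (3 * r ^ 2) (8 * r) p₀),
        0 ≤ ut q + pucci δ (uxx q) + B * ‖ux q‖ + f q ∧
        0 ≤ -ut q + pucci δ (-uxx q) + B * ‖-ux q‖ + f q) →
      (∀ q ∈ box (3 * r ^ 2) (8 * r) p₀, |u q| ≤ M) →
      lint f (box (3 * r ^ 2) (8 * r) p₀) ≤ ENNReal.ofReal c₀ →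
      ∀ q ∈ box (3 * r' ^ 2) (8 * r') p₀, |u q - u p₀| ≤ 3 * η := by
  obtain ⟨c₁, hc₁, hosc⟩ := osc_small (d := d) hδ hδ1 hB hη (M := M + 1) (by linarith)
  set C : ℝ := 1 + puccC d δ + B with hC
  have hC0 : 0 < C := by have := puccC_nonneg (d := d) hδ; positivity
  set c₀ : ℝ := c₁ / 2 ^ (d + 2) with hc₀
  have hc₀0 : 0 < c₀ := by positivity
  refine ⟨c₀, hc₀0, fun r hr hr1 => ?_⟩
  obtain ⟨r₁, hr₁, hosc⟩ := hosc r hr hr1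
  refine ⟨min r₁ r, lt_min hr₁ hr, min_le_right _ _, ?_⟩
  intro u ut f ux uxx p₀ hap hineq hbd hint q hq
  set S := box (3 * r ^ 2) (8 * r) p₀ with hS
  obtain ⟨v, e, hv, he, h1, h2, h3⟩ := hap (min (min η 1) (c₀ / C ^ (d + 1)))
    (lt_min (lt_min hη one_pos) (by positivity))
  set f₁ : ℝ × E d → ℝ := fun q => max (Dt v q - pucci δ (-Dxx v q) - B * ‖Dx v q‖)
    (-Dt v q - pucci δ (Dxx v q) - B * ‖Dx v q‖) with hf₁
  have hs1 : SuperS δ B f₁ v S := fun q _ => by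
    have := le_max_left (Dt v q - pucci δ (-Dxx v q) - B * ‖Dx v q‖)
      (-Dt v q - pucci δ (Dxx v q) - B * ‖Dx v q‖)
    simp only [hf₁]
    linarith
  have hs2 : SuperS δ B f₁ (fun q => -1 * v q) S := fun q _ => by
    have := le_max_right (Dt v q - pucci δ (-Dxx v q) - B * ‖Dx v q‖)
      (-Dt v q - pucci δ (Dxx v q) - B * ‖Dx v q‖)
    rw [Dt_const_mul hv, Dx_const_mul hv, Dxx_const_mul hv]
    simp only [hf₁, neg_smul, one_smul, neg_neg, norm_neg]
    linarith
  have hf₁f : lint f₁ S ≤ ENNReal.ofReal c₁ := by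
    have h5 : lint f₁ S ≤ lint (fun q => f q + C * e q) S := by
      refine lintegral_mono_ae ?_
      filter_upwards [h3, hineq] with q hq hq'
      gcongr
      have h7 := le_add_error hδ hδ1 hB hq.1 hq.2.1 hq.2.2
      have h8 := le_add_error (a := -ut q) (a' := -Dt v q) (b := -ux q) (b' := -Dx v q)
        (A := -uxx q) (A' := -Dxx v q) (e := e q) hδ hδ1 hB
        (by rw [neg_sub_neg, abs_sub_comm]; exact hq.1)
        (by rw [neg_sub_neg, norm_sub_rev]; exact hq.2.1)
        (by rw [neg_sub_neg, norm_sub_rev]; exact hq.2.2)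
      rw [norm_neg (Dx v q)] at h8
      exact max_le (by linarith [hq'.2]) (by linarith [hq'.1])
    have h6 : lint (fun q => C * e q) S ≤ ENNReal.ofReal c₀ := by
      refine (lint_const_mul_le hC0.le h2).trans (ENNReal.ofReal_le_ofReal ?_)
      calc C ^ (d + 1) * min (min η 1) (c₀ / C ^ (d + 1)) ≤ C ^ (d + 1) * (c₀ / C ^ (d + 1)) := by
            gcongr
            exact min_le_right _ _
        _ = c₀ := by field_simp
    refine h5.trans ((lint_add_le (he.const_mul C) S).trans ?_)
    calc 2 ^ (d + 1) * (lint f S + lint (fun q => C * e q) S)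
        ≤ 2 ^ (d + 1) * (ENNReal.ofReal c₀ + ENNReal.ofReal c₀) := by gcongr
      _ = ENNReal.ofReal c₁ := by
        rw [← ENNReal.ofReal_add hc₀0.le hc₀0.le, show (2 : ℝ≥0∞) = ENNReal.ofReal 2 by simp,
          ← ENNReal.ofReal_pow (by norm_num), ← ENNReal.ofReal_mul (by positivity), hc₀]
        congr 1
        rw [pow_succ 2 (d + 1)]
        field_simp
        ring
  have hle : ∀ q ∈ S, |v q - u q| ≤ η ∧ |v q - u q| ≤ 1 := fun q hq =>
    ⟨(h1 q hq).trans ((min_le_left _ _).trans (min_le_left _ _)),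
      (h1 q hq).trans ((min_le_left _ _).trans (min_le_right _ _))⟩
  have hbd' : ∀ q ∈ S, |v q| ≤ M + 1 := fun q hq => by
    have h4 := abs_add_le (v q - u q) (u q)
    rw [sub_add_cancel] at h4
    linarith [hbd q hq, (hle q hq).2]
  have hr1' : 0 < min r₁ r := lt_min hr₁ hr
  have hqv := hosc v f₁ hv p₀ hs1 hs2 hbd' hf₁f q (by
    refine prod_mono (Icc_subset_Icc_right ?_) (closedBall_subset_closedBall ?_) hq
    · have := pow_le_pow_left₀ hr1'.le (min_le_left r₁ r) 2
      linarith
    · linarith [min_le_left r₁ r])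
  have hqS : q ∈ S := by
    refine prod_mono (Icc_subset_Icc_right ?_) (closedBall_subset_closedBall ?_) hq
    · have := pow_le_pow_left₀ hr1'.le (min_le_right r₁ r) 2
      linarith
    · linarith [min_le_right r₁ r]
  have hpS : p₀ ∈ S := ⟨⟨le_rfl, by simp; positivity⟩, mem_closedBall_self (by positivity)⟩
  have e1 := abs_le.1 (hle q hqS).1
  have e2 := abs_le.1 (hle p₀ hpS).1
  have e3 := abs_le.1 hqv
  rw [abs_le]
  constructor <;> linarith [e1.1, e1.2, e2.1, e2.2, e3.1, e3.2]

/-- Interior equicontinuity of bounded strong solutions, up to the initial time. -/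
theorem exists_nhds_abs_sub_le_interior (hδ : 0 < δ) (hδ1 : δ ≤ 1) (hB : 0 ≤ B) (hT : 0 < T)
    (hΩ : IsOpen Ω) {q₀ : ℝ × E d} (hq₀ : q₀ ∈ PiDom T Ω) {M : ℝ} (hM : 0 < M)
    {f : ℝ × E d → ℝ} (hf : MemLp f (d + 1 : ℕ) (volume.restrict (PiInt T Ω))) {η : ℝ}
    (hη : 0 < η) : ∃ W ∈ 𝓝 q₀, ∀ (F : Ham d) (u ut : ℝ × E d → ℝ) (ux : ℝ × E d → E d)
      (uxx : ℝ × E d → Matrix (Fin d) (Fin d) ℝ), Struct δ B F → StrongSol T Ω F u ut ux uxx →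
      (∀ q ∈ closure (PiDom T Ω), |u q| ≤ M) →
      (∀ r q, |r| ≤ M → |F (vcons r 0) 0 q| ≤ f q) →
      ∀ q ∈ W ∩ closure (PiDom T Ω), |u q - u q₀| ≤ 6 * η := by
  obtain ⟨c₀, hc₀, hosc⟩ := osc_small_approx (d := d) hδ hδ1 hB hη hM
  obtain ⟨σ, hσ, hint⟩ := exists_ball_lint_le (lint_lt_top hf) q₀ (ε := ENNReal.ofReal c₀)
    (by simpa using hc₀)
  obtain ⟨κ, hκ, hκΩ⟩ := Metric.isOpen_iff.1 hΩ q₀.2 hq₀.2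
  have htT : 0 < T - q₀.1 := sub_pos.2 hq₀.1.2
  set r : ℝ := min 1 (min σ (min (T - q₀.1) κ)) / 16 with hr
  have hm0 : 0 < min 1 (min σ (min (T - q₀.1) κ)) := by positivity
  have hr0 : 0 < r := by positivity
  have hr1 : 16 * r ≤ 1 := by rw [hr]; linarith [min_le_left 1 (min σ (min (T - q₀.1) κ))]
  have hm1 := min_le_right 1 (min σ (min (T - q₀.1) κ))
  have hm2 := hm1.trans (min_le_right _ _)
  have hrσ : 16 * r ≤ σ := by rw [hr]; linarith [hm1.trans (min_le_left _ _)]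
  have hrT : 16 * r ≤ T - q₀.1 := by rw [hr]; linarith [hm2.trans (min_le_left _ _)]
  have hrκ : 16 * r ≤ κ := by rw [hr]; linarith [hm2.trans (min_le_right _ _)]
  obtain ⟨ρ, hρ, hρr, hosc⟩ := hosc r hr0 (by linarith)
  have hρ2 : ρ ^ 2 ≤ r ^ 2 := pow_le_pow_left₀ hρ.le hρr 2
  have hr2 : r ^ 2 ≤ r := by nlinarith
  set W : Set (ℝ × E d) := Ioo (q₀.1 - ρ ^ 2) (q₀.1 + ρ ^ 2) ×ˢ ball q₀.2 ρ with hW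
  have hWo : IsOpen W := isOpen_Ioo.prod isOpen_ball
  have hρ20 : 0 < ρ ^ 2 := by positivity
  have hqW : q₀ ∈ W := ⟨⟨by linarith, by linarith⟩, mem_ball_self hρ⟩
  refine ⟨W, hWo.mem_nhds hqW, fun F u ut ux uxx hF hu hbd hFf => ?_⟩
  have hkey : ∀ q ∈ W ∩ PiInt T Ω, ∀ q' ∈ W ∩ PiInt T Ω, |u q - u q'| ≤ 6 * η := by
    intro q hq q' hq'
    set p₀ : ℝ × E d := (min q.1 q'.1, q₀.2) with hp₀
    have hp1 : 0 < p₀.1 := lt_min hq.2.1.1 hq'.2.1.1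
    have hp2 : p₀.1 < q₀.1 + ρ ^ 2 := (min_le_left _ _).trans_lt hq.1.1.2
    have hp3 : q₀.1 - ρ ^ 2 < p₀.1 := lt_min hq.1.1.1 hq'.1.1.1
    have hsub : box (3 * r ^ 2) (8 * r) p₀ ⊆ PiInt T Ω ∩ ball q₀ σ := by
      rintro s ⟨hs1, hs2⟩
      have hs2' : dist s.2 q₀.2 ≤ 8 * r := hs2
      refine ⟨⟨⟨hp1.trans_le hs1.1, by linarith [hs1.2]⟩, hκΩ ?_⟩, ?_⟩
      · rw [mem_ball]; linarith
      · rw [mem_ball, Prod.dist_eq, max_lt_iff, Real.dist_eq, abs_lt]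
        exact ⟨⟨by linarith [hs1.1], by linarith [hs1.2]⟩, by linarith⟩
    have hsub' := hsub.trans inter_subset_left
    have h := hosc u ut f ux uxx p₀
      (hu.ap _ hsub' (isCompact_Icc.prod (isCompact_closedBall _ _))) (by
        have a1 := hu.sub_ineq hF
        have a2 := hu.neg.sub_ineq hF.neg
        refine ae_restrict_of_ae_restrict_of_subset hsub' ?_
        filter_upwards [a1, a2, ae_restrict_mem (isOpen_PiInt hΩ).measurableSet] with s b1 b2 hs
        have b3 := abs_le.1 (hbd s (subset_closure (PiInt_subset hs)))
        have b4 := b1 (-M) b3.1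
        have b5 := b2 (-M) (by linarith [b3.2])
        have b6 := abs_le.1 (hFf (-M) s (by rw [abs_neg, abs_of_pos hM]))
        have b7 := abs_le.1 (hFf M s (by rw [abs_of_pos hM]))
        simp only [negHam, neg_vcons, neg_neg, neg_zero] at b5
        exact ⟨by linarith [b6.2], by linarith [b7.1]⟩)
      (fun s hs => hbd s (subset_closure (PiInt_subset (hsub' hs))))
      ((lint_mono_set hsub).trans hint)
    have hmem : ∀ s ∈ W, p₀.1 ≤ s.1 → s ∈ box (3 * ρ ^ 2) (8 * ρ) p₀ := fun s hs hs' =>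
      ⟨⟨hs', by linarith [hs.1.2]⟩, ball_subset_closedBall (ball_subset_ball (by linarith) hs.2)⟩
    have e1 := abs_le.1 (h q (hmem q hq.1 (min_le_left _ _)))
    have e2 := abs_le.1 (h q' (hmem q' hq'.1 (min_le_right _ _)))
    rw [abs_le]
    constructor <;> linarith [e1.1, e1.2, e2.1, e2.2]
  have hcl : W ∩ closure (PiDom T Ω) ⊆ closure (W ∩ PiInt T Ω) := by
    rw [← closure_PiInt hT]
    exact hWo.inter_closure
  have hcl' : closure (W ∩ PiInt T Ω) ⊆ closure (PiDom T Ω) := by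
    rw [← closure_PiInt hT]
    exact closure_mono inter_subset_right
  have hc : ContinuousOn u (closure (W ∩ PiInt T Ω)) := hu.cont.mono hcl'
  intro q hq
  refine le_on_closure (f := fun q => |u q - u q₀|) (g := fun _ => 6 * η) (fun s hs => ?_)
    (hc.sub continuousOn_const).abs continuousOn_const (hcl hq)
  exact le_on_closure (f := fun q => |u s - u q|) (g := fun _ => 6 * η) (fun s' hs' =>
    hkey s hs s' hs') (continuousOn_const.sub hc).abs continuousOn_const
    (hcl ⟨hqW, subset_closure hq₀⟩)

end Interior

section Limit

variable {d : ℕ} {T : ℝ} {Ω : Set (E d)} {δ B K₀ : ℝ} {H : Ham d} {Hb : ℝ × E d → ℝ}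
  {P : Matrix (Fin d) (Fin d) ℝ → ℝ} {g : ℝ × E d → ℝ} {vf vtf : ℝ → ℝ × E d → ℝ}
  {vxf : ℝ → ℝ × E d → E d} {vxxf : ℝ → ℝ × E d → Matrix (Fin d) (Fin d) ℝ}

lemma memLp_const_add {S : Set (ℝ × E d)} {n : ℝ≥0∞} {f : ℝ × E d → ℝ}
    (hf : MemLp f n (volume.restrict S)) {c : ℝ} (hS : volume S < ⊤) :
    MemLp (fun q => c + f q) n (volume.restrict S) := by
  have : IsFiniteMeasure (volume.restrict S) := ⟨by rwa [Measure.restrict_apply_univ]⟩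
  exact MemLp.add (memLp_const c) hf

/-- A common bound for strong solutions with the same boundary datum. -/
lemma exists_abs_le (hδ : 0 < δ) (hδ1 : δ ≤ 1) (hB : 0 ≤ B) (hT : 0 < T) (hΩ : IsOpen Ω)
    (hΩb : Bornology.IsBounded Ω) (hg : ContinuousOn g (parBdry T Ω))
    (hHb : MemLp Hb (d + 1 : ℕ) (volume.restrict (PiInt T Ω))) : ∃ M > (0 : ℝ),
      ∀ (F : Ham d) (u ut : ℝ × E d → ℝ) (ux : ℝ × E d → E d)
      (uxx : ℝ × E d → Matrix (Fin d) (Fin d) ℝ), Struct δ B F → StrongSol T Ω F u ut ux uxx →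
      EqOn u g (parBdry T Ω) → (∀ q, |F (vcons 0 0) 0 q| ≤ Hb q) →
      ∀ q ∈ closure (PiDom T Ω), |u q| ≤ M := by
  obtain ⟨R, hR, hbox⟩ := exists_box hT hΩb
  obtain ⟨G, hG⟩ := (isCompact_parBdry hΩb).exists_bound_of_continuousOn hg
  have hN := abpN_nonneg (d := d) hδ hB hT.le hR
  have hl := lint_lt_top hHb
  set μ : ℝ := (lint Hb (PiInt T Ω)).toReal + 1 with hμ
  have hμ1 : 1 ≤ μ := by linarith [ENNReal.toReal_nonneg (a := lint Hb (PiInt T Ω))]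
  have hμ0 : 0 < μ := by linarith
  have hint : lint Hb (PiInt T Ω) ≤ ENNReal.ofReal μ ^ (d + 1) := by
    rw [← ENNReal.ofReal_pow hμ0.le, ← ENNReal.ofReal_toReal hl.ne]
    refine ENNReal.ofReal_le_ofReal (le_trans (by linarith) (le_self_pow₀ hμ1 (by simp)))
  refine ⟨max G 0 + abpN d δ B T R * (4 * μ) + 1, by positivity, ?_⟩
  intro F u ut ux uxx hF hu hug hF0 q hq
  have h1 := hu.le_of_le hδ hδ1 hB hF hT hΩ hR hbox (Hb := Hb)
    (fun p => (le_abs_self _).trans (hF0 p)) (le_max_right G 0)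
    (fun q hq => by
      rw [hug hq]
      exact (le_abs_self _).trans ((hG q hq).trans (le_max_left _ _))) hμ0 hint q hq
  have h2 := hu.neg.le_of_le hδ hδ1 hB hF.neg hT hΩ hR hbox (Hb := Hb)
    (fun p => by
      rw [negHam, neg_vcons, neg_zero, neg_zero, neg_zero]
      exact (neg_le_abs _).trans (hF0 p)) (le_max_right G 0)
    (fun q hq => by
      rw [hug hq]
      exact (neg_le_abs _).trans ((hG q hq).trans (le_max_left _ _))) hμ0 hint q hq
  rw [abs_le]
  constructor <;> linarith

lemma maxHam_anti {K₁ K₂ : ℝ} (h : K₁ ≤ K₂) (u' : E (d + 1)) (A : Matrix (Fin d) (Fin d) ℝ)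
    (p : ℝ × E d) : maxHam H P K₂ u' A p ≤ maxHam H P K₁ u' A p :=
  max_le_max le_rfl (by linarith)

/-- Monotone uniform convergence of the solutions of the truncated equations. -/
theorem exists_limit (hδ : 0 < δ) (hδ1 : δ ≤ 1) (hB : 0 ≤ B) (hT : 0 < T) (hΩ : IsC11Domain Ω)
    (hF : ∀ K, Struct δ B (maxHam H P K)) (hK₀ : 0 < K₀)
    (hH : ∀ K > (0 : ℝ), ∀ r p, |maxHam H P K (vcons r 0) 0 p| ≤ K₀ * |r| + Hb p)
    (hHb : MemLp Hb (d + 1 : ℕ) (volume.restrict (PiInt T Ω)))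
    (hg : ContinuousOn g (parBdry T Ω))
    (hs : ∀ K > (0 : ℝ), StrongSol T Ω (maxHam H P K) (vf K) (vtf K) (vxf K) (vxxf K))
    (hsg : ∀ K > (0 : ℝ), EqOn (vf K) g (parBdry T Ω)) :
    (∀ K₁ K₂ : ℝ, 0 < K₁ → K₁ ≤ K₂ → ∀ q ∈ closure (PiDom T Ω), vf K₂ q ≤ vf K₁ q) ∧
    ∃ v : ℝ × E d → ℝ, ContinuousOn v (closure (PiDom T Ω)) ∧
      TendstoUniformlyOn (fun K => vf K) v atTop (closure (PiDom T Ω)) ∧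
      EqOn v g (parBdry T Ω) := by
  have hmono : ∀ K₁ K₂ : ℝ, 0 < K₁ → K₁ ≤ K₂ → ∀ q ∈ closure (PiDom T Ω), vf K₂ q ≤ vf K₁ q :=
    fun K₁ K₂ h1 h2 => (hs K₂ (h1.trans_le h2)).compare hδ hδ1 hB (hF K₂) hT hΩ.1 hΩ.2.2.1
      (hs K₁ h1) (maxHam_anti h2) fun q hq => by
        rw [hsg _ (h1.trans_le h2) hq, hsg _ h1 hq]
  refine ⟨hmono, ?_⟩
  obtain ⟨M, hM, hbd⟩ := exists_abs_le hδ hδ1 hB hT hΩ.1 hΩ.2.2.1 hg hHb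
  have hbd' : ∀ K > (0 : ℝ), ∀ q ∈ closure (PiDom T Ω), |vf K q| ≤ M := fun K hK =>
    hbd _ _ _ _ _ (hF K) (hs K hK) (hsg K hK) fun q => by simpa using hH K hK 0 q
  have hf := memLp_const_add hHb (c := K₀ * M) (volume_PiInt_lt_top hΩ.2.2.1)
  have hFf : ∀ K > (0 : ℝ), ∀ r q, |r| ≤ M →
      |maxHam H P K (vcons r 0) 0 q| ≤ K₀ * M + Hb q := fun K hK r q hr => by
    have := mul_le_mul_of_nonneg_left hr hK₀.le
    linarith [hH K hK r q]
  have hequi : ∀ q₀ ∈ closure (PiDom T Ω), ∀ ε > (0 : ℝ), ∃ W ∈ 𝓝 q₀, ∀ K > (0 : ℝ),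
      ∀ q ∈ W ∩ closure (PiDom T Ω), |vf K q - vf K q₀| ≤ ε := by
    intro q₀ hq₀ ε hε
    by_cases hmem : q₀ ∈ PiDom T Ω
    · obtain ⟨W, hW, h⟩ := exists_nhds_abs_sub_le_interior hδ hδ1 hB hT hΩ.1 hmem hM hf
        (show 0 < ε / 6 by positivity)
      refine ⟨W, hW, fun K hK q hq => ?_⟩
      have := h _ _ _ _ _ (hF K) (hs K hK) (hbd' K hK) (hFf K hK) q hq
      linarith
    · have hq₀' : q₀ ∈ parBdry T Ω := by
        rw [closure_PiDom hT] at hq₀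
        by_cases h : q₀.1 = T
        · exact Or.inl ⟨h, hq₀.2⟩
        · refine Or.inr ⟨hq₀.1, hq₀.2, fun h2 => hmem ⟨⟨hq₀.1.1, lt_of_le_of_ne hq₀.1.2 h⟩, ?_⟩⟩
          exact interior_subset h2
      obtain ⟨W, hW, h⟩ := exists_nhds_abs_sub_le hδ hδ1 hB hT hΩ hq₀' hg M hf
        (show 0 < ε / 3 by positivity)
      refine ⟨W, hW, fun K hK q hq => ?_⟩
      have := h _ _ _ _ _ (hF K) (hs K hK) (hbd' K hK) (hFf K hK) (hsg K hK) q hq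
      rw [hsg K hK hq₀']
      linarith
  set w : ℝ → ℝ × E d → ℝ := fun K => vf (max K 1)
  have hpos : ∀ K : ℝ, 0 < max K 1 := fun K => lt_max_of_lt_right one_pos
  have hanti : ∀ q ∈ closure (PiDom T Ω), Antitone fun K => w K q := fun q hq K₁ K₂ h =>
    hmono _ _ (hpos K₁) (max_le_max h le_rfl) q hq
  set v : ℝ × E d → ℝ := fun q => ⨅ K, w K q
  have hlim : ∀ q ∈ closure (PiDom T Ω), Tendsto (fun K => w K q) atTop (𝓝 (v q)) :=
    fun q hq => tendsto_atTop_ciInf (hanti q hq) ⟨-M, by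
      rintro _ ⟨K, rfl⟩
      exact (abs_le.1 (hbd' _ (hpos K) q hq)).1⟩
  have hvc : ContinuousOn v (closure (PiDom T Ω)) := by
    intro q₀ hq₀
    rw [ContinuousWithinAt, Metric.tendsto_nhds]
    intro ε hε
    obtain ⟨W, hW, h⟩ := hequi q₀ hq₀ (ε / 2) (by positivity)
    filter_upwards [inter_mem (mem_nhdsWithin_of_mem_nhds hW) self_mem_nhdsWithin] with q hq
    rw [Real.dist_eq]
    refine lt_of_le_of_lt ?_ (half_lt_self hε)
    exact le_of_tendsto ((hlim q hq.2).sub (hlim q₀ hq₀)).abs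
      (Eventually.of_forall fun K => h _ (hpos K) q hq)
  refine ⟨v, hvc, ?_, fun q hq => ?_⟩
  · refine (Antitone.tendstoUniformlyOn_of_forall_tendsto
      (isCompact_closure_PiDom hT hΩ.2.2.1) (fun K => (hs _ (hpos K)).cont) hanti hvc hlim).congr ?_
    filter_upwards [eventually_ge_atTop 1] with K hK q _
    rw [max_eq_left hK]
  · refine tendsto_nhds_unique (hlim q (parBdry_subset hT hq)) ?_
    refine tendsto_const_nhds.congr fun K => ?_
    exact (hsg _ (hpos K) hq).symm

end Limit

section Viscosity

variable {d : ℕ} {T : ℝ} {Ω : Set (E d)} {δ B : ℝ} {H : Ham d}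

lemma lint_sub_tendsto {G : ℝ × E d → ℝ} {S : Set (ℝ × E d)}
    (hG : MemLp G (d + 1 : ℕ) (volume.restrict S)) {ε : ℝ≥0∞} (hε : 0 < ε) :
    ∃ K₁ : ℝ, ∀ K ≥ K₁, lint (fun q => max (G q - K) 0) S ≤ ε := by
  have hm : AEMeasurable G (volume.restrict S) := hG.1.aemeasurable
  have hlim : Tendsto (fun n : ℕ => lint (fun q => G q - n) S) atTop (𝓝 0) := by
    have := tendsto_lintegral_of_dominated_convergence' (μ := volume.restrict S)
      (F := fun (n : ℕ) q => ENNReal.ofReal (G q - n) ^ (d + 1)) (f := fun _ => 0)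
      (fun q => ENNReal.ofReal (G q) ^ (d + 1))
      (fun n => (hm.sub_const _).ennreal_ofReal.pow_const _)
      (fun n => Eventually.of_forall fun q => by
        dsimp only
        gcongr
        linarith [Nat.cast_nonneg (α := ℝ) n]) (lint_lt_top hG).ne
      (Eventually.of_forall fun q => by
        refine tendsto_const_nhds.congr' ?_
        obtain ⟨n₀, hn₀⟩ := exists_nat_ge (G q)
        filter_upwards [eventually_ge_atTop n₀] with n hn
        have : (n₀ : ℝ) ≤ n := by exact_mod_cast hn
        rw [ENNReal.ofReal_of_nonpos (by linarith), zero_pow (by simp)])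
    simpa [lint] using this
  obtain ⟨n, hn⟩ := (hlim.eventually (ge_mem_nhds hε)).exists
  refine ⟨n, fun K hK => le_trans (lintegral_mono fun q => ?_) hn⟩
  rw [ENNReal.ofReal_max, ENNReal.ofReal_zero, max_eq_left zero_le]
  exact (pow_le_pow_left' (ENNReal.ofReal_le_ofReal (sub_le_sub_left hK _)) _)

lemma exists_ae_le_of_limsup_neg {f : ℝ × E d → ℝ} {p₀ : ℝ × E d} {r : ℝ} (hr : 0 < r)
    (h : Filter.limsup (fun ρ : ℝ => pEssSup f (cylSet ρ p₀)) (𝓝[>] 0) < (0 : EReal)) :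
    ∃ ε > (0 : ℝ), ∃ ρ > (0 : ℝ), ρ < r ∧ ∀ᵐ q ∂volume.restrict (cylSet ρ p₀), f q ≤ -ε := by
  obtain ⟨c, hc, hc0⟩ := EReal.lt_iff_exists_real_btwn.1 h
  have hc0' : c < 0 := by exact_mod_cast hc0
  obtain ⟨ρ, h1, h2⟩ := ((eventually_lt_of_limsup_lt hc).and
    (Ioo_mem_nhdsGT hr : Ioo 0 r ∈ 𝓝[>] (0 : ℝ))).exists
  refine ⟨-c, by linarith, ρ, h2.1, h2.2, ?_⟩
  filter_upwards [ae_lt_of_essSup_lt h1] with q hq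
  rw [neg_neg]
  exact (EReal.coe_lt_coe_iff.1 hq).le

lemma exists_ae_ge_of_liminf_pos {f : ℝ × E d → ℝ} {p₀ : ℝ × E d} {r : ℝ} (hr : 0 < r)
    (h : (0 : EReal) < Filter.liminf (fun ρ : ℝ => pEssInf f (cylSet ρ p₀)) (𝓝[>] 0)) :
    ∃ ε > (0 : ℝ), ∃ ρ > (0 : ℝ), ρ < r ∧ ∀ᵐ q ∂volume.restrict (cylSet ρ p₀), ε ≤ f q := by
  obtain ⟨c, hc0, hc⟩ := EReal.lt_iff_exists_real_btwn.1 h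
  have hc0' : 0 < c := by exact_mod_cast hc0
  obtain ⟨ρ, h1, h2⟩ := ((eventually_lt_of_lt_liminf hc).and
    (Ioo_mem_nhdsGT hr : Ioo 0 r ∈ 𝓝[>] (0 : ℝ))).exists
  refine ⟨c, hc0', ρ, h2.1, h2.2, ?_⟩
  filter_upwards [ae_lt_of_lt_essInf h1] with q hq
  exact (EReal.coe_lt_coe_iff.1 hq).le

/-- The open cylinder inside `cylSet`. -/
def cylInt (ρ : ℝ) (p₀ : ℝ × E d) : Set (ℝ × E d) := Ioo p₀.1 (p₀.1 + ρ ^ 2) ×ˢ ball p₀.2 ρ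

lemma isOpen_cylInt (ρ : ℝ) (p₀ : ℝ × E d) : IsOpen (cylInt ρ p₀) := isOpen_Ioo.prod isOpen_ball

lemma interior_cylSet (ρ : ℝ) (p₀ : ℝ × E d) : interior (cylSet ρ p₀) = cylInt ρ p₀ := by
  rw [cylSet, interior_prod_eq, interior_Ico, isOpen_ball.interior_eq, cylInt]

lemma cylInt_subset (ρ : ℝ) (p₀ : ℝ × E d) : cylInt ρ p₀ ⊆ cylSet ρ p₀ :=
  prod_mono_left Ioo_subset_Ico_self

lemma closure_cylInt {ρ : ℝ} (hρ : 0 < ρ) (p₀ : ℝ × E d) :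
    closure (cylInt ρ p₀) = box (ρ ^ 2) ρ p₀ := by
  have : 0 < ρ ^ 2 := by positivity
  rw [cylInt, closure_prod_eq, closure_Ioo (by linarith), closure_ball _ hρ.ne', box]

lemma closure_cylSet {ρ : ℝ} (hρ : 0 < ρ) (p₀ : ℝ × E d) :
    closure (cylSet ρ p₀) = box (ρ ^ 2) ρ p₀ := by
  have : 0 < ρ ^ 2 := by positivity
  rw [cylSet, closure_prod_eq, closure_Ico (by linarith), closure_ball _ hρ.ne', box]

lemma box_subset_cylSet {ρ r : ℝ} (hρ : 0 < ρ) (hr : ρ < r) (p₀ : ℝ × E d) :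
    box (ρ ^ 2) ρ p₀ ⊆ cylSet r p₀ := by
  have : ρ ^ 2 < r ^ 2 := pow_lt_pow_left₀ hr hρ.le two_ne_zero
  exact prod_mono (Icc_subset_Ico_right (by linarith)) (closedBall_subset_ball hr)

lemma cylInt_mono {ρ r : ℝ} (hρ : 0 < ρ) (hr : ρ ≤ r) (p₀ : ℝ × E d) :
    cylInt ρ p₀ ⊆ cylInt r p₀ := by
  have : ρ ^ 2 ≤ r ^ 2 := pow_le_pow_left₀ hρ.le hr 2
  exact prod_mono (Ioo_subset_Ioo_right (by linarith)) (ball_subset_ball hr)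

lemma cylInt_subset_PiInt {r : ℝ} {p₀ : ℝ × E d} (hΩ : IsOpen Ω)
    (h : closure (cylSet r p₀) ⊆ PiDom T Ω) : cylInt r p₀ ⊆ PiInt T Ω := by
  rw [← interior_cylSet, ← interior_PiDom hΩ]
  exact interior_mono (subset_closure.trans h)

/-- A localized maximum principle with a quadratic penalty. -/
lemma penalized_abp (hδ : 0 < δ) (hδ1 : δ ≤ 1) (hB : 0 ≤ B) {ρ ν s μ : ℝ} (hρ : 0 < ρ)
    (hν : 0 < ν) {p₀ : ℝ × E d} {z zt f : ℝ × E d → ℝ} {zx : ℝ × E d → E d}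
    {zxx : ℝ × E d → Matrix (Fin d) (Fin d) ℝ} (hz : ContinuousOn z (box (ρ ^ 2) ρ p₀))
    (hap : ∀ K ⊆ cylInt ρ p₀, IsCompact K → Approx K z zt zx zxx)
    (hle : ∀ q ∈ box (ρ ^ 2) ρ p₀, z q ≤ s + ν * ρ ^ 2 / 4) (hs : s - ν * ρ ^ 2 / 4 ≤ z p₀)
    (hf : ∀ᵐ q ∂volume.restrict (cylInt ρ p₀), 0 ≤ zt q - ν +
      pucci δ (zxx q - (2 * ν) • (1 : Matrix (Fin d) (Fin d) ℝ)) +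
      B * ‖zx q - (2 * ν) • (q.2 - p₀.2)‖ + f q) (hμ : 0 < μ)
    (hint : lint f (cylInt ρ p₀) ≤ ENNReal.ofReal μ ^ (d + 1)) :
    ν * ρ ^ 2 / 4 ≤ abpN d δ B (ρ ^ 2) ρ * (4 * μ) := by
  have hρ2 : 0 < ρ ^ 2 := by positivity
  have hcl := closure_cylInt hρ p₀
  set ψ : ℝ × E d → ℝ := fun q =>
    ((-ν) * (q.1 - p₀.1) + (ν * ρ ^ 2 / 2 - s)) + (-ν) * ‖q.2 - p₀.2‖ ^ 2 with hψ
  have ht : ContDiff ℝ 2 fun t : ℝ => (-ν) * (t - p₀.1) + (ν * ρ ^ 2 / 2 - s) := by fun_prop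
  have hn : ContDiff ℝ 2 fun q : ℝ × E d => (-ν) * ‖q.2 - p₀.2‖ ^ 2 :=
    contDiff_const.mul (contDiff_normsq p₀.2)
  have hψc : ContDiff ℝ 2 ψ := (contDiff_time ht).add hn
  have hψt : ∀ q, Dt ψ q = -ν := fun q => by
    have hd : deriv (fun t : ℝ => (-ν) * (t - p₀.1) + (ν * ρ ^ 2 / 2 - s)) q.1 = -ν := by
      have h : HasDerivAt (fun t : ℝ => (-ν) * (t - p₀.1) + (ν * ρ ^ 2 / 2 - s)) ((-ν) * 1) q.1 :=
        (((hasDerivAt_id q.1).sub_const _).const_mul (-ν)).add_const _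
      rw [h.deriv, mul_one]
    rw [hψ, Dt_add (contDiff_time ht) hn, Dt_time ht, Dt_const_mul (contDiff_normsq p₀.2),
      Dt_normsq, hd]
    ring
  have hψx : ∀ q, Dx ψ q = -((2 * ν) • (q.2 - p₀.2)) := fun q => by
    rw [hψ, Dx_add (contDiff_time ht) hn, Dx_time ht, Dx_const_mul (contDiff_normsq p₀.2),
      Dx_normsq]
    module
  have hψxx : ∀ q, Dxx ψ q = -((2 * ν) • (1 : Matrix (Fin d) (Fin d) ℝ)) := fun q => by
    rw [hψ, Dxx_add (contDiff_time ht) hn, Dxx_time ht, Dxx_const_mul (contDiff_normsq p₀.2),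
      Dxx_normsq]
    module
  have hc : ContinuousOn (fun q => z q + ψ q) (closure (cylInt ρ p₀)) := by
    rw [hcl]
    exact hz.add hψc.continuous.continuousOn
  have key := abp_weak hδ hδ1 hB hρ2.le hρ.le (isOpen_cylInt ρ p₀) hcl.le (fun q hq => hq.1.1)
    (u := fun q => z q + ψ q) (ut := fun q => zt q + Dt ψ q) (ux := fun q => zx q + Dx ψ q)
    (uxx := fun q => zxx q + Dxx ψ q) (f := f) hc (fun q hq hq' h0 => ?_)
    (fun K hK hKc => (hap K hK hKc).add (approx_smooth hψc)) ?_ hμ hint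
  · have h1 := le_on_closure (f := fun q => z q + ψ q)
      (g := fun _ => abpN d δ B (ρ ^ 2) ρ * (4 * μ)) key hc continuousOn_const (x := p₀) (by
        rw [hcl]
        exact ⟨⟨le_rfl, by linarith⟩, mem_closedBall_self hρ.le⟩)
    have h2 : ψ p₀ = ν * ρ ^ 2 / 2 - s := by simp [hψ]
    linarith
  · rw [hcl] at hq
    have h1 := hle q hq
    have h2 : ρ ^ 2 ≤ (q.1 - p₀.1) + ‖q.2 - p₀.2‖ ^ 2 := by
      by_cases h : q.1 < p₀.1 + ρ ^ 2
      · have h3 : ρ ≤ ‖q.2 - p₀.2‖ := by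
          rw [← dist_eq_norm]
          exact not_lt.1 fun h3 => hq' ⟨⟨h0, h⟩, h3⟩
        have := pow_le_pow_left₀ hρ.le h3 2
        linarith
      · have := sq_nonneg ‖q.2 - p₀.2‖
        linarith
    have h3 := mul_le_mul_of_nonneg_left h2 hν.le
    have h4 : 0 < ν * ρ ^ 2 := by positivity
    rw [mul_add] at h3
    simp only [hψ]
    linarith
  · filter_upwards [hf] with q hq _
    rw [hψt, hψx, hψxx]
    simpa only [← sub_eq_add_neg] using hq

end Viscosity

section ViscosityLimit

variable {d : ℕ} {T : ℝ} {Ω : Set (E d)} {δ B : ℝ} {H : Ham d}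
  {P : Matrix (Fin d) (Fin d) ℝ → ℝ} {vf vtf : ℝ → ℝ × E d → ℝ}
  {vxf : ℝ → ℝ × E d → E d} {vxxf : ℝ → ℝ × E d → Matrix (Fin d) (Fin d) ℝ}
  {φ φt : ℝ × E d → ℝ} {φx : ℝ × E d → E d} {φxx : ℝ × E d → Matrix (Fin d) (Fin d) ℝ}

lemma approx_of_memW12 {r : ℝ} {p₀ : ℝ × E d} (hc : ContinuousOn φ (cylSet r p₀))
    (hw : MemW12 ((d : ℝ) + 1) (cylSet r p₀) φ φt φx φxx) :
    ∀ K ⊆ cylInt r p₀, IsCompact K → Approx K φ φt φx φxx := by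
  intro K hK hKc
  obtain ⟨hw, -, h1, h2, h3⟩ := hw
  unfold MemLpOn at h1 h2 h3
  rw [ofReal_add_one] at h1
  rw [← interior_cylSet] at hK
  refine approx_of_interior hw (hc.mono interior_subset) (fun K' hK' _ => ?_) hK hKc
  have hle : volume.restrict K' ≤ volume.restrict (cylSet r p₀) :=
    Measure.restrict_mono (hK'.trans interior_subset) le_rfl
  refine ⟨h1.mono_measure hle, fun i => ?_, fun i j => ?_⟩
  · have := h2 i
    rw [ofReal_add_one] at this
    exact this.mono_measure hle
  · have := h3 i j
    rw [ofReal_add_one] at this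
    exact this.mono_measure hle

lemma exists_penalty {ρ ε δ' D : ℝ} (hρ : 0 < ρ) (hε : 0 < ε) (hδ' : 0 < δ') (hD : 0 ≤ D) :
    ∃ ν > (0 : ℝ), ν * (1 + 2 * D) ≤ ε / 2 ∧ ν * ρ ^ 2 / 4 < δ' := by
  refine ⟨min (ε / 2 / (1 + 2 * D)) (δ' / ρ ^ 2), by positivity, ?_, ?_⟩
  · have := mul_le_mul_of_nonneg_right (min_le_left (ε / 2 / (1 + 2 * D)) (δ' / ρ ^ 2))
      (by positivity : 0 ≤ 1 + 2 * D)
    rwa [div_mul_cancel₀ _ (by positivity)] at this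
  · have := mul_le_mul_of_nonneg_right (min_le_right (ε / 2 / (1 + 2 * D)) (δ' / ρ ^ 2))
      (by positivity : 0 ≤ ρ ^ 2)
    rw [div_mul_cancel₀ _ (by positivity)] at this
    linarith

lemma exists_small_mul_lt {N κ : ℝ} (hN : 0 ≤ N) (hκ : 0 < κ) :
    ∃ μ > (0 : ℝ), N * (4 * μ) < κ := by
  refine ⟨κ / (4 * (N + 1)), by positivity, ?_⟩
  have h : N * (4 * (κ / (4 * (N + 1)))) = κ * (N / (N + 1)) := by field_simp
  rw [h]
  exact mul_lt_of_lt_one_right hκ ((div_lt_one (by positivity)).2 (by linarith))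

lemma norm_matrix_le_sum (A : Matrix (Fin d) (Fin d) ℝ) : ‖A‖ ≤ ∑ i, ∑ j, |A i j| := by
  refine (Matrix.norm_le_iff (by positivity)).2 fun i j => ?_
  rw [Real.norm_eq_abs]
  refine (Finset.single_le_sum (f := fun j => |A i j|) (fun j _ => abs_nonneg _)
    (Finset.mem_univ j)).trans ?_
  exact Finset.single_le_sum (f := fun i => ∑ j, |A i j|)
    (fun i _ => Finset.sum_nonneg fun j _ => abs_nonneg _) (Finset.mem_univ i)

/-- Effect on `H` of the penalty term. -/
lemma Struct.penalty_le (hδ : 0 < δ) (hδ1 : δ ≤ 1) (hB : 0 ≤ B) (hH : Struct δ B H) {ρ ν : ℝ}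
    (hν : 0 ≤ ν) (r : ℝ) (b y : E d) (A : Matrix (Fin d) (Fin d) ℝ) (hy : ‖y‖ ≤ ρ)
    (p : ℝ × E d) :
    H (vcons r (b + (2 * ν) • y)) (A + (2 * ν) • (1 : Matrix (Fin d) (Fin d) ℝ)) p ≤
      H (vcons r b) A p +
        2 * ν * (puccC d δ * ‖(1 : Matrix (Fin d) (Fin d) ℝ)‖ + B * ρ) := by
  have h := hH r r (b + (2 * ν) • y) b (A + (2 * ν) • (1 : Matrix (Fin d) (Fin d) ℝ)) A p le_rfl
  rw [add_sub_cancel_left, add_sub_cancel_left, pucci_smul (by positivity), norm_smul,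
    Real.norm_of_nonneg (by positivity)] at h
  have h1 := mul_le_mul_of_nonneg_left (pucci_le_norm hδ hδ1 (1 : Matrix (Fin d) (Fin d) ℝ))
    (by positivity : 0 ≤ 2 * ν)
  have h2 : B * (2 * ν * ‖y‖) ≤ B * (2 * ν * ρ) := by gcongr
  linarith

/-- Effect on `H` of subtracting the penalty term. -/
lemma Struct.le_penalty (hδ : 0 < δ) (hδ1 : δ ≤ 1) (hB : 0 ≤ B) (hH : Struct δ B H) {ρ ν : ℝ}
    (hν : 0 ≤ ν) (r : ℝ) (b y : E d) (A : Matrix (Fin d) (Fin d) ℝ) (hy : ‖y‖ ≤ ρ)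
    (p : ℝ × E d) :
    H (vcons r b) A p ≤
      H (vcons r (b - (2 * ν) • y)) (A - (2 * ν) • (1 : Matrix (Fin d) (Fin d) ℝ)) p +
        2 * ν * (puccC d δ * ‖(1 : Matrix (Fin d) (Fin d) ℝ)‖ + B * ρ) := by
  have h := hH.penalty_le hδ hδ1 hB hν r (b - (2 * ν) • y) y
    (A - (2 * ν) • (1 : Matrix (Fin d) (Fin d) ℝ)) hy p
  rwa [sub_add_cancel, sub_add_cancel] at h

/-- Uniform convergence in quantitative form. -/
lemma eventually_close {v : ℝ × E d → ℝ} {κ : ℝ} (hκ : 0 < κ)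
    (hunif : TendstoUniformlyOn (fun K => vf K) v atTop (closure (PiDom T Ω))) :
    ∀ᶠ K in atTop, 0 < K ∧ ∀ q ∈ closure (PiDom T Ω), |v q - vf K q| ≤ κ := by
  filter_upwards [Metric.tendstoUniformlyOn_iff.1 hunif κ hκ, eventually_gt_atTop 0] with K h h0
  exact ⟨h0, fun q hq => (Real.dist_eq _ _ ▸ h q hq).le⟩

theorem subsol_of_limit (hδ : 0 < δ) (hδ1 : δ ≤ 1) (hB : 0 ≤ B) (hΩ : IsOpen Ω)
    (hH : Struct δ B H) (hF : ∀ K, Struct δ B (maxHam H P K)) (hP : Pprops d δ P)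
    (hcont : ∀ ε > (0 : ℝ), ∃ δ' > (0 : ℝ), ∀ (r₁ r₂ : ℝ) (b : E d)
      (A : Matrix (Fin d) (Fin d) ℝ) (p : ℝ × E d), |r₁ - r₂| < δ' →
        |H (vcons r₁ b) A p - H (vcons r₂ b) A p| < ε)
    (hs : ∀ K > (0 : ℝ), StrongSol T Ω (maxHam H P K) (vf K) (vtf K) (vxf K) (vxxf K))
    {v : ℝ × E d → ℝ} (hv : ContinuousOn v (closure (PiDom T Ω)))
    (hunif : TendstoUniformlyOn (fun K => vf K) v atTop (closure (PiDom T Ω))) :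
    IsLqViscSubsol ((d : ℝ) + 1) H (PiDom T Ω) v := by
  refine ⟨hv.mono subset_closure, fun p₀ r hr hcyl φ φt φx φxx hφc hφ hmax => ?_⟩
  by_contra hneg
  obtain ⟨ε, hε, ρ, hρ, hρr, hae⟩ := exists_ae_le_of_limsup_neg hr (not_le.1 hneg)
  obtain ⟨δ', hδ', hδH⟩ := hcont (ε / 4) (by positivity)
  set D : ℝ := puccC d δ * ‖(1 : Matrix (Fin d) (Fin d) ℝ)‖ + B * ρ with hD
  have hC := puccC_nonneg (d := d) hδ
  obtain ⟨ν, hν, hν1, hν2⟩ := exists_penalty (D := D) hρ hε hδ' (by positivity)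
  set κ : ℝ := ν * ρ ^ 2 / 4 with hκ
  have hκ0 : 0 < κ := by positivity
  have hN := abpN_nonneg (d := d) hδ hB (sq_nonneg ρ) hρ.le
  obtain ⟨μ, hμ, hμN⟩ := exists_small_mul_lt hN hκ0
  set G : ℝ × E d → ℝ := fun q => (ν + puccC d δ * (2 * ν * ‖(1 : Matrix (Fin d) (Fin d) ℝ)‖)) +
    (φt q + puccC d δ * ∑ i, ∑ j, |φxx q i j|) with hG
  have hbox : box (ρ ^ 2) ρ p₀ ⊆ cylSet r p₀ := box_subset_cylSet hρ hρr p₀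
  have hsubC : cylInt ρ p₀ ⊆ cylSet r p₀ :=
    (subset_closure.trans (closure_cylInt hρ p₀).le).trans hbox
  have hGm : MemLp G (d + 1 : ℕ) (volume.restrict (cylInt ρ p₀)) := by
    have hle : volume.restrict (cylInt ρ p₀) ≤ volume.restrict (cylSet r p₀) :=
      Measure.restrict_mono hsubC le_rfl
    obtain ⟨-, -, h1, -, h3⟩ := hφ
    unfold MemLpOn at h1 h3
    rw [ofReal_add_one] at h1
    refine memLp_const_add ?_ ?_
    · refine (h1.mono_measure hle).add (MemLp.const_mul ?_ _)
      refine memLp_finsetSum _ fun i _ => memLp_finsetSum _ fun j _ => ?_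
      have := h3 i j
      rw [ofReal_add_one] at this
      exact (this.mono_measure hle).abs
    · exact ((isBounded_Ioo _ _).prod isBounded_ball).measure_lt_top
  obtain ⟨K₁, hK₁⟩ := lint_sub_tendsto hGm (ε := ENNReal.ofReal μ ^ (d + 1))
    (ENNReal.pow_pos (ENNReal.ofReal_pos.2 hμ) _)
  obtain ⟨K, ⟨hK0, hclose⟩, hKK⟩ :=
    ((eventually_close hκ0 hunif).and (eventually_ge_atTop K₁)).exists
  have hbc : box (ρ ^ 2) ρ p₀ ⊆ closure (PiDom T Ω) :=
    (hbox.trans (subset_closure.trans hcyl)).trans subset_closure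
  have hIP : cylInt ρ p₀ ⊆ PiInt T Ω :=
    (cylInt_mono hρ hρr.le p₀).trans (cylInt_subset_PiInt hΩ hcyl)
  have hp₀ : p₀ ∈ box (ρ ^ 2) ρ p₀ :=
    ⟨⟨le_rfl, by nlinarith⟩, mem_closedBall_self hρ.le⟩
  have key := penalized_abp hδ hδ1 hB hρ hν (p₀ := p₀) (s := v p₀ - φ p₀) (μ := μ)
    (z := fun q => vf K q + -φ q) (zt := fun q => vtf K q + -φt q)
    (zx := fun q => vxf K q + -φx q) (zxx := fun q => vxxf K q + -φxx q)
    (f := fun q => max (G q - K) 0)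
    (((hs K hK0).cont.mono hbc).add (hφc.mono hbox).neg)
    (fun K' hK' hKc => ((hs K hK0).ap K' (hK'.trans hIP) hKc).add
      (approx_of_memW12 hφc hφ K' (hK'.trans (cylInt_mono hρ hρr.le p₀)) hKc).neg)
    (fun q hq => ?_) ?_ ?_ hμ (hK₁ K hKK)
  · exact absurd key (not_le.2 hμN)
  · have h1 : v q - φ q ≤ v p₀ - φ p₀ := hmax (hbox hq)
    have h2 := (abs_le.1 (hclose q (hbc hq))).1
    linarith
  · have h2 := (abs_le.1 (hclose p₀ (hbc hp₀))).2
    linarith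
  · have hsubρ : cylInt ρ p₀ ⊆ cylSet ρ p₀ := cylInt_subset ρ p₀
    filter_upwards [ae_restrict_of_ae_restrict_of_subset hIP (hs K hK0).eq,
      ae_restrict_of_ae_restrict_of_subset hsubρ hae,
      ae_restrict_mem (isOpen_cylInt ρ p₀).measurableSet] with q hq hq' hqm
    have hqb : q ∈ box (ρ ^ 2) ρ p₀ := (closure_cylInt hρ p₀).le (subset_closure hqm)
    have hcl := abs_le.1 (hclose q (hbc hqb))
    have hy : ‖q.2 - p₀.2‖ ≤ ρ := by
      rw [← dist_eq_norm]
      exact (mem_ball.1 hqm.2).le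
    set b₂ := φx q + (2 * ν) • (q.2 - p₀.2) with hb₂
    set A₂ := φxx q + (2 * ν) • (1 : Matrix (Fin d) (Fin d) ℝ) with hA₂
    have h1 := hF K (vf K q) (v q - κ) (vxf K q) b₂ (vxxf K q) A₂ q (by linarith)
    have h2 : vxxf K q + -φxx q - (2 * ν) • (1 : Matrix (Fin d) (Fin d) ℝ) = vxxf K q - A₂ := by
      rw [hA₂]; abel
    have h3 : vxf K q + -φx q - (2 * ν) • (q.2 - p₀.2) = vxf K q - b₂ := by
      rw [hb₂]; abel
    rw [h2, h3]
    have h4 := (abs_lt.1 (hδH (v q - κ) (v q) b₂ A₂ q (by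
      rwa [sub_sub_cancel_left, abs_neg, abs_of_pos hκ0]))).2
    have h5 := hH.penalty_le hδ hδ1 hB hν.le (v q) (φx q) (q.2 - p₀.2) (φxx q) hy q
    rw [← hb₂, ← hA₂, ← hD] at h5
    have h6 : P A₂ ≤ puccC d δ * (∑ i, ∑ j, |φxx q i j|) +
        puccC d δ * (2 * ν * ‖(1 : Matrix (Fin d) (Fin d) ℝ)‖) := by
      have h7 := hP.sub_le_pucci hδ A₂ 0
      rw [hP.zero, sub_zero, sub_zero] at h7
      have h8 : ‖A₂‖ ≤ (∑ i, ∑ j, |φxx q i j|) + 2 * ν * ‖(1 : Matrix (Fin d) (Fin d) ℝ)‖ := by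
        refine (norm_add_le _ _).trans (add_le_add (norm_matrix_le_sum _) ?_)
        rw [norm_smul, Real.norm_of_nonneg (by positivity)]
      have h9 := mul_le_mul_of_nonneg_left h8 hC
      linarith [pucci_le_norm hδ hδ1 A₂]
    have h10 : maxHam H P K (vcons (v q - κ) b₂) A₂ q ≤ max (G q - K) 0 - φt q - ν := by
      refine max_le ?_ ?_
      · have := le_max_right (G q - K) 0
        linarith
      · have := le_max_left (G q - K) 0
        have h11 : G q = (ν + puccC d δ * (2 * ν * ‖(1 : Matrix (Fin d) (Fin d) ℝ)‖)) +
          (φt q + puccC d δ * ∑ i, ∑ j, |φxx q i j|) := rfl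
        linarith
    linarith

theorem supersol_of_limit (hδ : 0 < δ) (hδ1 : δ ≤ 1) (hB : 0 ≤ B) (hΩ : IsOpen Ω)
    (hH : Struct δ B H)
    (hcont : ∀ ε > (0 : ℝ), ∃ δ' > (0 : ℝ), ∀ (r₁ r₂ : ℝ) (b : E d)
      (A : Matrix (Fin d) (Fin d) ℝ) (p : ℝ × E d), |r₁ - r₂| < δ' →
        |H (vcons r₁ b) A p - H (vcons r₂ b) A p| < ε)
    (hs : ∀ K > (0 : ℝ), StrongSol T Ω (maxHam H P K) (vf K) (vtf K) (vxf K) (vxxf K))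
    {v : ℝ × E d → ℝ} (hv : ContinuousOn v (closure (PiDom T Ω)))
    (hunif : TendstoUniformlyOn (fun K => vf K) v atTop (closure (PiDom T Ω))) :
    IsLqViscSupersol ((d : ℝ) + 1) H (PiDom T Ω) v := by
  refine ⟨hv.mono subset_closure, fun p₀ r hr hcyl φ φt φx φxx hφc hφ hmin => ?_⟩
  by_contra hneg
  obtain ⟨ε, hε, ρ, hρ, hρr, hae⟩ := exists_ae_ge_of_liminf_pos hr (not_le.1 hneg)
  obtain ⟨δ', hδ', hδH⟩ := hcont (ε / 4) (by positivity)
  set D : ℝ := puccC d δ * ‖(1 : Matrix (Fin d) (Fin d) ℝ)‖ + B * ρ with hD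
  have hC := puccC_nonneg (d := d) hδ
  obtain ⟨ν, hν, hν1, hν2⟩ := exists_penalty (D := D) hρ hε hδ' (by positivity)
  set κ : ℝ := ν * ρ ^ 2 / 4 with hκ
  have hκ0 : 0 < κ := by positivity
  have hN := abpN_nonneg (d := d) hδ hB (sq_nonneg ρ) hρ.le
  obtain ⟨μ, hμ, hμN⟩ := exists_small_mul_lt hN hκ0
  have hbox : box (ρ ^ 2) ρ p₀ ⊆ cylSet r p₀ := box_subset_cylSet hρ hρr p₀
  obtain ⟨K, hK0, hclose⟩ := (eventually_close hκ0 hunif).exists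
  have hbc : box (ρ ^ 2) ρ p₀ ⊆ closure (PiDom T Ω) :=
    (hbox.trans (subset_closure.trans hcyl)).trans subset_closure
  have hIP : cylInt ρ p₀ ⊆ PiInt T Ω :=
    (cylInt_mono hρ hρr.le p₀).trans (cylInt_subset_PiInt hΩ hcyl)
  have hp₀ : p₀ ∈ box (ρ ^ 2) ρ p₀ :=
    ⟨⟨le_rfl, by nlinarith⟩, mem_closedBall_self hρ.le⟩
  have key := penalized_abp hδ hδ1 hB hρ hν (p₀ := p₀) (s := φ p₀ - v p₀) (μ := μ)
    (z := fun q => φ q + -vf K q) (zt := fun q => φt q + -vtf K q)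
    (zx := fun q => φx q + -vxf K q) (zxx := fun q => φxx q + -vxxf K q)
    (f := fun _ => 0) ((hφc.mono hbox).add ((hs K hK0).cont.mono hbc).neg)
    (fun K' hK' hKc =>
      (approx_of_memW12 hφc hφ K' (hK'.trans (cylInt_mono hρ hρr.le p₀)) hKc).add
      ((hs K hK0).ap K' (hK'.trans hIP) hKc).neg)
    (fun q hq => ?_) ?_ ?_ hμ (by simp [lint])
  · exact absurd key (not_le.2 hμN)
  · have h1 : v p₀ - φ p₀ ≤ v q - φ q := hmin (hbox hq)
    have h2 := (abs_le.1 (hclose q (hbc hq))).2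
    linarith
  · have h2 := (abs_le.1 (hclose p₀ (hbc hp₀))).1
    linarith
  · have hsubρ : cylInt ρ p₀ ⊆ cylSet ρ p₀ := cylInt_subset ρ p₀
    filter_upwards [ae_restrict_of_ae_restrict_of_subset hIP (hs K hK0).eq,
      ae_restrict_of_ae_restrict_of_subset hsubρ hae,
      ae_restrict_mem (isOpen_cylInt ρ p₀).measurableSet] with q hq hq' hqm
    have hqb : q ∈ box (ρ ^ 2) ρ p₀ := (closure_cylInt hρ p₀).le (subset_closure hqm)
    have hcl := abs_le.1 (hclose q (hbc hqb))
    have hy : ‖q.2 - p₀.2‖ ≤ ρ := by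
      rw [← dist_eq_norm]
      exact (mem_ball.1 hqm.2).le
    set b₁ := φx q - (2 * ν) • (q.2 - p₀.2) with hb₁
    set A₁ := φxx q - (2 * ν) • (1 : Matrix (Fin d) (Fin d) ℝ) with hA₁
    have h1 := hH (v q + κ) (vf K q) b₁ (vxf K q) A₁ (vxxf K q) q (by linarith)
    have h2 : φxx q + -vxxf K q - (2 * ν) • (1 : Matrix (Fin d) (Fin d) ℝ) = A₁ - vxxf K q := by
      rw [hA₁]; abel
    have h3 : φx q + -vxf K q - (2 * ν) • (q.2 - p₀.2) = b₁ - vxf K q := by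
      rw [hb₁]; abel
    rw [h2, h3]
    have h4 := (abs_lt.1 (hδH (v q + κ) (v q) b₁ A₁ q (by
      rwa [add_sub_cancel_left, abs_of_pos hκ0]))).1
    have h5 := hH.le_penalty hδ hδ1 hB hν.le (v q) (φx q) (q.2 - p₀.2) (φxx q) hy q
    rw [← hb₁, ← hA₁, ← hD] at h5
    have h6 : H (vcons (vf K q) (vxf K q)) (vxxf K q) q ≤
      maxHam H P K (vcons (vf K q) (vxf K q)) (vxxf K q) q := le_max_left _ _
    linarith

end ViscosityLimit

section Maximality

variable {d : ℕ} {T : ℝ} {Ω : Set (E d)} {H : Ham d} {Q Q' : Set (ℝ × E d)}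
  {u ut : ℝ × E d → ℝ} {ux : ℝ × E d → E d} {uxx : ℝ × E d → Matrix (Fin d) (Fin d) ℝ}

lemma setIntegral_eq_of_tsupport {f ψ : ℝ × E d → ℝ} (hψ : tsupport ψ ⊆ interior Q)
    (hf : ∀ q, ψ q = 0 → f q = 0) : ∫ q in Q, f q = ∫ q, f q :=
  setIntegral_eq_integral_of_forall_compl_eq_zero fun q hq => hf q <| by
    by_contra h
    exact hq (interior_subset (hψ (subset_tsupport ψ h)))

lemma tsupport_fderiv_apply_subset' (ψ : ℝ × E d → ℝ) (e : ℝ × E d) :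
    tsupport (fun q => fderiv ℝ ψ q e) ⊆ tsupport ψ :=
  tsupport_fderiv_apply_subset ℝ e

lemma WeakDerivs.mono (hQ : Q' ⊆ Q) (h : WeakDerivs Q u ut ux uxx) :
    WeakDerivs Q' u ut ux uxx := by
  intro ψ hψ hψc hψs
  have hs : tsupport ψ ⊆ interior Q := hψs.trans (interior_mono hQ)
  have hd : ∀ e, tsupport (fun q => fderiv ℝ ψ q e) ⊆ tsupport ψ :=
    tsupport_fderiv_apply_subset' ψ
  have hdd : ∀ e e', tsupport (fun q => fderiv ℝ (fun q => fderiv ℝ ψ q e) q e') ⊆ tsupport ψ :=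
    fun e e' => (tsupport_fderiv_apply_subset' _ e').trans (hd e)
  have key : ∀ f χ : ℝ × E d → ℝ, tsupport χ ⊆ tsupport ψ →
      ∫ q in Q', f q * χ q = ∫ q in Q, f q * χ q := fun f χ hχ => by
    rw [setIntegral_eq_of_tsupport (hχ.trans hψs) fun q hq => by rw [hq, mul_zero],
      setIntegral_eq_of_tsupport (hχ.trans hs) fun q hq => by rw [hq, mul_zero]]
  obtain ⟨h1, h2, h3⟩ := h ψ hψ hψc hs
  refine ⟨?_, fun i => ?_, fun i j => ?_⟩
  · rw [key u _ (hd _), key ut ψ le_rfl, h1]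
  · rw [key u _ (hd _), key (fun q => ux q i) ψ le_rfl, h2]
  · rw [key u _ (hdd _ _), key (fun q => uxx q i j) ψ le_rfl, h3]

lemma integral_fst_mul_fderiv {χ : ℝ × E d → ℝ} (hχ : ContDiff ℝ 1 χ) (hc : HasCompactSupport χ)
    (e : ℝ × E d) : ∫ q, q.1 * fderiv ℝ χ q e = -(e.1 * ∫ q, χ q) := by
  have hf : ∀ q : ℝ × E d, fderiv ℝ (fun q : ℝ × E d => q.1) q e = e.1 := fun q => by
    rw [fderiv_fst]; rfl
  have hcd : Continuous fun q => fderiv ℝ χ q e :=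
    (hχ.continuous_fderiv one_ne_zero).clm_apply continuous_const
  have hcs : HasCompactSupport fun q => fderiv ℝ χ q e := hc.fderiv_apply ℝ e
  rw [integral_mul_fderiv_eq_neg_fderiv_mul_of_integrable (f := fun q : ℝ × E d => q.1)]
  · simp only [hf]
    rw [integral_const_mul]
  · simp only [hf]
    exact (continuous_const.mul hχ.continuous).integrable_of_hasCompactSupport hc.mul_left
  · exact (continuous_fst.mul hcd).integrable_of_hasCompactSupport hcs.mul_left
  · exact (continuous_fst.mul hχ.continuous).integrable_of_hasCompactSupport hc.mul_left
  · exact fun q _ => differentiableAt_fst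
  · exact fun q _ => hχ.differentiable one_ne_zero q

lemma WeakDerivs.sub_time (h : WeakDerivs Q u ut ux uxx) (hu : IntegrableOn u Q)
    (hut : IntegrableOn ut Q) (ε : ℝ) :
    WeakDerivs Q (fun q => u q - ε * q.1) (fun q => ut q - ε) ux uxx := by
  intro ψ hψ hψc hψs
  have hd : ∀ e, tsupport (fun q => fderiv ℝ ψ q e) ⊆ tsupport ψ :=
    tsupport_fderiv_apply_subset' ψ
  have hψ' : ∀ e, ContDiff ℝ (⊤ : ℕ∞) fun q => fderiv ℝ ψ q e := fun e =>
    (hψ.fderiv_right (m := (⊤ : ℕ∞)) le_rfl).clm_apply contDiff_const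
  have hψc' : ∀ e, HasCompactSupport fun q => fderiv ℝ ψ q e := fun e => hψc.fderiv_apply ℝ e
  have hmul : ∀ (f χ : ℝ × E d → ℝ), IntegrableOn f Q → Continuous χ → HasCompactSupport χ →
      IntegrableOn (fun q => f q * χ q) Q := fun f χ hf hχ hχc => by
    obtain ⟨C, hC⟩ := hχ.bounded_above_of_compact_support hχc
    exact hf.mul_bdd hχ.aestronglyMeasurable (Eventually.of_forall hC)
  have key : ∀ (χ : ℝ × E d → ℝ) (e : ℝ × E d), ContDiff ℝ (⊤ : ℕ∞) χ → HasCompactSupport χ →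
      tsupport χ ⊆ interior Q → ∫ q in Q, (u q - ε * q.1) * fderiv ℝ χ q e =
        (∫ q in Q, u q * fderiv ℝ χ q e) + ε * (e.1 * ∫ q in Q, χ q) := by
    intro χ e hχ hχc hχs
    have hχ1 : ContDiff ℝ 1 χ := hχ.of_le (by exact_mod_cast le_top)
    have hcd : Continuous fun q => fderiv ℝ χ q e :=
      (hχ1.continuous_fderiv one_ne_zero).clm_apply continuous_const
    have hcs : HasCompactSupport fun q => fderiv ℝ χ q e := hχc.fderiv_apply ℝ e
    have h1 : IntegrableOn (fun q : ℝ × E d => q.1 * fderiv ℝ χ q e) Q :=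
      ((continuous_fst.mul hcd).integrable_of_hasCompactSupport hcs.mul_left).integrableOn
    have h2 : ∫ q in Q, q.1 * fderiv ℝ χ q e = -(e.1 * ∫ q in Q, χ q) := by
      rw [setIntegral_eq_of_tsupport ((tsupport_fderiv_apply_subset' χ e).trans hχs)
          fun q hq => by rw [hq, mul_zero],
        setIntegral_eq_of_tsupport hχs fun q hq => hq, integral_fst_mul_fderiv hχ1 hχc]
    have h3 : ∀ q : ℝ × E d, (u q - ε * q.1) * fderiv ℝ χ q e =
        u q * fderiv ℝ χ q e - ε * (q.1 * fderiv ℝ χ q e) := fun q => by ring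
    simp only [h3]
    rw [integral_sub (hmul u _ hu hcd hcs) (h1.const_mul ε), integral_const_mul, h2]
    ring
  obtain ⟨h1, h2, h3⟩ := h ψ hψ hψc hψs
  refine ⟨?_, fun i => ?_, fun i j => ?_⟩
  · have h4 : ∀ q : ℝ × E d, (ut q - ε) * ψ q = ut q * ψ q - ε * ψ q := fun q => by ring
    rw [key ψ _ hψ hψc hψs, h1]
    simp only [h4]
    rw [integral_sub (hmul ut _ hut hψ.continuous hψc)
      ((hψ.continuous.integrable_of_hasCompactSupport hψc).integrableOn.const_mul ε),
      integral_const_mul]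
    ring
  · rw [key ψ _ hψ hψc hψs, h2]
    simp
  · rw [key _ _ (hψ' _) (hψc' _) ((hd _).trans hψs), h3]
    simp

lemma exists_cylSet_subset {O : Set (ℝ × E d)} {p₀ : ℝ × E d}
    (hO : O ∈ 𝓝[Ici p₀.1 ×ˢ univ] p₀) : ∃ r > (0 : ℝ), closure (cylSet r p₀) ⊆ O := by
  obtain ⟨η, hη, hηO⟩ := Metric.mem_nhdsWithin_iff.1 hO
  have hr : 0 < min (η / 2) 1 := by positivity
  refine ⟨min (η / 2) 1, hr, ?_⟩
  rw [closure_cylSet hr]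
  have h1 : min (η / 2) 1 ≤ η / 2 := min_le_left _ _
  have h2 : min (η / 2) 1 ≤ 1 := min_le_right _ _
  rintro q ⟨hq1, hq2⟩
  have h3 : (min (η / 2) 1) ^ 2 ≤ η / 2 := by nlinarith
  have h4 : q.1 ≤ p₀.1 + (min (η / 2) 1) ^ 2 := hq1.2
  have h5 : p₀.1 ≤ q.1 := hq1.1
  refine hηO ⟨?_, h5, mem_univ _⟩
  rw [mem_ball, Prod.dist_eq, max_lt_iff]
  refine ⟨?_, ?_⟩
  · rw [Real.dist_eq, abs_of_nonneg (by linarith)]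
    linarith
  · have := mem_closedBall.1 hq2
    linarith

/-- Viscosity subsolutions lie below strong supersolutions. -/
theorem subsol_le_strong (hT : 0 < T) (hΩ : IsOpen Ω) (hΩb : Bornology.IsBounded Ω)
    (hne : (Ωᶜ).Nonempty) {p : ℝ} (hp : (d : ℝ) + 1 ≤ p)
    (hmono : ∀ (r₁ r₂ : ℝ) (b : E d) (A : Matrix (Fin d) (Fin d) ℝ) (p : ℝ × E d),
      r₁ ≤ r₂ → H (vcons r₂ b) A p ≤ H (vcons r₁ b) A p)
    (hu : ContinuousOn u (closure (PiDom T Ω))) (hw : WeakDerivs (PiDom T Ω) u ut ux uxx)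
    (hLp : ∀ ρ : ℝ, 0 < ρ → LpAll p (PiRho T ρ Ω) u ut ux uxx)
    (heq : ∀ᵐ q ∂volume.restrict (PiDom T Ω), ut q + H (vcons (u q) (ux q)) (uxx q) q ≤ 0)
    {w : ℝ × E d → ℝ} (hwc : ContinuousOn w (closure (PiDom T Ω)))
    (hsub : IsLqViscSubsol ((d : ℝ) + 1) H (PiDom T Ω) w)
    (hbd : ∀ q ∈ parBdry T Ω, w q ≤ u q) : ∀ q ∈ closure (PiDom T Ω), w q ≤ u q := by
  by_contra! hcon
  obtain ⟨q₁, hq₁, hlt⟩ := hcon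
  set m : ℝ := w q₁ - u q₁ with hm
  have hm0 : 0 < m := sub_pos.2 hlt
  set ε : ℝ := m / (2 * T) with hε
  have hε0 : 0 < ε := by positivity
  have hεT : ε * T = m / 2 := by rw [hε]; field_simp
  have hdc : ContinuousOn (fun q => w q - u q) (closure (PiDom T Ω)) := hwc.sub hu
  obtain ⟨p₀, hp₀, hmax⟩ := (isCompact_closure_PiDom hT hΩb).exists_isMaxOn ⟨q₁, hq₁⟩
    (hdc.add (by fun_prop : ContinuousOn (fun q : ℝ × E d => ε * q.1) _))
  have hmaxq : ∀ q ∈ closure (PiDom T Ω), w q - u q + ε * q.1 ≤ w p₀ - u p₀ + ε * p₀.1 :=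
    fun q hq => hmax hq
  have hmem : ∀ q ∈ closure (PiDom T Ω), 0 ≤ q.1 ∧ q.1 ≤ T := fun q hq => by
    rw [closure_PiDom hT] at hq
    exact hq.1
  have hpos : 0 < w p₀ - u p₀ := by
    have h1 := hmaxq q₁ hq₁
    have h2 := mul_le_mul_of_nonneg_left (hmem p₀ hp₀).2 hε0.le
    have h3 := mul_nonneg hε0.le (hmem q₁ hq₁).1
    linarith
  have hp₀' : p₀ ∉ parBdry T Ω := fun h => by linarith [hbd p₀ h]
  have hp₀c := hp₀
  rw [closure_PiDom hT] at hp₀c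
  have hpd : p₀ ∈ PiDom T Ω := by
    refine ⟨⟨hp₀c.1.1, lt_of_le_of_ne hp₀c.1.2 fun h => hp₀' (Or.inl ⟨h, hp₀c.2⟩)⟩, ?_⟩
    by_contra h
    exact hp₀' (Or.inr ⟨hp₀c.1, hp₀c.2, by rwa [hΩ.interior_eq]⟩)
  have hnhds : PiDom T Ω ∈ 𝓝[Ici p₀.1 ×ˢ univ] p₀ := by
    have h1 : Iio T ×ˢ Ω ∈ 𝓝 p₀ := (isOpen_Iio.prod hΩ).mem_nhds ⟨hpd.1.2, hpd.2⟩
    filter_upwards [mem_nhdsWithin_of_mem_nhds h1, self_mem_nhdsWithin] with q hq hq'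
    have h2 : p₀.1 ≤ q.1 := hq'.1
    exact ⟨⟨hpd.1.1.trans h2, hq.1⟩, hq.2⟩
  have hnhds' : {q | 0 < w q - u q} ∈ 𝓝[Ici p₀.1 ×ˢ univ] p₀ := by
    have h1 : ∀ᶠ q in 𝓝[closure (PiDom T Ω)] p₀, 0 < w q - u q :=
      (hdc p₀ hp₀).eventually (lt_mem_nhds hpos)
    exact nhdsWithin_le_of_mem (mem_of_superset hnhds subset_closure) h1
  obtain ⟨r, hr, hrsub⟩ := exists_cylSet_subset (inter_mem hnhds hnhds')
  have hcyl : closure (cylSet r p₀) ⊆ PiDom T Ω := hrsub.trans inter_subset_left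
  have hcyl' : cylSet r p₀ ⊆ PiDom T Ω := subset_closure.trans hcyl
  have hcc : IsCompact (closure (cylSet r p₀)) := by
    rw [closure_cylSet hr]
    exact isCompact_Icc.prod (isCompact_closedBall _ _)
  have hvol : volume (cylSet r p₀) < ⊤ :=
    (measure_mono subset_closure).trans_lt hcc.measure_lt_top
  have hfin : IsFiniteMeasure (volume.restrict (cylSet r p₀)) :=
    ⟨by rwa [Measure.restrict_apply_univ]⟩
  obtain ⟨ρ, hρ, hρsub⟩ := exists_subset_PiRho hΩ hne hcyl hcc
  obtain ⟨h0, h1, h2, h3⟩ := hLp ρ hρ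
  have hsubρ : cylSet r p₀ ⊆ PiRho T ρ Ω := subset_closure.trans hρsub
  have m0 := memLp_of_le hp h0 hsubρ hvol
  have m1 := memLp_of_le hp h1 hsubρ hvol
  have h1le : (1 : ℝ≥0∞) ≤ (d + 1 : ℕ) := by exact_mod_cast Nat.le_add_left 1 d
  have mt : MemLp (fun q : ℝ × E d => ε * q.1) (d + 1 : ℕ) (volume.restrict (cylSet r p₀)) := by
    refine MemLp.of_bound (by fun_prop) (ε * T) ?_
    filter_upwards [ae_restrict_mem (measurableSet_Ico.prod measurableSet_ball)] with q hq
    have h4 := hmem q (subset_closure (hcyl' hq))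
    rw [Real.norm_of_nonneg (mul_nonneg hε0.le h4.1)]
    exact mul_le_mul_of_nonneg_left h4.2 hε0.le
  have hW : MemW12 ((d : ℝ) + 1) (cylSet r p₀) (fun q => u q - ε * q.1) (fun q => ut q - ε)
      ux uxx := by
    refine ⟨(hw.mono hcyl').sub_time (m0.integrable h1le) (m1.integrable h1le) ε, ?_⟩
    unfold LpAll MemLpOn
    rw [ofReal_add_one]
    exact ⟨m0.sub mt, m1.sub (memLp_const ε), fun i => memLp_of_le hp (h2 i) hsubρ hvol,
      fun i j => memLp_of_le hp (h3 i j) hsubρ hvol⟩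
  have hvisc := hsub.2 p₀ r hr hcyl _ _ ux uxx
    ((hu.mono (hcyl'.trans subset_closure)).sub (by fun_prop)) hW (fun q hq => by
      have := hmaxq q (subset_closure (hcyl' hq))
      change w q - (u q - ε * q.1) ≤ w p₀ - (u p₀ - ε * p₀.1)
      linarith)
  have hle : Filter.limsup (fun ρ : ℝ => pEssSup (fun q => ut q - ε +
      H (vcons (w q) (ux q)) (uxx q) q) (cylSet ρ p₀)) (𝓝[>] 0) ≤ ((-ε : ℝ) : EReal) := by
    refine Filter.limsup_le_of_le (by isBoundedDefault) ?_
    filter_upwards [Ioo_mem_nhdsGT hr] with ρ hρ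
    refine essSup_le_of_ae_le _ ?_
    have hsub' : cylSet ρ p₀ ⊆ cylSet r p₀ := by
      have : ρ ^ 2 ≤ r ^ 2 := pow_le_pow_left₀ hρ.1.le hρ.2.le 2
      exact prod_mono (Ico_subset_Ico_right (by linarith)) (ball_subset_ball hρ.2.le)
    filter_upwards [ae_restrict_of_ae_restrict_of_subset (hsub'.trans hcyl') heq,
      ae_restrict_mem (measurableSet_Ico.prod measurableSet_ball)] with q hq hqm
    have h4 : 0 < w q - u q := (hrsub (subset_closure (hsub' hqm))).2
    have h5 := hmono (u q) (w q) (ux q) (uxx q) q (by linarith)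
    exact EReal.coe_le_coe_iff.2 (by linarith)
  have h6 := hvisc.trans hle
  have h7 : (0 : ℝ) ≤ -ε := by exact_mod_cast h6
  linarith

end Maximality

/-- **Theorem 4.2.** The solutions `v_K` decrease in `K` and converge uniformly on
`Π̄` to an `L_{d+1}`-viscosity solution `v` of `∂_t v + H[v] = 0` with `v = g` on
`∂'Π`, which is the maximal `L_{d+1}`-viscosity subsolution of class `C(Π̄)`
with this boundary condition. -/
theorem stmt12 (d : ℕ) (hd : 1 ≤ d) (T δ δb K₀ p : ℝ)
    (hT : 0 < T) (hδ0 : 0 < δ) (hδ1 : δ ≤ 1) (hK₀ : 0 < K₀)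
    (hp : (d : ℝ) + 2 < p) (hδb0 : 0 < δb) (hδbδ : δb < δ)
    (Hb : ℝ × E d → ℝ) (hHb0 : ∀ q, 0 ≤ Hb q)
    (hHbLp : MemLp Hb (ENNReal.ofReal p) volume)
    (Ω : Set (E d)) (hΩ : IsC11Domain Ω)
    (H : Ham d) (hB : AssumptionB δ K₀ H Hb)
    (P : Matrix (Fin d) (Fin d) ℝ → ℝ) (hP : Pprops d δb P)
    (g : ℝ × E d → ℝ) (hg : ContinuousOn g (parBdry T Ω))
    (vf vtf : ℝ → ℝ × E d → ℝ) (vxf : ℝ → ℝ × E d → E d)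
    (vxxf : ℝ → ℝ × E d → Matrix (Fin d) (Fin d) ℝ)
    (hsol : ∀ K : ℝ, 0 < K → SolPlus H P K T Ω g (vf K) (vtf K) (vxf K) (vxxf K) ∧
      ∀ ρ : ℝ, 0 < ρ → LpAll p (PiRho T ρ Ω) (vf K) (vtf K) (vxf K) (vxxf K)) :
    (∀ K₁ K₂ : ℝ, 0 < K₁ → K₁ ≤ K₂ → ∀ q ∈ closure (PiDom T Ω), vf K₂ q ≤ vf K₁ q) ∧
    ∃ v : ℝ × E d → ℝ, ContinuousOn v (closure (PiDom T Ω)) ∧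
      TendstoUniformlyOn (fun K => vf K) v atTop (closure (PiDom T Ω)) ∧
      IsLqViscSol ((d : ℝ) + 1) H (PiDom T Ω) v ∧ Set.EqOn v g (parBdry T Ω) ∧
      ∀ w : ℝ × E d → ℝ, ContinuousOn w (closure (PiDom T Ω)) →
        IsLqViscSubsol ((d : ℝ) + 1) H (PiDom T Ω) w → Set.EqOn w g (parBdry T Ω) →
        ∀ q ∈ closure (PiDom T Ω), w q ≤ v q := by
  have hΩo := hΩ.1
  have hΩb := hΩ.2.2.1
  have hδb1 : δb ≤ 1 := hδbδ.le.trans hδ1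
  have hp1 : (d : ℝ) + 1 ≤ p := by linarith
  have hne : (Ωᶜ).Nonempty := by
    have : Nonempty (Fin d) := ⟨⟨0, hd⟩⟩
    rw [nonempty_compl]
    rintro rfl
    exact NormedSpace.unbounded_univ ℝ (E d) hΩb
  obtain ⟨B, hB0, hH, hF⟩ := exists_struct hδ0 hδ1 hδb0 hδbδ hB hP
  have hs : ∀ K > (0 : ℝ), StrongSol T Ω (maxHam H P K) (vf K) (vtf K) (vxf K) (vxxf K) :=
    fun K hK => strongSol_of_solPlus hp1 hΩo hne (hsol K hK).1 (hsol K hK).2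
  have hsg : ∀ K > (0 : ℝ), EqOn (vf K) g (parBdry T Ω) := fun K hK => (hsol K hK).1.2.2.2
  have hHb : MemLp Hb (d + 1 : ℕ) (volume.restrict (PiInt T Ω)) :=
    memLp_of_le (S := univ) hp1 (by rwa [Measure.restrict_univ]) (subset_univ _)
      (volume_PiInt_lt_top hΩb)
  obtain ⟨hdecr, v, hv, hunif, hvg⟩ := exists_limit hδb0 hδb1 hB0 hT hΩ hF hK₀
    (fun K hK => abs_maxHam_le hB hP hK) hHb hg hs hsg
  refine ⟨hdecr, v, hv, hunif, ⟨?_, ?_⟩, hvg, fun w hw hwsub hwg q hq => ?_⟩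
  · exact subsol_of_limit hδb0 hδb1 hB0 hΩo hH hF hP hB.2.1 hs hv hunif
  · exact supersol_of_limit hδb0 hδb1 hB0 hΩo hH hB.2.1 hs hv hunif
  · refine ge_of_tendsto (hunif.tendsto_at hq) ?_
    filter_upwards [eventually_gt_atTop 0] with K hK
    obtain ⟨hc, hweak, heq, hbd⟩ := (hsol K hK).1
    refine subsol_le_strong hT hΩo hΩb hne hp1 hB.1 hc hweak (hsol K hK).2 ?_ hw hwsub
      (fun q hq => by rw [hwg hq, hbd hq]) q hq
    filter_upwards [heq] with q hq
    have := le_max_left (H (vcons (vf K q) (vxf K q)) (vxxf K q) q) (P (vxxf K q) - K)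
    linarith

end Krylov
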